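/- Let m,n be positive integers and d = m+n. Suppose (μ_k)_{k≥1} is a sequence of a-invariant Borel probability measures on X_d = SL_d(ℝ)/SL_d(ℤ) converging in the weak* topology to the zero measure. Then limsup_{k→∞} h_{μ_k}(a) ≤ m+n−1. -/

import Mathlib

open MeasureTheory Matrix ENNReal Filter Topology

noncomputable section

/-- The supremum norm of a matrix (the maximum of the absolute values of its entries),
obtained from the sup norm on the corresponding function space. -/
def supNorm {p q : ℕ} (M : Matrix (Fin p) (Fin q) ℝ) : ℝ := ‖(Matrix.of.symm M)‖

/-- The diagonal element `a_t = diag(e^{t/m} I_m, e^{-t/n} I_n)`. -/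
def aMat (m n : ℕ) (t : ℝ) : Matrix (Fin (m + n)) (Fin (m + n)) ℝ :=
  Matrix.reindex finSumFinEquiv finSumFinEquiv
    (Matrix.fromBlocks (Real.exp (t / m) • (1 : Matrix (Fin m) (Fin m) ℝ)) 0 0
      (Real.exp (-(t / n)) • (1 : Matrix (Fin n) (Fin n) ℝ)))

/-- The unipotent element `u_A` with upper-right block `A`. -/
def uMat (m n : ℕ) (A : Fin m → Fin n → ℝ) : Matrix (Fin (m + n)) (Fin (m + n)) ℝ :=
  Matrix.reindex finSumFinEquiv finSumFinEquiv
    (Matrix.fromBlocks 1 (Matrix.of A) 0 1)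

lemma uMat_det (m n : ℕ) (A : Fin m → Fin n → ℝ) : (uMat m n A).det = 1 := by
  simp [uMat, Matrix.det_fromBlocks_zero₂₁]

lemma aMat_det (m n : ℕ) (hm : 0 < m) (hn : 0 < n) (t : ℝ) : (aMat m n t).det = 1 := by
  have hm' : (m : ℝ) ≠ 0 := Nat.cast_ne_zero.mpr hm.ne'
  have hn' : (n : ℝ) ≠ 0 := Nat.cast_ne_zero.mpr hn.ne'
  simp only [aMat, Matrix.det_reindex_self, Matrix.det_fromBlocks_zero₂₁,
    Matrix.det_smul, Matrix.det_one, Fintype.card_fin, mul_one]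
  rw [← Real.exp_nat_mul, ← Real.exp_nat_mul, ← Real.exp_add]
  rw [mul_div_cancel₀ _ hm']
  rw [show (n : ℝ) * -(t / n) = -t by field_simp [mul_comm]]
  simp

/-- `a_t` as an element of `SL_{m+n}(ℝ)`. -/
def aSL (m n : ℕ) (hm : 0 < m) (hn : 0 < n) (t : ℝ) :
    Matrix.SpecialLinearGroup (Fin (m + n)) ℝ :=
  ⟨aMat m n t, aMat_det m n hm hn t⟩

/-- `u_A` as an element of `SL_{m+n}(ℝ)`. -/
def uSL (m n : ℕ) (A : Fin m → Fin n → ℝ) : Matrix.SpecialLinearGroup (Fin (m + n)) ℝ :=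
  ⟨uMat m n A, uMat_det m n A⟩

instance SLtop (d : ℕ) : TopologicalSpace (Matrix.SpecialLinearGroup (Fin d) ℝ) :=
  instTopologicalSpaceSubtype

/-- `SL_d(ℤ)` viewed as a subgroup of `SL_d(ℝ)`. -/
def Gamma (d : ℕ) : Subgroup (Matrix.SpecialLinearGroup (Fin d) ℝ) :=
  (Matrix.SpecialLinearGroup.map (n := Fin d) (Int.castRingHom ℝ)).range

/-- The space of unimodular lattices `X_d = SL_d(ℝ)/SL_d(ℤ)`. -/
abbrev XSp (d : ℕ) := Matrix.SpecialLinearGroup (Fin d) ℝ ⧸ Gamma d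

instance (d : ℕ) : MeasurableSpace (XSp d) := borel _

/-- The first successive minimum `λ₁` of the lattice `g ℤ^d` (with respect to the sup norm):
the infimum of all `r` such that the lattice contains a nonzero vector of norm at most `r`. -/
def lam1M (d : ℕ) (g : Matrix (Fin d) (Fin d) ℝ) : ℝ :=
  sInf {r : ℝ | ∃ v : Fin d → ℤ, v ≠ 0 ∧ ‖g.mulVec (fun i => (v i : ℝ))‖ ≤ r}

/-- The first successive minimum `λ₁` of a unimodular lattice `x ∈ X_d`. -/
def lam1X (d : ℕ) (x : XSp d) : ℝ :=
  sInf {r : ℝ | ∃ g : Matrix.SpecialLinearGroup (Fin d) ℝ,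
    (QuotientGroup.mk g : XSp d) = x ∧
    ∃ v : Fin d → ℤ, v ≠ 0 ∧
      ‖(g : Matrix (Fin d) (Fin d) ℝ).mulVec (fun i => (v i : ℝ))‖ ≤ r}

/-- The lattice `g ℤ^d` as a subset of `ℝ^d`. -/
def latticeSet (d : ℕ) (g : Matrix (Fin d) (Fin d) ℝ) : Set (Fin d → ℝ) :=
  Set.range fun v : Fin d → ℤ => g.mulVec (fun i => (v i : ℝ))

/-- Shannon entropy of a finite indexed partition with respect to a measure. -/
def partEnt {α : Type*} [MeasurableSpace α] (μ : Measure α) {ι : Type*} [Fintype ι]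
    (P : ι → Set α) : ℝ :=
  ∑ i, Real.negMulLog (μ (P i)).toReal

/-- The join `⋁_{j<N} T^{-j} P` of a finite partition, indexed by itineraries. -/
def joinPart {α : Type*} (T : α → α) {k : ℕ} (P : Fin k → Set α) (N : ℕ) :
    (Fin N → Fin k) → Set α :=
  fun ω => ⋂ j : Fin N, T^[(j : ℕ)] ⁻¹' P (ω j)

/-- A finite measurable partition of the space. -/
def IsFinPart {α : Type*} [MeasurableSpace α] {k : ℕ} (P : Fin k → Set α) : Prop :=
  (∀ i, MeasurableSet (P i)) ∧ Pairwise (Function.onFun Disjoint P) ∧ (⋃ i, P i) = Set.univ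

/-- Kolmogorov–Sinai (measure-theoretic) entropy of a transformation `T` with respect to `μ`:
the supremum over finite measurable partitions `P` of `inf_N H_μ(⋁_{j<N} T^{-j}P)/N`. -/
def ksEntropy {α : Type*} [MeasurableSpace α] (T : α → α) (μ : Measure α) : ℝ :=
  ⨆ (k : ℕ) (P : Fin k → Set α) (_ : IsFinPart P),
    ⨅ N : ℕ, partEnt μ (joinPart T P (N + 1)) / (N + 1)

/-- The time-one map `x ↦ a x` on the space of lattices `X_{m+n}`. -/
def aAct (m n : ℕ) (hm : 0 < m) (hn : 0 < n) : XSp (m + n) → XSp (m + n) :=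
  fun x => aSL m n hm hn 1 • x

/-- The (topological) support of a measure: points all of whose open neighborhoods have
positive measure. -/
def μsupport {α : Type*} [TopologicalSpace α] [MeasurableSpace α] (μ : Measure α) : Set α :=
  {x | ∀ U : Set α, IsOpen U → x ∈ U → 0 < μ U}

/-! ### Part 1: elementary counting lemmas -/

/-- Layer-cake estimate for sums of `f⁻ᵖ`. -/
lemma layer_sum {ι : Type*} (F : Finset ι) (f : ι → ℝ) (p : ℕ) (C D : ℝ) (hC : 0 ≤ C)
    (h1 : ∀ i ∈ F, 1 ≤ f i) (h2 : ∀ i ∈ F, f i ≤ Real.exp D) (hD : 0 ≤ D)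
    (hc : ∀ R : ℝ, 1 ≤ R → ((F.filter (fun i => f i ≤ R)).card : ℝ) ≤ C * R ^ p) :
    ∑ i ∈ F, ((f i)⁻¹) ^ p ≤ C * Real.exp p * (1 + D) := by
  classical
  have hmaps : ∀ i ∈ F, ⌊Real.log (f i)⌋₊ ∈ Finset.range (⌊D⌋₊ + 1) := by
    intro i hi
    rw [Finset.mem_range, Nat.lt_succ_iff]
    apply Nat.floor_mono
    rw [Real.log_le_iff_le_exp (by linarith [h1 i hi])]
    exact h2 i hi
  rw [← Finset.sum_fiberwise_of_maps_to hmaps]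
  have hin : ∀ k ∈ Finset.range (⌊D⌋₊ + 1),
      ∑ i ∈ F.filter (fun i => ⌊Real.log (f i)⌋₊ = k), ((f i)⁻¹) ^ p ≤ C * Real.exp p := by
    intro k _
    have hterm : ∀ i ∈ F.filter (fun i => ⌊Real.log (f i)⌋₊ = k),
        ((f i)⁻¹) ^ p ≤ (Real.exp (-k)) ^ p := by
      intro i hi
      rw [Finset.mem_filter] at hi
      have hfi := h1 i hi.1
      have hl : (k : ℝ) ≤ Real.log (f i) := by
        rw [← hi.2]; exact Nat.floor_le (Real.log_nonneg hfi)
      apply pow_le_pow_left₀ (by positivity)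
      rw [Real.exp_neg]
      apply inv_anti₀ (Real.exp_pos _)
      rwa [← Real.le_log_iff_exp_le (by linarith)]
    have hcard : ((F.filter (fun i => ⌊Real.log (f i)⌋₊ = k)).card : ℝ)
        ≤ C * (Real.exp (k + 1)) ^ p := by
      refine le_trans ?_ (hc (Real.exp (k + 1)) (Real.one_le_exp (by positivity)))
      norm_cast
      apply Finset.card_le_card
      intro i hi
      rw [Finset.mem_filter] at hi ⊢
      refine ⟨hi.1, ?_⟩
      have hfi := h1 i hi.1
      rw [← Real.log_le_iff_le_exp (by linarith)]
      have := Nat.lt_floor_add_one (Real.log (f i))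
      rw [hi.2] at this
      exact_mod_cast this.le
    calc _ ≤ ∑ i ∈ F.filter (fun i => ⌊Real.log (f i)⌋₊ = k), (Real.exp (-k)) ^ p :=
          Finset.sum_le_sum hterm
      _ = ((F.filter (fun i => ⌊Real.log (f i)⌋₊ = k)).card : ℝ) * (Real.exp (-k)) ^ p := by
          rw [Finset.sum_const, nsmul_eq_mul]
      _ ≤ C * (Real.exp (k + 1)) ^ p * (Real.exp (-k)) ^ p := by gcongr
      _ = C * Real.exp p := by
          rw [mul_assoc, ← mul_pow, ← Real.exp_add, ← Real.exp_nat_mul]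
          congr 2; ring
  calc _ ≤ ∑ k ∈ Finset.range (⌊D⌋₊ + 1), C * Real.exp p := Finset.sum_le_sum hin
    _ = (⌊D⌋₊ + 1) * (C * Real.exp p) := by simp
    _ ≤ (D + 1) * (C * Real.exp p) := by
        gcongr; exact Nat.floor_le hD
    _ = _ := by ring

/-- Integers in `[-M, M]`, as a type. -/
abbrev IccM (M : ℕ) := ↥(Finset.Icc (-(M : ℤ)) M)

lemma card_IccM (M : ℕ) : Fintype.card (IccM M) = 2 * M + 1 := by
  simp; omega

lemma IccM_abs (M : ℕ) (z : IccM M) : |((z : ℤ) : ℝ)| ≤ M := by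
  have := Finset.mem_Icc.1 z.2
  rw [abs_le]; constructor <;> norm_cast <;> linarith [this.1, this.2]

/-- Number of integers in an interval of radius `R`. -/
lemma card_int_le (M : ℕ) (τ R : ℝ) (hR : 1 ≤ R) :
    (((Finset.univ : Finset (IccM M)).filter (fun z : IccM M => |τ + ((z : ℤ) : ℝ)| ≤ R)).card : ℝ) ≤ 3 * R := by
  have h : ((Finset.univ : Finset (IccM M)).filter (fun z : IccM M => |τ + ((z : ℤ) : ℝ)| ≤ R)).card
      ≤ (Finset.Icc ⌈-R - τ⌉ ⌊R - τ⌋).card := by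
    apply Finset.card_le_card_of_injOn (fun z : IccM M => (z : ℤ))
    · intro z hz
      simp only [Finset.coe_filter, Finset.mem_univ, true_and, Set.mem_ofPred_eq, abs_le] at hz
      simp only [Finset.coe_Icc, Set.mem_Icc, Int.ceil_le, Int.le_floor]
      constructor <;> linarith [hz.1, hz.2]
    · intro a _ b _ hab
      exact Subtype.ext hab
  rw [Int.card_Icc] at h
  have h2 : (((⌊R - τ⌋ + 1 - ⌈-R - τ⌉).toNat : ℤ) : ℝ) ≤ 3 * R := by
    rw [Int.toNat_eq_max]
    push_cast
    apply max_le
    · have := Int.floor_le (R - τ)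
      have := Int.le_ceil (-R - τ)
      linarith
    · linarith
  refine le_trans ?_ h2
  exact_mod_cast h

lemma card_pi_le {α : Type*} [Fintype α] [DecidableEq α] (M : ℕ) (τ : α → ℝ) (R : ℝ) (hR : 1 ≤ R) :
    (((Finset.univ : Finset (α → IccM M)).filter
      (fun z => max 1 ‖fun a => τ a + ((z a : ℤ) : ℝ)‖ ≤ R)).card : ℝ)
      ≤ 3 ^ Fintype.card α * R ^ Fintype.card α := by
  classical
  have h : ((Finset.univ : Finset (α → IccM M)).filter
      (fun z => max 1 ‖fun a => τ a + ((z a : ℤ) : ℝ)‖ ≤ R)) ⊆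
      Fintype.piFinset (fun a => (Finset.univ : Finset (IccM M)).filter
        (fun z : IccM M => |τ a + ((z : ℤ) : ℝ)| ≤ R)) := by
    intro z hz
    simp only [Finset.mem_filter, Finset.mem_univ, true_and, Fintype.mem_piFinset] at hz ⊢
    intro a
    have := norm_le_pi_norm (fun a => τ a + ((z a : ℤ) : ℝ)) a
    rw [Real.norm_eq_abs] at this
    exact this.trans ((le_max_right _ _).trans hz)
  calc _ ≤ (((Fintype.piFinset (fun a => (Finset.univ : Finset (IccM M)).filter
        (fun z : IccM M => |τ a + ((z : ℤ) : ℝ)| ≤ R))).card : ℕ) : ℝ) := by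
          exact_mod_cast Finset.card_le_card h
    _ = ∏ a, (((Finset.univ : Finset (IccM M)).filter
        (fun z : IccM M => |τ a + ((z : ℤ) : ℝ)| ≤ R)).card : ℝ) := by
          rw [Fintype.card_piFinset]; push_cast; rfl
    _ ≤ ∏ _a : α, (3 * R) := by
          apply Finset.prod_le_prod
          · intros; positivity
          · intro a _; exact card_int_le M (τ a) R hR
    _ = _ := by rw [Finset.prod_const, Finset.card_univ, mul_pow]

/-- Packing bound. -/
lemma packing {E : Type*} [NormedAddCommGroup E] [NormedSpace ℝ E] [FiniteDimensional ℝ E]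
    (s : Finset E) (ρ R : ℝ) (hρ : 0 < ρ) (hR : 0 ≤ R) (hs : ∀ c ∈ s, ‖c‖ ≤ R)
    (h : ∀ c ∈ s, ∀ d ∈ s, c ≠ d → ρ ≤ ‖c - d‖) :
    (s.card : ℝ) ≤ (1 + 2 * R / ρ) ^ Module.finrank ℝ E := by
  open Metric Function Module in
  borelize E
  let μ : Measure E := Measure.addHaar
  let δ : ℝ := ρ / 2
  let r : ℝ := R + ρ / 2
  have rpos : 0 < r := by positivity
  have I : 0 < δ := by positivity
  set A := ⋃ c ∈ s, ball (c : E) δ with hA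
  have D : Set.Pairwise (s : Set E) (Disjoint on fun c => ball (c : E) δ) := by
    rintro c hc d hd hcd
    apply ball_disjoint_ball
    rw [dist_eq_norm]
    have := h c hc d hd hcd
    simp only [δ]; linarith
  have A_subset : A ⊆ ball (0 : E) r := by
    refine Set.iUnion₂_subset fun x hx => ?_
    apply ball_subset_ball'
    rw [dist_zero_right]
    have := hs x hx
    simp only [δ, r]; linarith
  have I :
    (s.card : ℝ≥0∞) * ENNReal.ofReal (δ ^ finrank ℝ E) * μ (ball 0 1) ≤
      ENNReal.ofReal (r ^ finrank ℝ E) * μ (ball 0 1) :=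
    calc
      (s.card : ℝ≥0∞) * ENNReal.ofReal (δ ^ finrank ℝ E) * μ (ball 0 1) = μ A := by
        rw [hA, measure_biUnion_finset D fun c _ => measurableSet_ball]
        simp only [μ.addHaar_ball_of_pos _ I]
        simp only [Finset.sum_const, nsmul_eq_mul, mul_assoc]
      _ ≤ μ (ball (0 : E) r) := measure_mono A_subset
      _ = ENNReal.ofReal (r ^ finrank ℝ E) * μ (ball 0 1) := by
        simp only [μ.addHaar_ball_of_pos _ rpos]
  have J : (s.card : ℝ≥0∞) * ENNReal.ofReal (δ ^ finrank ℝ E) ≤ ENNReal.ofReal (r ^ finrank ℝ E) :=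
    (ENNReal.mul_le_mul_iff_left (measure_ball_pos _ _ zero_lt_one).ne' measure_ball_lt_top.ne).1 I
  have K := ENNReal.toReal_le_of_le_ofReal (pow_nonneg rpos.le _) J
  rw [ENNReal.toReal_mul, ENNReal.toReal_natCast, ENNReal.toReal_ofReal (by positivity)] at K
  rw [← le_div_iff₀ (by positivity), ← div_pow] at K
  refine K.trans (le_of_eq ?_)
  congr 1
  simp only [r, δ]; field_simp; ring

/-- Inner sum over one column. -/
lemma column_sum {α : Type*} [Fintype α] [DecidableEq α] (M : ℕ) (τ : α → ℝ) (B : ℝ) (hB : 1 ≤ B)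
    (hτ : ∀ z : α → IccM M, ‖fun a => τ a + ((z a : ℤ) : ℝ)‖ ≤ B) :
    ∑ z : α → IccM M, ((max 1 ‖fun a => τ a + ((z a : ℤ) : ℝ)‖)⁻¹) ^ Fintype.card α
      ≤ 3 ^ Fintype.card α * Real.exp (Fintype.card α) * (1 + Real.log B) := by
  apply layer_sum
  · positivity
  · intro z _; exact le_max_left _ _
  · intro z _
    rw [Real.exp_log (by linarith)]
    exact max_le hB (hτ z)
  · exact Real.log_nonneg hB
  · intro R hR; exact card_pi_le M τ R hR

/-- Action on a vector: `X + c Y`. -/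
def cact {α β : Type*} [Fintype β] {M : ℕ} (X : α → ℝ) (Y : β → ℝ) (c : β → α → IccM M) : α → ℝ :=
  fun a => X a + ∑ b, ((c b a : ℤ) : ℝ) * Y b

lemma cact_sub_norm {α β : Type*} [Fintype α] [Fintype β] {M : ℕ} (X : α → ℝ) (Y : β → ℝ)
    (c : β → α → IccM M) (a : α) :
    |∑ b, ((c b a : ℤ) : ℝ) * Y b| ≤ Fintype.card β * M * ‖Y‖ := by
  calc _ ≤ ∑ b, |((c b a : ℤ) : ℝ) * Y b| := Finset.abs_sum_le_sum_abs _ _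
    _ ≤ ∑ _b : β, (M : ℝ) * ‖Y‖ := by
        apply Finset.sum_le_sum
        intro b _
        rw [abs_mul]
        have := norm_le_pi_norm Y b
        rw [Real.norm_eq_abs] at this
        exact mul_le_mul (IccM_abs M _) this (abs_nonneg _) (by positivity)
    _ = _ := by simp [mul_assoc]

lemma count_case1 {α β : Type*} [Fintype α] [DecidableEq α] [Fintype β] [DecidableEq β] (M : ℕ)
    (X : α → ℝ) (Y : β → ℝ) (hX : 0 < ‖X‖) (h : 2 * Fintype.card β * M * ‖Y‖ ≤ ‖X‖) :
    ∑ c : β → α → IccM M, ((max ‖cact X Y c‖ ‖Y‖)⁻¹) ^ Fintype.card α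
      ≤ (2 * M + 1) ^ (Fintype.card α * Fintype.card β) * (2 / ‖X‖) ^ Fintype.card α := by
  have hterm : ∀ c : β → α → IccM M,
      ((max ‖cact X Y c‖ ‖Y‖)⁻¹) ^ Fintype.card α ≤ (2 / ‖X‖) ^ Fintype.card α := by
    intro c
    apply pow_le_pow_left₀ (by positivity)
    rw [← inv_div]
    apply inv_anti₀ (by positivity)
    refine le_trans ?_ (le_max_left _ _)
    have h3 : ‖X‖ ≤ ‖cact X Y c‖ + ‖X‖ / 2 := by
      rw [pi_norm_le_iff_of_nonneg (by positivity)]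
      intro a
      have h1 := norm_le_pi_norm (cact X Y c) a
      have h2 := cact_sub_norm X Y c a
      rw [Real.norm_eq_abs] at h1 ⊢
      have h4 : X a = cact X Y c a - ∑ b, ((c b a : ℤ) : ℝ) * Y b := by simp [cact]
      rw [h4]
      refine (abs_sub _ _).trans ?_
      linarith
    linarith
  calc _ ≤ ∑ c : β → α → IccM M, (2 / ‖X‖) ^ Fintype.card α :=
        Finset.sum_le_sum (fun c _ => hterm c)
    _ = _ := by
      rw [Finset.sum_const, Finset.card_univ, Fintype.card_fun, Fintype.card_fun, card_IccM,
        ← pow_mul]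
      simp

lemma count_case2 {α β : Type*} [Fintype α] [DecidableEq α] [Fintype β] [DecidableEq β] (M : ℕ)
    (hM : 1 ≤ M) (X : α → ℝ) (Y : β → ℝ) (hY : 0 < ‖Y‖)
    (h : ‖X‖ ≤ 2 * Fintype.card β * M * ‖Y‖) :
    ∑ c : β → α → IccM M, ((max ‖cact X Y c‖ ‖Y‖)⁻¹) ^ Fintype.card α
      ≤ (2 * M + 1) ^ (Fintype.card α * (Fintype.card β - 1)) *
        (3 ^ Fintype.card α * Real.exp (Fintype.card α) * (1 + Real.log (4 * Fintype.card β * M)))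
          * (‖Y‖⁻¹) ^ Fintype.card α := by
  classical
  have hne : Nonempty β := by
    by_contra hh
    rw [not_nonempty_iff] at hh
    rw [Subsingleton.elim Y 0] at hY
    simp at hY
  obtain ⟨b, hb⟩ : ∃ b, ‖Y b‖ = ‖Y‖ := by
    obtain ⟨b, _, hb⟩ := Finset.exists_max_image Finset.univ (fun b => ‖Y b‖) Finset.univ_nonempty
    refine ⟨b, le_antisymm (norm_le_pi_norm Y b) ?_⟩
    rw [pi_norm_le_iff_of_nonneg (norm_nonneg _)]
    exact fun i => hb i (Finset.mem_univ _)
  have hYb : Y b ≠ 0 := by intro h0; rw [h0, norm_zero] at hb; linarith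
  have hq : (1 : ℝ) ≤ Fintype.card β := by exact_mod_cast Fintype.card_pos
  have hM' : (1 : ℝ) ≤ M := by exact_mod_cast hM
  have hqM : (1 : ℝ) ≤ Fintype.card β * M := one_le_mul_of_one_le_of_one_le hq hM'
  rw [← (Equiv.funSplitAt b (α → IccM M)).symm.sum_comp, Fintype.sum_prod_type, Finset.sum_comm]
  have hinner : ∀ r : {j // j ≠ b} → α → IccM M,
      ∑ z : α → IccM M, ((max ‖cact X Y ((Equiv.funSplitAt b (α → IccM M)).symm (z, r))‖ ‖Y‖)⁻¹)
        ^ Fintype.card α ≤ (3 ^ Fintype.card α * Real.exp (Fintype.card α) *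
          (1 + Real.log (4 * Fintype.card β * M))) * (‖Y‖⁻¹) ^ Fintype.card α := by
    intro r
    let τ : α → ℝ := fun a => (X a + ∑ j : {j // j ≠ b}, ((r j a : ℤ) : ℝ) * Y j) / Y b
    have hc : ∀ z : α → IccM M, ∀ a, cact X Y ((Equiv.funSplitAt b (α → IccM M)).symm (z, r)) a =
        Y b * (τ a + ((z a : ℤ) : ℝ)) := by
      intro z a
      simp only [cact, τ]
      rw [← Finset.add_sum_erase Finset.univ _ (Finset.mem_univ b)]
      have : ∑ x ∈ Finset.univ.erase b,
          ((((Equiv.funSplitAt b (α → IccM M)).symm (z, r)) x a : ℤ) : ℝ) * Y x =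
          ∑ j : {j // j ≠ b}, ((r j a : ℤ) : ℝ) * Y j := by
        rw [Finset.sum_subtype (Finset.univ.erase b) (p := fun j => j ≠ b) (by simp)]
        apply Finset.sum_congr rfl
        rintro ⟨j, hj⟩ _
        simp [Equiv.funSplitAt, hj]
      rw [this]
      simp [Equiv.funSplitAt]
      field_simp
      ring
    have hn : ∀ z : α → IccM M, ‖cact X Y ((Equiv.funSplitAt b (α → IccM M)).symm (z, r))‖ =
        ‖Y‖ * ‖fun a => τ a + ((z a : ℤ) : ℝ)‖ := by
      intro z
      have : cact X Y ((Equiv.funSplitAt b (α → IccM M)).symm (z, r)) =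
        Y b • (fun a => τ a + ((z a : ℤ) : ℝ)) := by
        ext a; rw [hc]; simp
      rw [this, norm_smul, hb]
    have hB : ∀ z : α → IccM M, ‖fun a => τ a + ((z a : ℤ) : ℝ)‖ ≤ 4 * Fintype.card β * M := by
      intro z
      have h1 : ‖cact X Y ((Equiv.funSplitAt b (α → IccM M)).symm (z, r))‖
          ≤ 3 * Fintype.card β * M * ‖Y‖ := by
        rw [pi_norm_le_iff_of_nonneg (by positivity)]
        intro a
        have h2 := cact_sub_norm X Y ((Equiv.funSplitAt b (α → IccM M)).symm (z, r)) a
        have h3 := norm_le_pi_norm X a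
        rw [Real.norm_eq_abs] at h3 ⊢
        refine (abs_add_le _ _).trans ?_
        linarith
      rw [hn, mul_comm] at h1
      have h4 := le_of_mul_le_mul_right h1 hY
      nlinarith
    have hcs := column_sum M τ (4 * Fintype.card β * M) (by nlinarith) hB
    have heq : ∀ z : α → IccM M,
        ((max ‖cact X Y ((Equiv.funSplitAt b (α → IccM M)).symm (z, r))‖ ‖Y‖)⁻¹) ^ Fintype.card α =
        ((max 1 ‖fun a => τ a + ((z a : ℤ) : ℝ)‖)⁻¹) ^ Fintype.card α *
          (‖Y‖⁻¹) ^ Fintype.card α := by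
      intro z
      rw [hn, ← mul_pow, ← mul_inv, max_mul_of_nonneg _ _ hY.le, max_comm, one_mul, mul_comm ‖Y‖]
    simp_rw [heq]
    rw [← Finset.sum_mul]
    gcongr
  calc _ ≤ ∑ r : {j // j ≠ b} → α → IccM M, (3 ^ Fintype.card α * Real.exp (Fintype.card α) *
          (1 + Real.log (4 * Fintype.card β * M))) * (‖Y‖⁻¹) ^ Fintype.card α :=
        Finset.sum_le_sum (fun r _ => hinner r)
    _ = _ := by
      rw [Finset.sum_const, Finset.card_univ, Fintype.card_fun, Fintype.card_fun, card_IccM,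
        ← pow_mul]
      have : Fintype.card {j // j ≠ b} = Fintype.card β - 1 := by
        rw [Fintype.card_subtype_compl]; simp
      rw [this]
      simp
      ring

/-- The main counting lemma. -/
lemma count_sum {α β : Type*} [Fintype α] [DecidableEq α] [Fintype β] [DecidableEq β] [Nonempty β]
    (M : ℕ) (hM : 1 ≤ M) (e1 e2 : ℝ) (h1 : 0 < e1) (h2 : 0 < e2) (hM1 : e1 / e2 ≤ M)
    (hM2 : M ≤ 2 * (e1 / e2)) (x : α → ℝ) (y : β → ℝ) (hv : 0 < max ‖x‖ ‖y‖) :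
    ∑ c : β → α → IccM M, ((max ‖cact (e1 • x) (e2 • y) c‖ ‖e2 • y‖)⁻¹) ^ Fintype.card α
      ≤ (2 * M + 1) ^ (Fintype.card α * Fintype.card β) *
        ((12 * Fintype.card β) ^ Fintype.card α * Real.exp (Fintype.card α) *
          (1 + Real.log (4 * Fintype.card β * M))) * ((e1 * max ‖x‖ ‖y‖)⁻¹) ^ Fintype.card α := by
  have hq : (1 : ℝ) ≤ Fintype.card β := by exact_mod_cast Fintype.card_pos
  have hM' : (1 : ℝ) ≤ M := by exact_mod_cast hM
  have hqM : (1 : ℝ) ≤ Fintype.card β * M := one_le_mul_of_one_le_of_one_le hq hM'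
  have hlog : 0 ≤ Real.log (4 * Fintype.card β * M) := Real.log_nonneg (by nlinarith)
  have hexp : (1 : ℝ) ≤ Real.exp (Fintype.card α) := Real.one_le_exp (by positivity)
  have hX : ‖e1 • x‖ = e1 * ‖x‖ := by rw [norm_smul, Real.norm_eq_abs, abs_of_pos h1]
  have hY : ‖e2 • y‖ = e2 * ‖y‖ := by rw [norm_smul, Real.norm_eq_abs, abs_of_pos h2]
  rw [div_le_iff₀ h2] at hM1
  rw [← mul_div_assoc, le_div_iff₀ h2] at hM2
  rcases le_or_gt (2 * Fintype.card β * M * ‖e2 • y‖) ‖e1 • x‖ with h | h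
  · have hxy : ‖y‖ ≤ ‖x‖ := by
      rw [hX, hY] at h
      have : e1 * ‖y‖ ≤ e1 * ‖x‖ := by
        refine le_trans ?_ h
        calc e1 * ‖y‖ ≤ (M * e2) * ‖y‖ := by gcongr
          _ = 1 * 1 * (M * (e2 * ‖y‖)) := by ring
          _ ≤ 2 * Fintype.card β * (M * (e2 * ‖y‖)) := by gcongr; norm_num
          _ = _ := by ring
      exact le_of_mul_le_mul_left this h1
    rw [max_eq_left hxy] at hv ⊢
    have hXp : 0 < ‖e1 • x‖ := by rw [hX]; positivity
    refine (count_case1 M _ _ hXp h).trans ?_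
    rw [mul_assoc]
    apply mul_le_mul_of_nonneg_left _ (by positivity)
    rw [div_eq_mul_inv, mul_pow, hX]
    apply mul_le_mul_of_nonneg_right _ (by positivity)
    calc (2 : ℝ) ^ Fintype.card α = 2 ^ Fintype.card α * 1 * 1 := by ring
      _ ≤ _ := by
        gcongr
        · linarith
        · linarith
  · have hyp : 0 < ‖e2 • y‖ := by
      by_contra hh
      have h0 : ‖e2 • y‖ = 0 := le_antisymm (not_lt.1 hh) (norm_nonneg _)
      rw [h0, mul_zero] at h
      linarith [norm_nonneg (e1 • x)]
    refine (count_case2 M hM _ _ hyp h.le).trans ?_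
    have hyp' : 0 < ‖y‖ := by
      rw [hY] at hyp; exact pos_of_mul_pos_right hyp h2.le
    have hxy : max ‖x‖ ‖y‖ ≤ 4 * Fintype.card β * ‖y‖ := by
      apply max_le
      · rw [hX, hY] at h
        have : e1 * ‖x‖ ≤ e1 * (4 * Fintype.card β * ‖y‖) := by
          refine h.le.trans ?_
          calc _ = 2 * Fintype.card β * (M * e2) * ‖y‖ := by ring
            _ ≤ 2 * Fintype.card β * (2 * e1) * ‖y‖ := by gcongr
            _ = _ := by ring
        exact le_of_mul_le_mul_left this h1
      · nlinarith
    have hkey : ‖e2 • y‖⁻¹ ≤ (2 * M + 1) * (4 * Fintype.card β) * (e1 * max ‖x‖ ‖y‖)⁻¹ := by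
      rw [hY, ← div_eq_mul_inv, inv_eq_one_div, div_le_div_iff₀ (by positivity) (by positivity)]
      calc 1 * (e1 * max ‖x‖ ‖y‖) ≤ 1 * ((M * e2) * (4 * Fintype.card β * ‖y‖)) := by gcongr
        _ = M * (4 * Fintype.card β) * (e2 * ‖y‖) := by ring
        _ ≤ _ := by gcongr; linarith
    obtain ⟨q', hq'⟩ : ∃ q', Fintype.card β = q' + 1 :=
      ⟨Fintype.card β - 1, (Nat.sub_add_cancel Fintype.card_pos).symm⟩
    calc _ ≤ (2 * M + 1 : ℝ) ^ (Fintype.card α * (Fintype.card β - 1)) *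
        (3 ^ Fintype.card α * Real.exp (Fintype.card α) * (1 + Real.log (4 * Fintype.card β * M)))
          * ((2 * M + 1) * (4 * Fintype.card β) * (e1 * max ‖x‖ ‖y‖)⁻¹) ^ Fintype.card α := by
          gcongr
      _ = _ := by
        have e3 : (12 * (Fintype.card β : ℝ)) = 3 * (4 * Fintype.card β) := by ring
        rw [e3, mul_pow, mul_pow, mul_pow 3]
        have e4 : (2 * M + 1 : ℝ) ^ (Fintype.card α * Fintype.card β) =
          (2 * M + 1 : ℝ) ^ (Fintype.card α * (Fintype.card β - 1)) *
            (2 * M + 1 : ℝ) ^ Fintype.card α := by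
          rw [← pow_add]; congr 1; rw [hq']; simp; ring
        rw [e4]; ring

/-! ### Part 2: lattices -/

/-- integer vector as real vector -/
def zv {d : ℕ} (z : Fin d → ℤ) : Fin d → ℝ := fun i => (z i : ℝ)

lemma zv_norm_ge {d : ℕ} (z : Fin d → ℤ) (hz : z ≠ 0) : 1 ≤ ‖zv z‖ := by
  obtain ⟨i, hi⟩ := Function.ne_iff.1 hz
  refine le_trans ?_ (norm_le_pi_norm (zv z) i)
  simp only [zv, Real.norm_eq_abs]
  rw [← Int.cast_abs]
  exact_mod_cast Int.one_le_abs hi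

lemma zv_ne {d : ℕ} (z : Fin d → ℤ) (hz : z ≠ 0) : zv z ≠ 0 := by
  intro h
  have := zv_norm_ge z hz
  rw [h, norm_zero] at this
  linarith

lemma zv_inj {d : ℕ} : Function.Injective (zv (d := d)) := by
  intro a b h
  ext i
  have := congrFun h i
  simpa [zv] using this

lemma zv_sub {d : ℕ} (a b : Fin d → ℤ) : zv (a - b) = zv a - zv b := by
  ext i; simp [zv]

/-- entrywise l1 norm -/
def nb {d : ℕ} (B : Matrix (Fin d) (Fin d) ℝ) : ℝ := ∑ i, ∑ j, |B i j|

lemma nb_nonneg {d : ℕ} (B : Matrix (Fin d) (Fin d) ℝ) : 0 ≤ nb B :=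
  Finset.sum_nonneg fun _ _ => Finset.sum_nonneg fun _ _ => abs_nonneg _

lemma nb_mulVec {d : ℕ} (B : Matrix (Fin d) (Fin d) ℝ) (v : Fin d → ℝ) :
    ‖B *ᵥ v‖ ≤ nb B * ‖v‖ := by
  rw [pi_norm_le_iff_of_nonneg (mul_nonneg (nb_nonneg B) (norm_nonneg _))]
  intro i
  rw [Real.norm_eq_abs]
  calc |(B *ᵥ v) i| ≤ ∑ j, |B i j * v j| := by
        show |∑ j, B i j * v j| ≤ _
        exact Finset.abs_sum_le_sum_abs _ _
    _ ≤ ∑ j, |B i j| * ‖v‖ := by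
        apply Finset.sum_le_sum; intro j _
        rw [abs_mul]
        exact mul_le_mul_of_nonneg_left (norm_le_pi_norm v j) (abs_nonneg _)
    _ = (∑ j, |B i j|) * ‖v‖ := by rw [Finset.sum_mul]
    _ ≤ nb B * ‖v‖ := by
        apply mul_le_mul_of_nonneg_right _ (norm_nonneg _)
        exact Finset.single_le_sum (f := fun i => ∑ j, |B i j|)
          (fun _ _ => Finset.sum_nonneg fun _ _ => abs_nonneg _) (Finset.mem_univ i)

/-- first minimum of the lattice `h ℤ^d` (sup norm) -/
def lam {d : ℕ} (h : Matrix (Fin d) (Fin d) ℝ) : ℝ :=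
  ⨅ z : {z : Fin d → ℤ // z ≠ 0}, ‖h *ᵥ zv z.1‖

lemma lam_bdd {d : ℕ} (h : Matrix (Fin d) (Fin d) ℝ) :
    BddBelow (Set.range fun z : {z : Fin d → ℤ // z ≠ 0} => ‖h *ᵥ zv z.1‖) :=
  ⟨0, by rintro _ ⟨z, rfl⟩; exact norm_nonneg _⟩

lemma lam_le {d : ℕ} (h : Matrix (Fin d) (Fin d) ℝ) (z : Fin d → ℤ) (hz : z ≠ 0) :
    lam h ≤ ‖h *ᵥ zv z‖ :=
  ciInf_le (lam_bdd h) ⟨z, hz⟩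

lemma nonempty_z {d : ℕ} (hd : 0 < d) : Nonempty {z : Fin d → ℤ // z ≠ 0} :=
  ⟨⟨fun _ => 1, fun h => by simpa using congrFun h ⟨0, hd⟩⟩⟩

lemma le_lam {d : ℕ} (hd : 0 < d) (h : Matrix (Fin d) (Fin d) ℝ) (r : ℝ)
    (hr : ∀ z : Fin d → ℤ, z ≠ 0 → r ≤ ‖h *ᵥ zv z‖) : r ≤ lam h := by
  have := nonempty_z hd
  exact le_ciInf fun z => hr z.1 z.2

lemma exists_lt_lam {d : ℕ} (hd : 0 < d) (h : Matrix (Fin d) (Fin d) ℝ) (r : ℝ) (hr : lam h < r) :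
    ∃ z : Fin d → ℤ, z ≠ 0 ∧ ‖h *ᵥ zv z‖ < r := by
  have := nonempty_z hd
  obtain ⟨z, hz⟩ := exists_lt_of_ciInf_lt hr
  exact ⟨z.1, z.2, hz⟩

lemma lower_of_inv {d : ℕ} (h : Matrix (Fin d) (Fin d) ℝ) (hh : h.det = 1) (v : Fin d → ℝ) :
    ‖v‖ ≤ nb h⁻¹ * ‖h *ᵥ v‖ := by
  have : v = h⁻¹ *ᵥ (h *ᵥ v) := by
    rw [Matrix.mulVec_mulVec, Matrix.nonsing_inv_mul _ (by simp [hh]), Matrix.one_mulVec]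
  conv_lhs => rw [this]
  exact nb_mulVec _ _

lemma nb_inv_pos {d : ℕ} (hd : 0 < d) (h : Matrix (Fin d) (Fin d) ℝ) (hh : h.det = 1) :
    0 < nb h⁻¹ := by
  have h1 := lower_of_inv h hh (zv (fun _ => 1))
  have h2 : (1 : ℝ) ≤ ‖zv (d := d) (fun _ => 1)‖ := by
    apply zv_norm_ge
    intro h; simpa using congrFun h ⟨0, hd⟩
  by_contra h3
  have h4 : nb h⁻¹ = 0 := le_antisymm (not_lt.1 h3) (nb_nonneg _)
  rw [h4, zero_mul] at h1
  linarith

lemma lam_pos {d : ℕ} (hd : 0 < d) (h : Matrix (Fin d) (Fin d) ℝ) (hh : h.det = 1) : 0 < lam h := by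
  refine lt_of_lt_of_le (inv_pos.2 (nb_inv_pos hd h hh)) (le_lam hd h _ fun z hz => ?_)
  rw [inv_le_iff_one_le_mul₀' (nb_inv_pos hd h hh)]
  exact (zv_norm_ge z hz).trans (lower_of_inv h hh _)

/-- comparison of first minima -/
lemma lam_mul_le {d : ℕ} (hd : 0 < d) (B h : Matrix (Fin d) (Fin d) ℝ) (κ : ℝ) (hκ : 0 < κ)
    (hB : ∀ v, ‖B *ᵥ v‖ ≤ κ * ‖v‖) : lam (B * h) ≤ κ * lam h := by
  rw [← div_le_iff₀' hκ]
  apply le_lam hd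
  intro z hz
  rw [div_le_iff₀' hκ]
  refine (lam_le (B * h) z hz).trans ?_
  rw [← Matrix.mulVec_mulVec]
  exact hB _

lemma lam_le_mul {d : ℕ} (hd : 0 < d) (B h : Matrix (Fin d) (Fin d) ℝ) (κ : ℝ) (hκ : 0 < κ)
    (hB : ∀ v, ‖v‖ ≤ κ * ‖B *ᵥ v‖) : lam h ≤ κ * lam (B * h) := by
  rw [← div_le_iff₀' hκ]
  apply le_lam hd
  intro z hz
  rw [div_le_iff₀' hκ, ← Matrix.mulVec_mulVec]
  exact (lam_le h z hz).trans (hB _)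

lemma finite_short {d : ℕ} (h : Matrix (Fin d) (Fin d) ℝ) (hh : h.det = 1) (R : ℝ) :
    {z : Fin d → ℤ | ‖h *ᵥ zv z‖ ≤ R}.Finite := by
  have : {z : Fin d → ℤ | ‖h *ᵥ zv z‖ ≤ R} ⊆
      Set.pi Set.univ (fun _ => Set.Icc (-⌈nb h⁻¹ * R⌉) ⌈nb h⁻¹ * R⌉) := by
    intro z hz i _
    have h1 := (lower_of_inv h hh (zv z)).trans (mul_le_mul_of_nonneg_left hz (nb_nonneg _))
    have h2 := (norm_le_pi_norm (zv z) i).trans h1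
    rw [Real.norm_eq_abs] at h2
    have h3 := h2.trans (Int.le_ceil _)
    simp only [zv] at h3
    rw [Set.mem_Icc, ← abs_le]
    exact_mod_cast h3
  exact (Set.Finite.pi' fun _ => Set.finite_Icc _ _).subset (by
    intro z hz i; exact this hz i trivial)

/-- Minkowski's theorem for boxes. -/
lemma minkowski_box {d : ℕ} (h : Matrix (Fin d) (Fin d) ℝ) (hh : |h.det| = 1) (r : Fin d → ℝ)
    (hr : ∀ i, 0 < r i) (hp : 1 < ∏ i, r i) :
    ∃ z : Fin d → ℤ, z ≠ 0 ∧ ∀ i, |(h *ᵥ zv z) i| < r i := by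
  let b := Pi.basisFun ℝ (Fin d)
  let L := (Submodule.span ℤ (Set.range b)).toAddSubgroup
  have hF : IsAddFundamentalDomain L (ZSpan.fundamentalDomain b) volume :=
    ZSpan.isAddFundamentalDomain b volume
  let box : Set (Fin d → ℝ) := Set.pi Set.univ fun i => Set.Ioo (-(r i)) (r i)
  let s : Set (Fin d → ℝ) := (Matrix.toLin' h) ⁻¹' box
  have hmem : ∀ x, x ∈ s ↔ ∀ i, |(h *ᵥ x) i| < r i := by
    intro x
    simp only [s, box, Set.mem_preimage, Set.mem_pi, Set.mem_univ, true_implies, Set.mem_Ioo,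
      Matrix.toLin'_apply, abs_lt]
  have hsymm : ∀ x ∈ s, -x ∈ s := by
    intro x hx
    rw [hmem] at hx ⊢
    intro i
    rw [Matrix.mulVec_neg, Pi.neg_apply, abs_neg]; exact hx i
  have hconv : Convex ℝ s := by
    apply Convex.linear_preimage
    exact convex_pi fun i _ => convex_Ioo _ _
  have hdet : LinearMap.det (Matrix.toLin' h) ≠ 0 := by
    rw [LinearMap.det_toLin']
    intro h0; rw [h0] at hh; simp at hh
  have hvol : volume s = ENNReal.ofReal (∏ i, (2 * r i)) := by
    simp only [s]
    rw [Measure.addHaar_preimage_linearMap _ hdet, LinearMap.det_toLin', abs_inv, hh]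
    simp only [box]
    rw [Real.volume_pi_Ioo]
    simp only [inv_one, ENNReal.ofReal_one, one_mul]
    rw [← ENNReal.ofReal_prod_of_nonneg]
    · congr 1; apply Finset.prod_congr rfl; intro i _; ring
    · intro i _; linarith [hr i]
  have hF1 : volume (ZSpan.fundamentalDomain b) = 1 := by
    simp only [b]
    rw [ZSpan.fundamentalDomain_pi_basisFun, Real.volume_pi_Ico]
    simp
  have hlt : volume (ZSpan.fundamentalDomain b) * 2 ^ Module.finrank ℝ (Fin d → ℝ) < volume s := by
    rw [hF1, hvol, one_mul, Module.finrank_fin_fun, Finset.prod_mul_distrib, Finset.prod_const,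
      Finset.card_univ, Fintype.card_fin]
    rw [show (2 : ℝ≥0∞) ^ d = ENNReal.ofReal (2 ^ d) by
      rw [ENNReal.ofReal_pow (by norm_num)]; simp]
    rw [ENNReal.ofReal_lt_ofReal_iff (by positivity)]
    have : (0 : ℝ) < 2 ^ d := by positivity
    nlinarith
  have : Countable L := by
    have : Countable (Submodule.span ℤ (Set.range b)) := inferInstance
    exact this
  obtain ⟨x, hx0, hxs⟩ := exists_ne_zero_mem_lattice_of_measure_mul_two_pow_lt_measure hF hsymm
    hconv hlt
  have hxL : (x : Fin d → ℝ) ∈ Submodule.span ℤ (Set.range b) := x.2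
  rw [Module.Basis.mem_span_iff_repr_mem] at hxL
  choose z hz using hxL
  have hxz : (x : Fin d → ℝ) = zv z := by
    ext i
    have := hz i
    simp [b] at this
    simp [zv, this]
  refine ⟨z, ?_, ?_⟩
  · rintro rfl
    apply hx0
    apply Subtype.ext
    rw [hxz]
    ext i; simp [zv]
  · rw [hmem, hxz] at hxs
    exact hxs

lemma lam_le_one {d : ℕ} (hd : 0 < d) (h : Matrix (Fin d) (Fin d) ℝ) (hh : h.det = 1) :
    lam h ≤ 1 := by
  apply le_of_forall_gt
  intro r hr
  obtain ⟨s, hs1, hs2⟩ := exists_between hr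
  have : Nonempty (Fin d) := ⟨⟨0, hd⟩⟩
  obtain ⟨z, hz, hzr⟩ := minkowski_box h (by simp [hh]) (fun _ => s) (fun _ => by linarith)
    (by rw [Finset.prod_const, Finset.card_univ, Fintype.card_fin]; exact one_lt_pow₀ hs1 hd.ne')
  refine lt_of_le_of_lt (lam_le h z hz) (lt_of_le_of_lt ?_ hs2)
  rw [pi_norm_le_iff_of_nonneg (by linarith)]
  intro i; exact (hzr i).le

/-- orthogonal matrix adapted to a subspace -/
lemma exists_adapted {d : ℕ} (E : Submodule ℝ (Fin d → ℝ)) :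
    ∃ O : Matrix (Fin d) (Fin d) ℝ, O * Oᵀ = 1 ∧ Oᵀ * O = 1 ∧
      (∀ v ∈ E, ∀ i : Fin d, Module.finrank ℝ E ≤ i → (O *ᵥ v) i = 0) ∧
      (∀ y, (∀ v ∈ E, v ⬝ᵥ y = 0) → ∀ i : Fin d, (i : ℕ) < Module.finrank ℝ E → (O *ᵥ y) i = 0) := by
  classical
  let e := (WithLp.linearEquiv 2 ℝ (Fin d → ℝ)).symm
  let E' : Submodule ℝ (EuclideanSpace ℝ (Fin d)) := E.map e.toLinearMap
  have hk : Module.finrank ℝ E' = Module.finrank ℝ E := LinearEquiv.finrank_map_eq e E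
  let ob := stdOrthonormalBasis ℝ E'
  let v : Fin d → EuclideanSpace ℝ (Fin d) := fun i =>
    if h : (i : ℕ) < Module.finrank ℝ E' then (ob ⟨i, h⟩ : EuclideanSpace ℝ (Fin d)) else 0
  let s : Set (Fin d) := {i | (i : ℕ) < Module.finrank ℝ E'}
  have hv : Orthonormal ℝ (s.domRestrict v) := by
    have h1 : Orthonormal ℝ (fun i => (ob i : EuclideanSpace ℝ (Fin d))) :=
      ob.orthonormal.comp_linearIsometry E'.subtypeₗᵢ
    have h2 := h1.comp (fun i : s => (⟨i.1, i.2⟩ : Fin (Module.finrank ℝ E'))) (by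
      intro a b hab
      simp only [Fin.mk.injEq] at hab
      exact Subtype.ext (Fin.ext hab))
    convert h2 using 1
    ext1 i
    have := i.2
    simp only [s, Set.mem_ofPred_eq] at this
    simp [v, Set.domRestrict, this]
  obtain ⟨b, hb⟩ := hv.exists_orthonormalBasis_extension_of_card_eq (by simp)
  have hin : ∀ i (w : Fin d → ℝ), ∑ j, b i j * w j = inner ℝ (b i) (e w) := by
    intro i w
    simp [e, PiLp.inner_apply, mul_comm]
  let O : Matrix (Fin d) (Fin d) ℝ := Matrix.of fun i j => b i j
  have hO : O * Oᵀ = 1 := by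
    ext i j
    rw [Matrix.mul_apply]
    simp only [O, Matrix.of_apply, Matrix.transpose_apply]
    have h3 := hin i (fun k => b j k)
    have h4 : e (fun k => b j k) = b j := by ext k; simp [e]
    rw [h3, h4, orthonormal_iff_ite.1 b.orthonormal i j, Matrix.one_apply]
  have hOv : ∀ w i, (O *ᵥ w) i = inner ℝ (b i) (e w) := by
    intro w i
    rw [← hin]; rfl
  have hbmem : ∀ i : Fin d, (i : ℕ) < Module.finrank ℝ E' → b i ∈ E' := by
    intro i hi
    rw [hb i hi]
    simp [v, hi]
  refine ⟨O, hO, mul_eq_one_comm.1 hO, ?_, ?_⟩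
  · intro w hw i hi
    rw [hOv]
    have hw' : e w ∈ E' := Submodule.mem_map_of_mem hw
    have : (⟨e w, hw'⟩ : E') = ∑ j, ob.repr ⟨e w, hw'⟩ j • ob j := (ob.sum_repr _).symm
    have h5 : e w = ∑ j, ob.repr ⟨e w, hw'⟩ j • (ob j : EuclideanSpace ℝ (Fin d)) := by
      have := congrArg (Subtype.val) this
      simpa using this
    rw [h5, inner_sum]
    apply Finset.sum_eq_zero
    intro j _
    rw [inner_smul_right]
    have hjd : (j : ℕ) < d := by
      have := Submodule.finrank_le E'
      simp at this
      exact lt_of_lt_of_le j.2 this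
    have h6 : (ob j : EuclideanSpace ℝ (Fin d)) = b ⟨j, hjd⟩ := by
      rw [hb ⟨j, hjd⟩ j.2]
      simp [v]
    rw [h6, orthonormal_iff_ite.1 b.orthonormal i ⟨j, hjd⟩, if_neg, mul_zero]
    intro h7
    have := j.2
    rw [h7] at hi
    simp at hi; omega
  · intro y hy i hi
    rw [hOv]
    obtain ⟨w, hw, hw2⟩ := hbmem i (by rw [hk]; exact hi)
    rw [← hw2]
    have := hy w hw
    simp only [e]
    simp [PiLp.inner_apply]
    simp [dotProduct] at this
    rw [← this]
    apply Finset.sum_congr rfl; intro j _; ring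

lemma orth_entry {d : ℕ} (O : Matrix (Fin d) (Fin d) ℝ) (hO : O * Oᵀ = 1) (i j : Fin d) :
    |O i j| ≤ 1 := by
  have h1 : ∑ k, O i k * O i k = 1 := by
    have := congrFun (congrFun hO i) i
    rw [Matrix.mul_apply] at this
    simpa using this
  have h2 : O i j * O i j ≤ ∑ k, O i k * O i k :=
    Finset.single_le_sum (f := fun k => O i k * O i k) (fun k _ => mul_self_nonneg _)
      (Finset.mem_univ j)
  rw [abs_le_one_iff_mul_self_le_one]
  linarith

lemma orth_norm {d : ℕ} (O : Matrix (Fin d) (Fin d) ℝ) (hO : ∀ i j, |O i j| ≤ 1) (v : Fin d → ℝ)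
    (R : ℝ) (hR : ∀ i, |v i| ≤ R) (i : Fin d) : |(O *ᵥ v) i| ≤ d * R := by
  calc |(O *ᵥ v) i| ≤ ∑ j, |O i j * v j| := by
        show |∑ j, O i j * v j| ≤ _
        exact Finset.abs_sum_le_sum_abs _ _
    _ ≤ ∑ _j : Fin d, R := by
        apply Finset.sum_le_sum; intro j _
        rw [abs_mul]
        calc _ ≤ 1 * |v j| := mul_le_mul_of_nonneg_right (hO i j) (abs_nonneg _)
          _ ≤ R := by rw [one_mul]; exact hR j
    _ = d * R := by simp

lemma orth_det {d : ℕ} (O : Matrix (Fin d) (Fin d) ℝ) (hO : O * Oᵀ = 1) : |O.det| = 1 := by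
  have h1 := congrArg Matrix.det hO
  rw [Matrix.det_mul, Matrix.det_transpose, Matrix.det_one] at h1
  have : |O.det| * |O.det| = 1 := by rw [← abs_mul, h1, abs_one]
  nlinarith [abs_nonneg O.det]

/-- product of a two-valued function -/
lemma prod_two {d k : ℕ} (hk : k ≤ d) (a b : ℝ) :
    ∏ i : Fin d, (if (i : ℕ) < k then a else b) = a ^ k * b ^ (d - k) := by
  rw [Finset.prod_ite, Finset.prod_const, Finset.prod_const]
  have h1 : (Finset.univ.filter (fun i : Fin d => (i : ℕ) < k)).card = k := by
    rw [Fin.card_filter_val_lt]; exact min_eq_right hk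
  have h2 := Finset.card_filter_add_card_filter_not (s := (Finset.univ : Finset (Fin d)))
    (fun i : Fin d => (i : ℕ) < k)
  rw [h1, Finset.card_univ, Fintype.card_fin] at h2
  rw [h1]
  congr 2; omega

/-- span of short vectors -/
def shortSpan {d : ℕ} (h : Matrix (Fin d) (Fin d) ℝ) (ρ : ℝ) : Submodule ℝ (Fin d → ℝ) :=
  Submodule.span ℝ {v | ∃ z : Fin d → ℤ, v = h *ᵥ zv z ∧ ‖v‖ ≤ ρ}

lemma dual_vec {d : ℕ} (hd : 0 < d) (h : Matrix (Fin d) (Fin d) ℝ) (hh : h.det = 1) (ρ R : ℝ)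
    (hρ : 0 < ρ) (hR : 0 < R)
    (hcond : 1 < ((2 * d ^ 2 * ρ)⁻¹) ^ Module.finrank ℝ (shortSpan h ρ) *
      R ^ (d - Module.finrank ℝ (shortSpan h ρ))) :
    ∃ z : Fin d → ℤ, z ≠ 0 ∧ ‖(h⁻¹)ᵀ *ᵥ zv z‖ ≤ d * R := by
  obtain ⟨O, hO1, hO2, hO3, hO4⟩ := exists_adapted (shortSpan h ρ)
  set k := Module.finrank ℝ (shortSpan h ρ) with hk
  have hkd : k ≤ d := by
    have := Submodule.finrank_le (shortSpan h ρ)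
    simpa using this
  have hd' : (1 : ℝ) ≤ d := by exact_mod_cast hd
  have hdet : |(O * (h⁻¹)ᵀ).det| = 1 := by
    rw [Matrix.det_mul, abs_mul, orth_det O hO1, Matrix.det_transpose, Matrix.det_nonsing_inv, hh]
    simp
  set r : ℝ := (2 * d ^ 2 * ρ)⁻¹ with hr
  have hrpos : 0 < r := by positivity
  obtain ⟨z, hz, hzr⟩ := minkowski_box _ hdet (fun i => if (i : ℕ) < k then r else R)
    (fun i => by split_ifs <;> assumption) (by rw [prod_two hkd]; exact hcond)
  refine ⟨z, hz, ?_⟩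
  set y := (h⁻¹)ᵀ *ᵥ zv z with hy
  rw [← Matrix.mulVec_mulVec, ← hy] at hzr
  have horth : ∀ v ∈ {v | ∃ z : Fin d → ℤ, v = h *ᵥ zv z ∧ ‖v‖ ≤ ρ}, v ⬝ᵥ y = 0 := by
    rintro v ⟨z', hv, hvρ⟩
    have h1 : v ⬝ᵥ y = zv z' ⬝ᵥ zv z := by
      rw [hv, hy, Matrix.mulVec_transpose, dotProduct_comm, ← Matrix.dotProduct_mulVec,
        Matrix.mulVec_mulVec, Matrix.nonsing_inv_mul _ (by simp [hh]), Matrix.one_mulVec,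
        dotProduct_comm]
    have h2' : ∀ a b : Fin d → ℝ, (O *ᵥ a) ⬝ᵥ (O *ᵥ b) = a ⬝ᵥ b := by
      intro a b
      rw [Matrix.dotProduct_mulVec, Matrix.vecMul_mulVec, hO2, Matrix.vecMul_one]
    have h2 : v ⬝ᵥ y = (O *ᵥ v) ⬝ᵥ (O *ᵥ y) := (h2' v y).symm
    have h3 : |v ⬝ᵥ y| < 1 := by
      rw [h2]
      have hvmem : v ∈ shortSpan h ρ := Submodule.subset_span ⟨z', hv, hvρ⟩
      calc |(O *ᵥ v) ⬝ᵥ (O *ᵥ y)| ≤ ∑ i, |(O *ᵥ v) i * (O *ᵥ y) i| := by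
            show |∑ i, (O *ᵥ v) i * (O *ᵥ y) i| ≤ _
            exact Finset.abs_sum_le_sum_abs _ _
        _ ≤ ∑ _i : Fin d, (d * ρ) * r := by
            apply Finset.sum_le_sum
            intro i _
            rw [abs_mul]
            by_cases hi : (i : ℕ) < k
            · have h4 := hzr i
              rw [if_pos hi] at h4
              have h5 := orth_norm O (orth_entry O hO1) v ρ
                (fun i => (norm_le_pi_norm v i).trans hvρ) i
              exact mul_le_mul h5 h4.le (abs_nonneg _) (by positivity)
            · rw [hO3 v hvmem i (not_lt.1 hi)]
              simp; positivity
        _ = 1 / 2 := by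
            rw [hr]; simp; field_simp
        _ < 1 := by norm_num
    rw [h1] at h3 ⊢
    have h6 : zv z' ⬝ᵥ zv z = ((z' ⬝ᵥ z : ℤ) : ℝ) := by
      simp [dotProduct, zv]
    rw [h6] at h3 ⊢
    have : |z' ⬝ᵥ z| < 1 := by exact_mod_cast h3
    rw [Int.abs_lt_one_iff] at this
    exact_mod_cast this
  have horth2 : ∀ v ∈ shortSpan h ρ, v ⬝ᵥ y = 0 := by
    intro v hv
    refine Submodule.span_induction (p := fun v _ => v ⬝ᵥ y = 0) horth (by simp) ?_ ?_ hv
    · intro a b _ _ ha hb; rw [add_dotProduct, ha, hb, add_zero]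
    · intro a b _ hb; rw [smul_dotProduct, hb, smul_zero]
  have hOy : ∀ i, |(O *ᵥ y) i| ≤ R := by
    intro i
    by_cases hi : (i : ℕ) < k
    · rw [hO4 y horth2 i hi]; simp [hR.le]
    · have := hzr i
      rw [if_neg hi] at this
      exact this.le
  have hyy : y = Oᵀ *ᵥ (O *ᵥ y) := by rw [Matrix.mulVec_mulVec, hO2, Matrix.one_mulVec]
  rw [hyy, pi_norm_le_iff_of_nonneg (by positivity)]
  intro i
  exact orth_norm Oᵀ (fun i j => orth_entry O hO1 j i) _ R hOy i

/-! ### Part 3: contraction estimates for first minima -/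

lemma det_dual {d : ℕ} (h : Matrix (Fin d) (Fin d) ℝ) (hh : h.det = 1) : ((h⁻¹)ᵀ).det = 1 := by
  rw [Matrix.det_transpose, Matrix.det_nonsing_inv, hh]; simp

lemma dual_dominates (p q d : ℕ) (hp : 0 < p) (hq : 0 < q) (hd : d = p + q) (K A : ℝ) (hK : 1 ≤ K)
    (hA : 0 < A) : ∃ ρ0 : ℝ, 0 < ρ0 ∧ ∀ h : Matrix (Fin d) (Fin d) ℝ, h.det = 1 → lam h ≤ ρ0 →
      p < Module.finrank ℝ (shortSpan h (K * lam h)) →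
      A * lam ((h⁻¹)ᵀ) ^ q ≤ lam h ^ p := by
  have hd0 : 0 < d := by omega
  have hd' : (1 : ℝ) ≤ d := by exact_mod_cast hd0
  set C : ℝ := A ^ (q - 1) * (2 * d) ^ (q * (q - 1)) * (2 * d ^ 2 * K) ^ ((p + 1) * q) with hC
  have hCpos : 0 < C := by positivity
  refine ⟨min (2 * d ^ 2 * K)⁻¹ (2 * C)⁻¹, by positivity, ?_⟩
  intro h hh hl hk
  have hlpos := lam_pos hd0 h hh
  have hl1 := lam_le_one hd0 h hh
  have hspos := lam_pos hd0 _ (det_dual h hh)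
  have hs1 := lam_le_one hd0 _ (det_dual h hh)
  set l := lam h with hldef
  set s := lam ((h⁻¹)ᵀ) with hsdef
  set k := Module.finrank ℝ (shortSpan h (K * l)) with hkdef
  have hkd : k ≤ d := by
    have := Submodule.finrank_le (shortSpan h (K * l))
    simpa using this
  by_contra hcon
  rw [not_le] at hcon
  set R := s / (2 * d) with hR
  have hRpos : 0 < R := by positivity
  have hR1 : R ≤ 1 := by
    rw [hR, div_le_one (by positivity)]; linarith
  set σ := 2 * d ^ 2 * (K * l) with hσ
  have hσpos : 0 < σ := by positivity
  have hσ1 : σ ≤ 1 := by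
    have h1 : l ≤ (2 * d ^ 2 * K)⁻¹ := hl.trans (min_le_left _ _)
    rw [le_inv_comm₀ hlpos (by positivity), inv_eq_one_div, le_div_iff₀ hlpos] at h1
    calc σ = 2 * d ^ 2 * K * l := by rw [hσ]; ring
      _ ≤ 1 := h1
  have h1 : R ^ (d - k) ≤ σ ^ k := by
    by_contra h2
    rw [not_le] at h2
    obtain ⟨z, hz, hz2⟩ := dual_vec hd0 h hh (K * l) R (by positivity) hRpos (by
      rw [← hkdef, ← hσ, inv_pow, ← div_eq_inv_mul, one_lt_div (by positivity)]; exact h2)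
    have h3 := lam_le ((h⁻¹)ᵀ) z hz
    rw [← hsdef] at h3
    have h4 : (d : ℝ) * R = s / 2 := by rw [hR]; field_simp
    rw [h4] at hz2
    linarith
  have h2 : R ^ (q - 1) ≤ σ ^ (p + 1) := by
    calc R ^ (q - 1) ≤ R ^ (d - k) := pow_le_pow_of_le_one hRpos.le hR1 (by omega)
      _ ≤ σ ^ k := h1
      _ ≤ σ ^ (p + 1) := pow_le_pow_of_le_one hσpos.le hσ1 hk
  have h3 : R ^ (q * (q - 1)) ≤ σ ^ ((p + 1) * q) := by
    rw [mul_comm q, pow_mul, pow_mul]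
    exact pow_le_pow_left₀ (by positivity) h2 _
  have hsR : s = 2 * d * R := by rw [hR]; field_simp
  have h4 : l ^ (p * (q - 1)) ≤ A ^ (q - 1) * (2 * d) ^ (q * (q - 1)) * R ^ (q * (q - 1)) := by
    rw [pow_mul, pow_mul, pow_mul, ← mul_pow, ← mul_pow]
    apply pow_le_pow_left₀ (by positivity)
    rw [mul_assoc, ← mul_pow, ← hsR]
    exact hcon.le
  have h5 : l ^ (p * (q - 1)) ≤ C * l ^ ((p + 1) * q) := by
    refine h4.trans ?_
    rw [hC, mul_assoc _ ((2 * (d : ℝ) ^ 2 * K) ^ ((p + 1) * q)), ← mul_pow, mul_assoc _ K l]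
    exact mul_le_mul_of_nonneg_left h3 (by positivity)
  obtain ⟨q', rfl⟩ : ∃ q', q = q' + 1 := ⟨q - 1, by omega⟩
  have h6 : (p + 1) * (q' + 1) = p * (q' + 1 - 1) + (p + q' + 1) := by
    simp; ring
  rw [h6, pow_add, ← mul_assoc, mul_comm C, mul_assoc] at h5
  have h7 : 1 ≤ C * l ^ (p + q' + 1) := by
    by_contra h8
    rw [not_le] at h8
    have : 0 < l ^ (p * (q' + 1 - 1)) := by positivity
    nlinarith
  have h8 : l ^ (p + q' + 1) ≤ l := by
    calc _ ≤ l ^ 1 := pow_le_pow_of_le_one hlpos.le hl1 (by omega)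
      _ = l := pow_one l
  have h9 : l ≤ (2 * C)⁻¹ := hl.trans (min_le_right _ _)
  have h10 : C * l ≤ 1 / 2 := by
    calc C * l ≤ C * (2 * C)⁻¹ := mul_le_mul_of_nonneg_left h9 hCpos.le
      _ = 1 / 2 := by field_simp
  nlinarith

lemma lat_sum {d : ℕ} (hd : 0 < d) (p : ℕ) (K : ℝ) (hK : 1 ≤ K) (h : Matrix (Fin d) (Fin d) ℝ)
    (hh : h.det = 1) (hk : Module.finrank ℝ (shortSpan h (K * lam h)) ≤ p)
    (F : Finset (Fin d → ℤ)) (hF : ∀ z ∈ F, z ≠ 0 ∧ ‖h *ᵥ zv z‖ ≤ K * lam h) :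
    ∑ z ∈ F, (‖h *ᵥ zv z‖⁻¹) ^ p ≤ 3 ^ p * Real.exp p * (1 + Real.log K) * ((lam h)⁻¹) ^ p := by
  classical
  have hl := lam_pos hd h hh
  have key := layer_sum F (fun z => ‖h *ᵥ zv z‖ / lam h) p (3 ^ p) (Real.log K) (by positivity)
    (fun z hz => by rw [le_div_iff₀ hl, one_mul]; exact lam_le h z (hF z hz).1)
    (fun z hz => by rw [Real.exp_log (by linarith), div_le_iff₀ hl]; exact (hF z hz).2)
    (Real.log_nonneg hK) ?_
  · calc ∑ z ∈ F, (‖h *ᵥ zv z‖⁻¹) ^ p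
        = ∑ z ∈ F, ((‖h *ᵥ zv z‖ / lam h)⁻¹) ^ p * ((lam h)⁻¹) ^ p := by
          apply Finset.sum_congr rfl; intro z _
          rw [← mul_pow]; congr 1; field_simp
      _ = (∑ z ∈ F, ((‖h *ᵥ zv z‖ / lam h)⁻¹) ^ p) * ((lam h)⁻¹) ^ p := by rw [Finset.sum_mul]
      _ ≤ _ := mul_le_mul_of_nonneg_right key (by positivity)
  · intro R hR
    set G := F.filter (fun z => ‖h *ᵥ zv z‖ / lam h ≤ R) with hG
    set E := shortSpan h (K * lam h) with hE
    have hmem : ∀ z ∈ G, h *ᵥ zv z ∈ E := fun z hz =>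
      Submodule.subset_span ⟨z, rfl, (hF z (Finset.mem_filter.1 hz).1).2⟩
    let φ : {z // z ∈ G} → E := fun z => ⟨h *ᵥ zv z.1, hmem z.1 z.2⟩
    have hsep : ∀ a b : Fin d → ℤ, a ≠ b → lam h ≤ ‖h *ᵥ zv a - h *ᵥ zv b‖ := by
      intro a b hab
      rw [← Matrix.mulVec_sub, ← zv_sub]
      exact lam_le h _ (sub_ne_zero.2 hab)
    have hinj : Function.Injective φ := by
      intro a b hab
      by_contra hne
      have h1 := hsep a.1 b.1 (fun h => hne (Subtype.ext h))
      have h2 : h *ᵥ zv a.1 = h *ᵥ zv b.1 := congrArg Subtype.val hab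
      rw [h2, sub_self, norm_zero] at h1
      linarith
    have hpack := packing (Finset.univ.image φ) (lam h) (R * lam h) hl (by positivity) (by
      intro c hc
      obtain ⟨z, _, rfl⟩ := Finset.mem_image.1 hc
      have h1 := (Finset.mem_filter.1 z.2).2
      rw [div_le_iff₀ hl] at h1
      exact h1) (by
      intro c hc c' hc' hne
      obtain ⟨z, _, rfl⟩ := Finset.mem_image.1 hc
      obtain ⟨z', _, rfl⟩ := Finset.mem_image.1 hc'
      exact hsep z.1 z'.1 (fun h => hne (congrArg φ (Subtype.ext h))))
    rw [Finset.card_image_of_injective _ hinj, Finset.card_univ, Fintype.card_coe] at hpack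
    refine hpack.trans ?_
    have h3 : 1 + 2 * (R * lam h) / lam h = 1 + 2 * R := by field_simp
    rw [h3, ← mul_pow]
    calc (1 + 2 * R) ^ Module.finrank ℝ E ≤ (1 + 2 * R) ^ p := pow_le_pow_right₀ (by linarith) hk
      _ ≤ (3 * R) ^ p := pow_le_pow_left₀ (by linarith) (by linarith) _

lemma contract_side {d : ℕ} (hd : 0 < d) (p : ℕ) {I : Type*} [Fintype I]
    (B : I → Matrix (Fin d) (Fin d) ℝ) (κ Θ : ℝ) (hκ : 1 ≤ κ) (hΘ : 0 ≤ Θ)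
    (hB : ∀ c, (B c).det = 1)
    (hB1 : ∀ c v, ‖B c *ᵥ v‖ ≤ κ * ‖v‖) (hB2 : ∀ c v, ‖v‖ ≤ κ * ‖B c *ᵥ v‖)
    (hB3 : ∀ v, v ≠ 0 → ∑ c, (‖B c *ᵥ v‖⁻¹) ^ p ≤ Θ * (‖v‖⁻¹) ^ p)
    (h : Matrix (Fin d) (Fin d) ℝ) (hh : h.det = 1)
    (hk : Module.finrank ℝ (shortSpan h ((2 * κ ^ 2) * lam h)) ≤ p) :
    ∑ c, ((lam (B c * h))⁻¹) ^ p ≤ 2 ^ p * Θ *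
      (3 ^ p * Real.exp p * (1 + Real.log (2 * κ ^ 2))) * ((lam h)⁻¹) ^ p := by
  classical
  have hl := lam_pos hd h hh
  have hκ0 : 0 < κ := by linarith
  have hK : 1 ≤ 2 * κ ^ 2 := by nlinarith
  have hfin : {z : Fin d → ℤ | z ≠ 0 ∧ ‖h *ᵥ zv z‖ ≤ 2 * κ ^ 2 * lam h}.Finite :=
    (finite_short h hh (2 * κ ^ 2 * lam h)).subset (fun z hz => hz.2)
  set F := hfin.toFinset with hF
  have hFm : ∀ z, z ∈ F ↔ z ≠ 0 ∧ ‖h *ᵥ zv z‖ ≤ 2 * κ ^ 2 * lam h := by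
    intro z; rw [hF, Set.Finite.mem_toFinset]; rfl
  have hterm : ∀ c, ((lam (B c * h))⁻¹) ^ p ≤ ∑ z ∈ F, 2 ^ p * (‖B c *ᵥ (h *ᵥ zv z)‖⁻¹) ^ p := by
    intro c
    have hdet : (B c * h).det = 1 := by rw [Matrix.det_mul, hB, hh, one_mul]
    have hlc := lam_pos hd _ hdet
    obtain ⟨z, hz, hz2⟩ := exists_lt_lam hd (B c * h) (2 * lam (B c * h)) (by linarith)
    have h1 := lam_mul_le hd (B c) h κ hκ0 (hB1 c)
    rw [← Matrix.mulVec_mulVec] at hz2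
    have hzF : z ∈ F := by
      rw [hFm]
      refine ⟨hz, ?_⟩
      calc _ ≤ κ * ‖B c *ᵥ (h *ᵥ zv z)‖ := hB2 c _
        _ ≤ κ * (2 * (κ * lam h)) := mul_le_mul_of_nonneg_left (by linarith) hκ0.le
        _ = _ := by ring
    have hpos : 0 < ‖B c *ᵥ (h *ᵥ zv z)‖ := by
      have := lam_le (B c * h) z hz
      rw [← Matrix.mulVec_mulVec] at this
      linarith
    calc ((lam (B c * h))⁻¹) ^ p ≤ 2 ^ p * (‖B c *ᵥ (h *ᵥ zv z)‖⁻¹) ^ p := by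
          rw [← mul_pow]
          apply pow_le_pow_left₀ (by positivity)
          rw [← div_eq_mul_inv, inv_le_comm₀ hlc (by positivity), inv_div]
          linarith
      _ ≤ _ := Finset.single_le_sum (f := fun z => 2 ^ p * (‖B c *ᵥ (h *ᵥ zv z)‖⁻¹) ^ p)
          (fun z _ => by positivity) hzF
  calc ∑ c, ((lam (B c * h))⁻¹) ^ p
      ≤ ∑ c, ∑ z ∈ F, 2 ^ p * (‖B c *ᵥ (h *ᵥ zv z)‖⁻¹) ^ p := Finset.sum_le_sum fun c _ => hterm c
    _ = ∑ z ∈ F, 2 ^ p * ∑ c, (‖B c *ᵥ (h *ᵥ zv z)‖⁻¹) ^ p := by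
        rw [Finset.sum_comm]
        apply Finset.sum_congr rfl; intro z _; rw [Finset.mul_sum]
    _ ≤ ∑ z ∈ F, 2 ^ p * (Θ * (‖h *ᵥ zv z‖⁻¹) ^ p) := by
        apply Finset.sum_le_sum
        intro z hz
        apply mul_le_mul_of_nonneg_left _ (by positivity)
        apply hB3
        intro h0
        have := lam_le h z ((hFm z).1 hz).1
        rw [h0, norm_zero] at this
        linarith
    _ = 2 ^ p * Θ * ∑ z ∈ F, (‖h *ᵥ zv z‖⁻¹) ^ p := by
        rw [Finset.mul_sum]; apply Finset.sum_congr rfl; intro z _; ring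
    _ ≤ 2 ^ p * Θ * (3 ^ p * Real.exp p * (1 + Real.log (2 * κ ^ 2)) * ((lam h)⁻¹) ^ p) :=
        mul_le_mul_of_nonneg_left
          (lat_sum hd p _ hK h hh hk F (fun z hz => (hFm z).1 hz)) (by positivity)
    _ = _ := by ring


lemma side_bound {d : ℕ} (p q : ℕ) (hp : 0 < p) (hq : 0 < q) (hd : d = p + q) {I : Type*} [Fintype I]
    (B : I → Matrix (Fin d) (Fin d) ℝ) (κ Θ τ : ℝ) (hκ : 1 ≤ κ) (hΘ : 0 ≤ Θ) (hτ : 0 < τ)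
    (hB : ∀ c, (B c).det = 1)
    (hB1 : ∀ c v, ‖B c *ᵥ v‖ ≤ κ * ‖v‖) (hB2 : ∀ c v, ‖v‖ ≤ κ * ‖B c *ᵥ v‖)
    (hB3 : ∀ v, v ≠ 0 → ∑ c, (‖B c *ᵥ v‖⁻¹) ^ p ≤ Θ * (‖v‖⁻¹) ^ p) :
    ∃ W : ℝ, 0 < W ∧ ∀ h : Matrix (Fin d) (Fin d) ℝ, h.det = 1 → ∀ w : ℝ, W ≤ w →
      ((lam h)⁻¹) ^ p ≤ w → ((lam ((h⁻¹)ᵀ))⁻¹) ^ q ≤ w →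
      ∑ c, ((lam (B c * h))⁻¹) ^ p ≤ (2 ^ p * Θ *
      (3 ^ p * Real.exp p * (1 + Real.log (2 * κ ^ 2))) + Fintype.card I * τ) * w := by
  have hd0 : 0 < d := by omega
  have hκ0 : 0 < κ := by linarith
  have hK : 1 ≤ 2 * κ ^ 2 := by nlinarith
  have hlogK : 0 ≤ Real.log (2 * κ ^ 2) := Real.log_nonneg hK
  obtain ⟨ρ0, hρ0, hdom⟩ := dual_dominates p q d hp hq hd (2 * κ ^ 2) (κ ^ p / τ) hK (by positivity)
  refine ⟨κ ^ p * (ρ0⁻¹) ^ p / τ, by positivity, ?_⟩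
  intro h hh w hW hw1 hw2
  have hw : 0 < w := lt_of_lt_of_le (by positivity) hW
  have hl := lam_pos hd0 h hh
  have hs := lam_pos hd0 _ (det_dual h hh)
  have hC1 : 0 ≤ 2 ^ p * Θ * (3 ^ p * Real.exp p * (1 + Real.log (2 * κ ^ 2))) := by positivity
  by_cases hk : Module.finrank ℝ (shortSpan h ((2 * κ ^ 2) * lam h)) ≤ p
  · refine (contract_side hd0 p B κ Θ hκ hΘ hB hB1 hB2 hB3 h hh hk).trans ?_
    apply mul_le_mul _ hw1 (by positivity) (by positivity)
    have : 0 ≤ (Fintype.card I : ℝ) * τ := by positivity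
    linarith
  · rw [not_le] at hk
    have hterm : ∀ c, ((lam (B c * h))⁻¹) ^ p ≤ κ ^ p * ((lam h)⁻¹) ^ p := by
      intro c
      have hlc := lam_pos hd0 (B c * h) (by rw [Matrix.det_mul, hB, hh, one_mul])
      have h1 := lam_le_mul hd0 (B c) h κ hκ0 (hB2 c)
      rw [← mul_pow]
      apply pow_le_pow_left₀ (by positivity)
      rw [← div_eq_mul_inv, inv_le_comm₀ hlc (by positivity), inv_div, div_le_iff₀' hκ0]
      exact h1
    have hsuff : κ ^ p * ((lam h)⁻¹) ^ p ≤ τ * w := by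
      by_cases hlρ : lam h ≤ ρ0
      · have h1 := hdom h hh hlρ hk
        refine le_trans ?_ (mul_le_mul_of_nonneg_left hw2 hτ.le)
        rw [inv_pow, inv_pow, ← div_eq_mul_inv, ← div_eq_mul_inv, div_le_div_iff₀ (by positivity)
          (by positivity)]
        rw [div_mul_eq_mul_div, div_le_iff₀ hτ] at h1
        linarith
      · rw [not_le] at hlρ
        have h2 : ((lam h)⁻¹) ^ p ≤ (ρ0⁻¹) ^ p :=
          pow_le_pow_left₀ (by positivity) (inv_anti₀ hρ0 hlρ.le) _
        rw [div_le_iff₀' hτ] at hW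
        exact le_trans (mul_le_mul_of_nonneg_left h2 (by positivity)) hW
    calc ∑ c, ((lam (B c * h))⁻¹) ^ p ≤ ∑ _c : I, τ * w :=
          Finset.sum_le_sum fun c _ => (hterm c).trans hsuff
      _ = Fintype.card I * τ * w := by simp [mul_assoc]
      _ ≤ _ := by
        apply mul_le_mul_of_nonneg_right _ hw.le
        linarith

/-! ### Part 4: the concrete matrices -/

lemma uMat_mul (m n : ℕ) (A A' : Fin m → Fin n → ℝ) :
    uMat m n A * uMat m n A' = uMat m n (A + A') := by
  simp only [uMat, Matrix.reindex_apply, Matrix.submatrix_mul_equiv, Matrix.fromBlocks_multiply]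
  congr 1
  simp [add_comm]

lemma aMat_mul (m n : ℕ) (s t : ℝ) : aMat m n s * aMat m n t = aMat m n (s + t) := by
  simp only [aMat, Matrix.reindex_apply, Matrix.submatrix_mul_equiv, Matrix.fromBlocks_multiply]
  congr 1
  simp [smul_smul, ← Real.exp_add, add_div, add_comm]

lemma aMat_zero (m n : ℕ) : aMat m n 0 = 1 := by
  simp [aMat]

lemma uMat_zero (m n : ℕ) : uMat m n 0 = 1 := by
  have : (Matrix.of (0 : Fin m → Fin n → ℝ)) = 0 := rfl
  simp [uMat, this]

lemma aMat_uMat (m n : ℕ) (t : ℝ) (A : Fin m → Fin n → ℝ) :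
    aMat m n t * uMat m n A = uMat m n (Real.exp (t / m + t / n) • A) * aMat m n t := by
  simp only [uMat, aMat, Matrix.reindex_apply, Matrix.submatrix_mul_equiv,
    Matrix.fromBlocks_multiply]
  congr 1
  simp only [Matrix.smul_mul, Matrix.mul_smul, Matrix.one_mul, Matrix.mul_one, Matrix.mul_zero,
    Matrix.zero_mul, add_zero, zero_add, smul_zero]
  congr 1
  ext i j
  simp [← mul_assoc, ← Real.exp_add]

lemma aMat_transpose (m n : ℕ) (t : ℝ) : (aMat m n t)ᵀ = aMat m n t := by
  simp [aMat, Matrix.transpose_submatrix, Matrix.fromBlocks_transpose]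

lemma sum_split {m n : ℕ} (f : Fin (m + n) → ℝ) :
    ∑ i, f i = ∑ a : Fin m, f (Fin.castAdd n a) + ∑ b : Fin n, f (Fin.natAdd m b) :=
  Fin.sum_univ_add f

lemma uMat_top {m n : ℕ} (A : Fin m → Fin n → ℝ) (v : Fin (m + n) → ℝ) (a : Fin m) :
    (uMat m n A *ᵥ v) (Fin.castAdd n a) = v (Fin.castAdd n a) + ∑ b, A a b * v (Fin.natAdd m b) := by
  simp [uMat, Matrix.mulVec, dotProduct, sum_split, Matrix.one_apply]

lemma uMat_bot {m n : ℕ} (A : Fin m → Fin n → ℝ) (v : Fin (m + n) → ℝ) (b : Fin n) :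
    (uMat m n A *ᵥ v) (Fin.natAdd m b) = v (Fin.natAdd m b) := by
  simp [uMat, Matrix.mulVec, dotProduct, sum_split, Matrix.one_apply]

lemma uMatT_top {m n : ℕ} (A : Fin m → Fin n → ℝ) (v : Fin (m + n) → ℝ) (a : Fin m) :
    ((uMat m n A)ᵀ *ᵥ v) (Fin.castAdd n a) = v (Fin.castAdd n a) := by
  simp [uMat, Matrix.mulVec, dotProduct, sum_split, Matrix.one_apply]

lemma uMatT_bot {m n : ℕ} (A : Fin m → Fin n → ℝ) (v : Fin (m + n) → ℝ) (b : Fin n) :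
    ((uMat m n A)ᵀ *ᵥ v) (Fin.natAdd m b)
      = v (Fin.natAdd m b) + ∑ a, A a b * v (Fin.castAdd n a) := by
  simp [uMat, Matrix.mulVec, dotProduct, sum_split, Matrix.one_apply, add_comm]

lemma aMat_top {m n : ℕ} (t : ℝ) (v : Fin (m + n) → ℝ) (a : Fin m) :
    (aMat m n t *ᵥ v) (Fin.castAdd n a) = Real.exp (t / m) * v (Fin.castAdd n a) := by
  simp [aMat, Matrix.mulVec, dotProduct, sum_split, Matrix.one_apply]

lemma aMat_bot {m n : ℕ} (t : ℝ) (v : Fin (m + n) → ℝ) (b : Fin n) :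
    (aMat m n t *ᵥ v) (Fin.natAdd m b) = Real.exp (-(t / n)) * v (Fin.natAdd m b) := by
  simp [aMat, Matrix.mulVec, dotProduct, sum_split, Matrix.one_apply]

lemma norm_split {m n : ℕ} (v : Fin (m + n) → ℝ) :
    ‖v‖ = max ‖fun a : Fin m => v (Fin.castAdd n a)‖ ‖fun b : Fin n => v (Fin.natAdd m b)‖ := by
  apply le_antisymm
  · rw [pi_norm_le_iff_of_nonneg (le_max_of_le_left (norm_nonneg _))]
    intro i
    refine Fin.addCases (fun a => ?_) (fun b => ?_) i
    · exact le_max_of_le_left (norm_le_pi_norm (fun a : Fin m => v (Fin.castAdd n a)) a)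
    · exact le_max_of_le_right (norm_le_pi_norm (fun b : Fin n => v (Fin.natAdd m b)) b)
  · apply max_le
    · rw [pi_norm_le_iff_of_nonneg (norm_nonneg _)]
      intro a; exact norm_le_pi_norm v _
    · rw [pi_norm_le_iff_of_nonneg (norm_nonneg _)]
      intro a; exact norm_le_pi_norm v _

lemma nb_le {d : ℕ} (B : Matrix (Fin d) (Fin d) ℝ) (b : ℝ) (hB : ∀ i j, |B i j| ≤ b) :
    nb B ≤ d ^ 2 * b := by
  calc nb B ≤ ∑ _i : Fin d, ∑ _j : Fin d, b :=
        Finset.sum_le_sum fun i _ => Finset.sum_le_sum fun j _ => hB i j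
    _ = d ^ 2 * b := by simp; ring

lemma nb_transpose {d : ℕ} (B : Matrix (Fin d) (Fin d) ℝ) : nb Bᵀ = nb B := by
  simp only [nb, Matrix.transpose_apply]; rw [Finset.sum_comm]

lemma uMat_entry {m n : ℕ} (A : Fin m → Fin n → ℝ) (b : ℝ) (hb : 1 ≤ b) (hA : ∀ i j, |A i j| ≤ b)
    (i j : Fin (m + n)) : |uMat m n A i j| ≤ b := by
  have h0 : 0 ≤ b := by linarith
  refine Fin.addCases (fun a => ?_) (fun a => ?_) i <;>
  refine Fin.addCases (fun a' => ?_) (fun a' => ?_) j <;>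
  simp [uMat, Matrix.one_apply, hA, h0] <;> split_ifs <;> simp [h0, hb]

lemma aMat_entry {m n : ℕ} (hm : 0 < m) (hn : 0 < n) (t : ℝ) (i j : Fin (m + n)) :
    |aMat m n t i j| ≤ Real.exp |t| := by
  have h1 : t / m ≤ |t| := by
    have : (1 : ℝ) ≤ m := by exact_mod_cast hm
    rw [div_le_iff₀ (by linarith)]
    nlinarith [le_abs_self t, abs_nonneg t]
  have h2 : -(t / n) ≤ |t| := by
    have : (1 : ℝ) ≤ n := by exact_mod_cast hn
    rw [← neg_div, div_le_iff₀ (by linarith)]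
    nlinarith [neg_le_abs t, abs_nonneg t]
  have := Real.exp_pos |t|
  refine Fin.addCases (fun a => ?_) (fun a => ?_) i <;>
  refine Fin.addCases (fun a' => ?_) (fun a' => ?_) j <;>
  simp [aMat, Matrix.one_apply, this.le] <;> split_ifs <;>
  simp [h1, h2, this.le, abs_of_pos (Real.exp_pos _)]

/-- integer block -/
def cmat {m n M : ℕ} (c : Fin n → Fin m → IccM M) : Fin m → Fin n → ℝ :=
  fun a b => ((c b a : ℤ) : ℝ)

/-- the branch matrices `u_c a_t` -/
def BM {m n M : ℕ} (t : ℝ) (c : Fin n → Fin m → IccM M) : Matrix (Fin (m + n)) (Fin (m + n)) ℝ :=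
  uMat m n (cmat c) * aMat m n t

lemma BM_det {m n M : ℕ} (hm : 0 < m) (hn : 0 < n) (t : ℝ) (c : Fin n → Fin m → IccM M) :
    (BM t c).det = 1 := by
  rw [BM, Matrix.det_mul, uMat_det, aMat_det m n hm hn, one_mul]

lemma BM_inv {m n M : ℕ} (t : ℝ) (c : Fin n → Fin m → IccM M) :
    (BM t c)⁻¹ = aMat m n (-t) * uMat m n (-cmat c) := by
  apply Matrix.inv_eq_right_inv
  rw [BM, Matrix.mul_assoc, ← Matrix.mul_assoc (aMat m n t), aMat_mul, add_neg_cancel, aMat_zero,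
    Matrix.one_mul, uMat_mul, add_neg_cancel, uMat_zero]

lemma BM_dual {m n M : ℕ} (t : ℝ) (c : Fin n → Fin m → IccM M) :
    ((BM t c)⁻¹)ᵀ = (uMat m n (-cmat c))ᵀ * aMat m n (-t) := by
  rw [BM_inv, Matrix.transpose_mul, aMat_transpose]

/-- all four norm bounds -/
lemma BM_bounds {m n M : ℕ} (hm : 0 < m) (hn : 0 < n) (hM : 1 ≤ M) (t : ℝ) (ht : 0 ≤ t)
    (c : Fin n → Fin m → IccM M) (v : Fin (m + n) → ℝ) :
    let κ : ℝ := ((m + n : ℕ) : ℝ) ^ 4 * (M * Real.exp t)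
    ‖BM t c *ᵥ v‖ ≤ κ * ‖v‖ ∧ ‖(BM t c)⁻¹ *ᵥ v‖ ≤ κ * ‖v‖ ∧ ‖((BM t c)⁻¹)ᵀ *ᵥ v‖ ≤ κ * ‖v‖
      ∧ ‖(BM t c)ᵀ *ᵥ v‖ ≤ κ * ‖v‖ := by
  intro κ
  have hM' : (1 : ℝ) ≤ M := by exact_mod_cast hM
  set D : ℝ := ((m + n : ℕ) : ℝ) with hD
  have hA : ∀ i j, |cmat c i j| ≤ M := fun i j => IccM_abs M _
  have hA' : ∀ i j, |(-cmat c) i j| ≤ M := fun i j => by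
    show |-(cmat c i j)| ≤ M
    rw [abs_neg]; exact hA i j
  have u1 : nb (uMat m n (cmat c)) ≤ D ^ 2 * M := nb_le _ _ (uMat_entry _ _ hM' hA)
  have u2 : nb (uMat m n (-cmat c)) ≤ D ^ 2 * M := nb_le _ _ (uMat_entry _ _ hM' hA')
  have a1 : nb (aMat m n t) ≤ D ^ 2 * Real.exp t := nb_le _ _ (fun i j => by
    have := aMat_entry hm hn t i j; rwa [abs_of_nonneg ht] at this)
  have a2 : nb (aMat m n (-t)) ≤ D ^ 2 * Real.exp t := nb_le _ _ (fun i j => by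
    have := aMat_entry hm hn (-t) i j; rwa [abs_neg, abs_of_nonneg ht] at this)
  have comb : ∀ X Y : Matrix (Fin (m + n)) (Fin (m + n)) ℝ, ∀ x y, nb X ≤ x → nb Y ≤ y → x * y = κ →
      ∀ v, ‖(X * Y) *ᵥ v‖ ≤ κ * ‖v‖ := by
    intro X Y x y hx hy hxy v
    rw [← Matrix.mulVec_mulVec]
    have hx0 := (nb_nonneg X).trans hx
    calc _ ≤ nb X * ‖Y *ᵥ v‖ := nb_mulVec _ _
      _ ≤ x * (nb Y * ‖v‖) := mul_le_mul hx (nb_mulVec _ _) (norm_nonneg _) hx0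
      _ ≤ x * (y * ‖v‖) := by gcongr
      _ = κ * ‖v‖ := by rw [← hxy]; ring
  refine ⟨?_, ?_, ?_, ?_⟩
  · exact comb _ _ _ _ u1 a1 (by simp only [κ]; ring) v
  · rw [BM_inv]; exact comb _ _ _ _ a2 u2 (by simp only [κ]; ring) v
  · rw [BM_dual]
    exact comb _ _ _ _ ((nb_transpose _).le.trans u2) a2 (by simp only [κ]; ring) v
  · rw [BM, Matrix.transpose_mul, aMat_transpose]
    exact comb _ _ _ _ a1 ((nb_transpose _).le.trans u1) (by simp only [κ]; ring) v

lemma BM_mulVec_norm {m n M : ℕ} (t : ℝ) (c : Fin n → Fin m → IccM M) (v : Fin (m + n) → ℝ) :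
    ‖BM t c *ᵥ v‖ = max
      ‖cact (Real.exp (t / m) • fun a : Fin m => v (Fin.castAdd n a))
        (Real.exp (-(t / n)) • fun b : Fin n => v (Fin.natAdd m b)) c‖
      ‖Real.exp (-(t / n)) • fun b : Fin n => v (Fin.natAdd m b)‖ := by
  rw [norm_split, BM, ← Matrix.mulVec_mulVec]
  simp only [uMat_top, uMat_bot, aMat_top, aMat_bot]
  rfl

lemma BM_dual_norm {m n M : ℕ} (t : ℝ) (c : Fin n → Fin m → IccM M) (v : Fin (m + n) → ℝ) :
    ‖((BM t c)⁻¹)ᵀ *ᵥ v‖ = max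
      ‖cact (Real.exp (t / n) • fun b : Fin n => v (Fin.natAdd m b))
        (Real.exp (-(t / m)) • fun a : Fin m => -v (Fin.castAdd n a)) (fun a b => c b a)‖
      ‖Real.exp (-(t / m)) • fun a : Fin m => -v (Fin.castAdd n a)‖ := by
  rw [norm_split, BM_dual, ← Matrix.mulVec_mulVec, max_comm]
  simp only [uMatT_top, uMatT_bot, aMat_top, aMat_bot]
  congr 1
  · congr 1
    ext b
    simp [cact, cmat, neg_div]
  · rw [show (fun a : Fin m => -v (Fin.castAdd n a)) = -(fun a : Fin m => v (Fin.castAdd n a)) from rfl,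
      smul_neg, norm_neg, neg_div]
    rfl


/-- the weight function -/
def wt {m n : ℕ} (h : Matrix (Fin (m + n)) (Fin (m + n)) ℝ) : ℝ :=
  1 + ((lam h)⁻¹) ^ m + ((lam ((h⁻¹)ᵀ))⁻¹) ^ n

lemma coef_bound (p q : ℕ) (t P M κ N E a b : ℝ) (ht : 0 ≤ t) (hP : 0 ≤ P) (hE : 0 ≤ E)
    (hN : 0 ≤ N) (hN2 : N ≤ P * (E * Real.exp t))
    (ha : 1 + Real.log (4 * q * M) ≤ a * (1 + t)) (hb : 1 + Real.log (2 * κ ^ 2) ≤ b * (1 + t))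
    (ha0 : 0 ≤ 1 + Real.log (4 * q * M)) (hb0 : 0 ≤ 1 + Real.log (2 * κ ^ 2)) :
    2 ^ p * (N * ((12 * q) ^ p * Real.exp p * (1 + Real.log (4 * q * M))) * Real.exp (-t)) *
      (3 ^ p * Real.exp p * (1 + Real.log (2 * κ ^ 2))) + N * Real.exp (-t) ≤
    (2 ^ p * P * ((12 * q) ^ p * Real.exp p) * (3 ^ p * Real.exp p) * (a * b) + P) *
      ((1 + t) ^ 2 * E) := by
  have h1 : N * Real.exp (-t) ≤ P * E := by
    calc N * Real.exp (-t) ≤ P * (E * Real.exp t) * Real.exp (-t) := by gcongr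
      _ = P * E * (Real.exp t * Real.exp (-t)) := by ring
      _ = P * E := by rw [← Real.exp_add]; simp
  have h2 : (1 + Real.log (4 * q * M)) * (1 + Real.log (2 * κ ^ 2)) ≤ a * b * (1 + t) ^ 2 := by
    calc _ ≤ (a * (1 + t)) * (b * (1 + t)) := mul_le_mul ha hb hb0 (ha0.trans ha)
      _ = _ := by ring
  have h0 : 0 ≤ N * Real.exp (-t) := by positivity
  have h3 : N * Real.exp (-t) * ((1 + Real.log (4 * q * M)) * (1 + Real.log (2 * κ ^ 2)))
      ≤ P * E * (a * b * (1 + t) ^ 2) :=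
    mul_le_mul h1 h2 (by positivity) (by positivity)
  have h4 : (1 : ℝ) ≤ (1 + t) ^ 2 := by nlinarith
  have h5 : P * E ≤ P * ((1 + t) ^ 2 * E) := by
    have : 0 ≤ P * E := by positivity
    nlinarith
  calc _ = (2 ^ p * ((12 * q) ^ p * Real.exp p) * (3 ^ p * Real.exp p)) *
        (N * Real.exp (-t) * ((1 + Real.log (4 * q * M)) * (1 + Real.log (2 * κ ^ 2))))
          + N * Real.exp (-t) := by ring
    _ ≤ (2 ^ p * ((12 * q) ^ p * Real.exp p) * (3 ^ p * Real.exp p)) *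
        (P * E * (a * b * (1 + t) ^ 2)) + P * ((1 + t) ^ 2 * E) := by
        exact add_le_add (mul_le_mul_of_nonneg_left h3 (by positivity)) (h1.trans h5)
    _ = _ := by ring

lemma inv_inv_pow_det {d : ℕ} (h : Matrix (Fin d) (Fin d) ℝ) (hh : h.det = 1) :
    (((h⁻¹)ᵀ)⁻¹)ᵀ = h := by
  rw [Matrix.transpose_nonsing_inv, Matrix.transpose_transpose,
    Matrix.nonsing_inv_nonsing_inv _ (by simp [hh])]

lemma dual_mul {d : ℕ} (B h : Matrix (Fin d) (Fin d) ℝ) :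
    ((B * h)⁻¹)ᵀ = (B⁻¹)ᵀ * (h⁻¹)ᵀ := by
  rw [Matrix.mul_inv_rev, Matrix.transpose_mul]

lemma lam_inv_pow_le {d : ℕ} (hd : 0 < d) (B h : Matrix (Fin d) (Fin d) ℝ) (hB : B.det = 1)
    (hh : h.det = 1) (κ : ℝ) (hκ : 0 < κ) (hB2 : ∀ v, ‖v‖ ≤ κ * ‖B *ᵥ v‖) (p : ℕ) :
    ((lam (B * h))⁻¹) ^ p ≤ κ ^ p * ((lam h)⁻¹) ^ p := by
  have hl := lam_pos hd h hh
  have hlc := lam_pos hd (B * h) (by rw [Matrix.det_mul, hB, hh, one_mul])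
  have h1 := lam_le_mul hd B h κ hκ hB2
  rw [← mul_pow]
  apply pow_le_pow_left₀ (by positivity)
  rw [← div_eq_mul_inv, inv_le_comm₀ hlc (by positivity), inv_div, div_le_iff₀' hκ]
  exact h1

lemma count_primal {m n M : ℕ} (hm : 0 < m) (hn : 0 < n) (hM : 1 ≤ M) (t : ℝ)
    (h1 : Real.exp (t / m + t / n) ≤ M) (h2 : M ≤ 2 * Real.exp (t / m + t / n))
    (v : Fin (m + n) → ℝ) (hv : v ≠ 0) :
    ∑ c : Fin n → Fin m → IccM M, (‖BM t c *ᵥ v‖⁻¹) ^ m ≤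
      ((2 * M + 1) ^ (m * n) * ((12 * n) ^ m * Real.exp m * (1 + Real.log (4 * n * M)))
        * Real.exp (-t)) * (‖v‖⁻¹) ^ m := by
  have : Nonempty (Fin n) := ⟨⟨0, hn⟩⟩
  have hm' : (m : ℝ) ≠ 0 := by positivity
  have he : Real.exp (t / m) / Real.exp (-(t / n)) = Real.exp (t / m + t / n) := by
    rw [← Real.exp_sub]; congr 1; ring
  have hn' : ‖v‖ = _ := norm_split v
  have key := count_sum (α := Fin m) (β := Fin n) M hM (Real.exp (t / m)) (Real.exp (-(t / n)))
    (Real.exp_pos _) (Real.exp_pos _) (by rw [he]; exact h1) (by rw [he]; exact h2)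
    (fun a : Fin m => v (Fin.castAdd n a)) (fun b : Fin n => v (Fin.natAdd m b))
    (by rw [← hn']; exact norm_pos_iff.2 hv)
  simp only [Fintype.card_fin, ← BM_mulVec_norm] at key
  refine key.trans (le_of_eq ?_)
  rw [← hn', mul_inv, mul_pow _ (‖v‖⁻¹), ← Real.exp_neg, ← Real.exp_nat_mul]
  rw [show (m : ℝ) * -(t / m) = -t by field_simp]
  ring

lemma count_dual {m n M : ℕ} (hm : 0 < m) (hn : 0 < n) (hM : 1 ≤ M) (t : ℝ)
    (h1 : Real.exp (t / m + t / n) ≤ M) (h2 : M ≤ 2 * Real.exp (t / m + t / n))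
    (v : Fin (m + n) → ℝ) (hv : v ≠ 0) :
    ∑ c : Fin n → Fin m → IccM M, (‖((BM t c)⁻¹)ᵀ *ᵥ v‖⁻¹) ^ n ≤
      ((2 * M + 1) ^ (m * n) * ((12 * m) ^ n * Real.exp n * (1 + Real.log (4 * m * M)))
        * Real.exp (-t)) * (‖v‖⁻¹) ^ n := by
  have : Nonempty (Fin m) := ⟨⟨0, hm⟩⟩
  have hm' : (n : ℝ) ≠ 0 := by positivity
  have he : Real.exp (t / n) / Real.exp (-(t / m)) = Real.exp (t / m + t / n) := by
    rw [← Real.exp_sub]; congr 1; ring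
  have hn' : ‖v‖ = max ‖fun b : Fin n => v (Fin.natAdd m b)‖ ‖fun a : Fin m => -v (Fin.castAdd n a)‖ := by
    rw [norm_split v, max_comm]
    congr 1
    exact (norm_neg (fun a : Fin m => v (Fin.castAdd n a))).symm
  have key := count_sum (α := Fin n) (β := Fin m) M hM (Real.exp (t / n)) (Real.exp (-(t / m)))
    (Real.exp_pos _) (Real.exp_pos _) (by rw [he]; exact h1) (by rw [he]; exact h2)
    (fun b : Fin n => v (Fin.natAdd m b)) (fun a : Fin m => -v (Fin.castAdd n a))
    (by rw [← hn']; exact norm_pos_iff.2 hv)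
  have hsw : ∑ c : Fin n → Fin m → IccM M, (‖((BM t c)⁻¹)ᵀ *ᵥ v‖⁻¹) ^ n =
      ∑ c : Fin m → Fin n → IccM M, ((max
      ‖cact (Real.exp (t / n) • fun b : Fin n => v (Fin.natAdd m b))
        (Real.exp (-(t / m)) • fun a : Fin m => -v (Fin.castAdd n a)) c‖
      ‖Real.exp (-(t / m)) • fun a : Fin m => -v (Fin.castAdd n a)‖)⁻¹) ^ n := by
    refine Fintype.sum_equiv (Equiv.piComm _) _ _ ?_
    intro c
    rw [BM_dual_norm]
    rfl
  simp only [Fintype.card_fin] at key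
  rw [hsw]
  refine key.trans (le_of_eq ?_)
  rw [← hn', mul_inv, mul_pow _ (‖v‖⁻¹), ← Real.exp_neg, ← Real.exp_nat_mul, mul_comm n m]
  rw [show (n : ℝ) * -(t / n) = -t by field_simp]
  ring

/-! ### Part 5: the contraction inequality -/

lemma wt_ge_one {m n : ℕ} (hm : 0 < m) (h : Matrix (Fin (m + n)) (Fin (m + n)) ℝ) (hh : h.det = 1) :
    1 ≤ wt h := by
  have h1 := lam_pos (by omega : 0 < m + n) h hh
  have h2 := lam_pos (by omega : 0 < m + n) _ (det_dual h hh)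
  have h3 : 0 ≤ ((lam h)⁻¹) ^ m := by positivity
  have h4 : 0 ≤ ((lam ((h⁻¹)ᵀ))⁻¹) ^ n := by positivity
  unfold wt; linarith

set_option maxHeartbeats 2000000 in
lemma contraction (m n : ℕ) (hm : 0 < m) (hn : 0 < n) : ∃ C0 : ℝ, 1 ≤ C0 ∧ ∀ t : ℕ, 1 ≤ t →
    ∃ M : ℕ, 1 ≤ M ∧ Real.exp (t / m + t / n) ≤ M ∧ ∃ W C' : ℝ, 1 ≤ W ∧ 1 ≤ C' ∧
    ∀ h : Matrix (Fin (m + n)) (Fin (m + n)) ℝ, h.det = 1 →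
    (W ≤ wt h → ∑ c : Fin n → Fin m → IccM M, wt (BM t c * h) ≤
      C0 * ((1 + t) ^ 2 * Real.exp ((m + n - 1) * t)) * wt h) ∧
    ∑ c : Fin n → Fin m → IccM M, wt (BM t c * h) ≤
      C' * (C0 * ((1 + t) ^ 2 * Real.exp ((m + n - 1) * t)) * wt h) := by
  have hd0 : 0 < m + n := by omega
  have hm1 : (1 : ℝ) ≤ m := by exact_mod_cast hm
  have hn1 : (1 : ℝ) ≤ n := by exact_mod_cast hn
  set D : ℝ := ((m + n : ℕ) : ℝ) with hD
  have hD1 : 1 ≤ D := by rw [hD]; exact_mod_cast hd0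
  set P : ℝ := 5 ^ (m * n) with hP
  have hP1 : 1 ≤ P := one_le_pow₀ (by norm_num)
  set an : ℝ := 3 + Real.log (8 * n) with han
  set am : ℝ := 3 + Real.log (8 * m) with ham
  set b : ℝ := 7 + Real.log (8 * D ^ 8) with hb
  have han0 : 0 ≤ Real.log (8 * n) := Real.log_nonneg (by linarith)
  have ham0 : 0 ≤ Real.log (8 * m) := Real.log_nonneg (by linarith)
  have hb0 : 0 ≤ Real.log (8 * D ^ 8) := Real.log_nonneg (by
    have : (1 : ℝ) ≤ D ^ 8 := one_le_pow₀ hD1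
    linarith)
  set C1 : ℝ := 2 ^ m * P * ((12 * n) ^ m * Real.exp m) * (3 ^ m * Real.exp m) * (an * b) + P with hC1
  set C2 : ℝ := 2 ^ n * P * ((12 * m) ^ n * Real.exp n) * (3 ^ n * Real.exp n) * (am * b) + P with hC2
  have hC1P : P ≤ C1 := by
    have : 0 ≤ 2 ^ m * P * ((12 * n) ^ m * Real.exp m) * (3 ^ m * Real.exp m) * (an * b) := by
      positivity
    linarith
  have hC2P : P ≤ C2 := by
    have : 0 ≤ 2 ^ n * P * ((12 * m) ^ n * Real.exp n) * (3 ^ n * Real.exp n) * (am * b) := by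
      positivity
    linarith
  refine ⟨P + C1 + C2, by linarith, ?_⟩
  intro t ht
  have ht1 : (1 : ℝ) ≤ t := by exact_mod_cast ht
  have ht0 : (0 : ℝ) ≤ t := by linarith
  set lm := Real.exp ((t : ℝ) / m + t / n) with hlm
  have hlm1 : 1 ≤ lm := by
    rw [hlm]; apply Real.one_le_exp; positivity
  have hlm2 : lm ≤ Real.exp (2 * t) := by
    rw [hlm]; apply Real.exp_le_exp.2
    have h1 : (t : ℝ) / m ≤ t := div_le_self ht0 hm1
    have h2 : (t : ℝ) / n ≤ t := div_le_self ht0 hn1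
    linarith
  set M := ⌈lm⌉₊ with hM
  have hM1 : lm ≤ M := Nat.le_ceil _
  have hM2 : (M : ℝ) ≤ 2 * lm := by
    have := Nat.ceil_lt_add_one (show 0 ≤ lm by linarith)
    rw [← hM] at this; linarith
  have hM1' : (1 : ℝ) ≤ M := by linarith
  have hM0 : 1 ≤ M := by exact_mod_cast hM1'
  set E := Real.exp (((m : ℝ) + n - 1) * t) with hE
  have hEpos : 0 < E := Real.exp_pos _
  set N : ℝ := (2 * (M : ℝ) + 1) ^ (m * n) with hN
  have hNpos : 0 < N := by positivity
  have hN2 : N ≤ P * (E * Real.exp t) := by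
    have h1 : E * Real.exp t = lm ^ (m * n) := by
      rw [hE, ← Real.exp_add, hlm, ← Real.exp_nat_mul]
      congr 1; push_cast; field_simp; ring
    rw [h1, hP, ← mul_pow]
    apply pow_le_pow_left₀ (by positivity)
    linarith
  have hcard : (Fintype.card (Fin n → Fin m → IccM M) : ℝ) = N := by
    rw [Fintype.card_fun, Fintype.card_fun, card_IccM]
    simp [hN, pow_mul]
  set κ : ℝ := D ^ 4 * (M * Real.exp t) with hκ
  have het1 : 1 ≤ Real.exp (t : ℝ) := Real.one_le_exp ht0
  have hκ1 : 1 ≤ κ := by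
    rw [hκ]
    exact one_le_mul_of_one_le_of_one_le (one_le_pow₀ hD1) (one_le_mul_of_one_le_of_one_le hM1' het1)
  have hκ0 : 0 < κ := by linarith
  have logq : ∀ q : ℝ, 1 ≤ q → 1 + Real.log (4 * q * M) ≤ (3 + Real.log (8 * q)) * (1 + t) ∧
      0 ≤ 1 + Real.log (4 * q * M) := by
    intro q hq
    have h0 : 0 ≤ Real.log (8 * q) := Real.log_nonneg (by linarith)
    constructor
    · have h1 : Real.log (4 * q * M) ≤ Real.log (8 * q * Real.exp (2 * t)) := by
        apply Real.log_le_log (by positivity)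
        nlinarith
      rw [Real.log_mul (x := 8 * q) (by positivity) (by positivity), Real.log_exp] at h1
      nlinarith
    · have : 0 ≤ Real.log (4 * q * M) := Real.log_nonneg (by nlinarith)
      linarith
  have logκ : 1 + Real.log (2 * κ ^ 2) ≤ b * (1 + t) := by
    have h1 : 2 * κ ^ 2 ≤ 8 * D ^ 8 * Real.exp (6 * t) := by
      have h2 : κ ≤ D ^ 4 * (2 * Real.exp (2 * t) * Real.exp t) := by
        rw [hκ]; gcongr; linarith
      calc 2 * κ ^ 2 ≤ 2 * (D ^ 4 * (2 * Real.exp (2 * t) * Real.exp t)) ^ 2 := by gcongr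
        _ = 8 * D ^ 8 * (Real.exp (2 * t) * Real.exp (2 * t) * (Real.exp t * Real.exp t)) := by ring
        _ = _ := by rw [← Real.exp_add, ← Real.exp_add, ← Real.exp_add]; ring_nf
    have h2 := Real.log_le_log (by positivity) h1
    rw [Real.log_mul (x := 8 * D ^ 8) (by positivity) (by positivity), Real.log_exp] at h2
    rw [hb]; nlinarith
  have logκ0 : 0 ≤ 1 + Real.log (2 * κ ^ 2) := by
    have : 0 ≤ Real.log (2 * κ ^ 2) := Real.log_nonneg (by
      have : 1 ≤ κ ^ 2 := one_le_pow₀ hκ1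
      linarith)
    linarith
  have bnd := fun (c : Fin n → Fin m → IccM M) v => BM_bounds hm hn hM0 (t : ℝ) ht0 c v
  have low : ∀ (c : Fin n → Fin m → IccM M) v, ‖v‖ ≤ κ * ‖BM (t : ℝ) c *ᵥ v‖ := by
    intro c v
    have h1 := (bnd c (BM (t : ℝ) c *ᵥ v)).2.1
    rwa [Matrix.mulVec_mulVec, Matrix.nonsing_inv_mul _ (by simp [BM_det hm hn]),
      Matrix.one_mulVec] at h1
  have lowd : ∀ (c : Fin n → Fin m → IccM M) v, ‖v‖ ≤ κ * ‖((BM (t : ℝ) c)⁻¹)ᵀ *ᵥ v‖ := by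
    intro c v
    have h1 := (bnd c (((BM (t : ℝ) c)⁻¹)ᵀ *ᵥ v)).2.2.2
    rwa [Matrix.mulVec_mulVec, ← Matrix.transpose_mul, Matrix.nonsing_inv_mul _ (by simp [BM_det hm hn]),
      Matrix.transpose_one, Matrix.one_mulVec] at h1
  obtain ⟨W1, hW1, side1⟩ := side_bound m n hm hn rfl
    (fun c : Fin n → Fin m → IccM M => BM (t : ℝ) c) κ
    (N * ((12 * n) ^ m * Real.exp m * (1 + Real.log (4 * n * M))) * Real.exp (-(t : ℝ)))
    (Real.exp (-(t : ℝ))) hκ1 (by have := (logq n hn1).2; positivity) (Real.exp_pos _)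
    (fun c => BM_det hm hn _ c) (fun c v => (bnd c v).1) low
    (fun v hv => count_primal hm hn hM0 t hM1 hM2 v hv)
  obtain ⟨W2, hW2, side2⟩ := side_bound n m hn hm (add_comm m n)
    (fun c : Fin n → Fin m → IccM M => ((BM (t : ℝ) c)⁻¹)ᵀ) κ
    (N * ((12 * m) ^ n * Real.exp n * (1 + Real.log (4 * m * M))) * Real.exp (-(t : ℝ)))
    (Real.exp (-(t : ℝ))) hκ1 (by have := (logq m hm1).2; positivity) (Real.exp_pos _)
    (fun c => det_dual _ (BM_det hm hn _ c)) (fun c v => (bnd c v).2.2.1) lowd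
    (fun v hv => count_dual hm hn hM0 t hM1 hM2 v hv)
  rw [hcard] at side1 side2
  have coef1 := coef_bound m n t P M κ N E an b ht0 (by linarith) hEpos.le hNpos.le hN2
    (logq n hn1).1 logκ (logq n hn1).2 logκ0
  have coef2 := coef_bound n m t P M κ N E am b ht0 (by linarith) hEpos.le hNpos.le hN2
    (logq m hm1).1 logκ (logq m hm1).2 logκ0
  set G : ℝ := (1 + (t : ℝ)) ^ 2 * E with hG
  have hGpos : 0 < G := by positivity
  have hEG : E ≤ G := by
    rw [hG]
    have : (1 : ℝ) ≤ (1 + (t : ℝ)) ^ 2 := one_le_pow₀ (by linarith)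
    exact le_mul_of_one_le_left hEpos.le this
  have split : ∀ h : Matrix (Fin (m + n)) (Fin (m + n)) ℝ,
      ∑ c : Fin n → Fin m → IccM M, wt (BM (t : ℝ) c * h) = N +
        ∑ c : Fin n → Fin m → IccM M, ((lam (BM (t : ℝ) c * h))⁻¹) ^ m +
        ∑ c : Fin n → Fin m → IccM M, ((lam (((BM (t : ℝ) c)⁻¹)ᵀ * (h⁻¹)ᵀ))⁻¹) ^ n := by
    intro h
    simp only [wt, dual_mul]
    rw [Finset.sum_add_distrib, Finset.sum_add_distrib]
    congr 2
    rw [Finset.sum_const, Finset.card_univ, nsmul_eq_mul, mul_one, hcard]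
  refine ⟨M, hM0, hM1, max (Real.exp t) (max W1 W2), max 1 (N * (κ ^ m + κ ^ n + 1) / ((P + C1 + C2) * G)),
    het1.trans (le_max_left _ _), le_max_left _ _, ?_⟩
  intro h hh
  have hw1 := wt_ge_one hm h hh
  have hw0 : 0 < wt h := by linarith
  have hl := lam_pos hd0 h hh
  have hs := lam_pos hd0 _ (det_dual h hh)
  have hlw : ((lam h)⁻¹) ^ m ≤ wt h := by
    have : 0 ≤ ((lam ((h⁻¹)ᵀ))⁻¹) ^ n := by positivity
    simp only [wt]; linarith
  have hsw : ((lam ((h⁻¹)ᵀ))⁻¹) ^ n ≤ wt h := by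
    have : 0 ≤ ((lam h)⁻¹) ^ m := by positivity
    simp only [wt]; linarith
  constructor
  · intro hW
    rw [split]
    have e1 := side1 h hh (wt h) (((le_max_left _ _).trans (le_max_right _ _)).trans hW) hlw hsw
    have e2 := side2 _ (det_dual h hh) (wt h)
      (((le_max_right _ _).trans (le_max_right _ _)).trans hW) hsw (by
        rw [inv_inv_pow_det h hh]; exact hlw)
    have e3 : N ≤ P * G * wt h := by
      calc N ≤ P * (E * Real.exp t) := hN2
        _ ≤ P * (G * wt h) := by
            gcongr
            exact (le_max_left _ _).trans hW
        _ = _ := by ring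
    have e1' := e1.trans (mul_le_mul_of_nonneg_right coef1 hw0.le)
    have e2' := e2.trans (mul_le_mul_of_nonneg_right coef2 hw0.le)
    calc _ ≤ P * G * wt h + C1 * G * wt h + C2 * G * wt h := add_le_add (add_le_add e3 e1') e2'
      _ = _ := by ring
  · have e1 : ∑ c : Fin n → Fin m → IccM M, ((lam (BM (t : ℝ) c * h))⁻¹) ^ m ≤ N * κ ^ m * wt h := by
      calc _ ≤ ∑ c : Fin n → Fin m → IccM M, κ ^ m * wt h := by
            apply Finset.sum_le_sum
            intro c _
            refine (lam_inv_pow_le hd0 _ h (BM_det hm hn _ c) hh κ hκ0 (low c) m).trans ?_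
            gcongr
        _ = _ := by rw [Finset.sum_const, Finset.card_univ, nsmul_eq_mul, hcard]; ring
    have e2 : ∑ c : Fin n → Fin m → IccM M, ((lam (((BM (t : ℝ) c)⁻¹)ᵀ * (h⁻¹)ᵀ))⁻¹) ^ n
        ≤ N * κ ^ n * wt h := by
      calc _ ≤ ∑ c : Fin n → Fin m → IccM M, κ ^ n * wt h := by
            apply Finset.sum_le_sum
            intro c _
            refine (lam_inv_pow_le hd0 _ _ (det_dual _ (BM_det hm hn _ c)) (det_dual h hh) κ hκ0
              (lowd c) n).trans ?_
            gcongr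
        _ = _ := by rw [Finset.sum_const, Finset.card_univ, nsmul_eq_mul, hcard]; ring
    rw [split]
    have hpos : 0 < (P + C1 + C2) * G := by
      apply mul_pos _ hGpos; linarith
    calc _ ≤ N * wt h + N * κ ^ m * wt h + N * κ ^ n * wt h := by
          refine add_le_add (add_le_add ?_ e1) e2
          nlinarith
      _ = (N * (κ ^ m + κ ^ n + 1) / ((P + C1 + C2) * G)) * ((P + C1 + C2) * G * wt h) := by
          have hne : (P + C1 + C2) * G ≠ 0 := hpos.ne'
          generalize (P + C1 + C2) * G = Z at *
          field_simp; ring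
      _ ≤ _ := by
          apply mul_le_mul_of_nonneg_right (le_max_right _ _)
          positivity

/-! ### Part 6: the covering tree -/

/-- indicator of the thick part -/
def Fth {d : ℕ} (ε : ℝ) (h : Matrix (Fin d) (Fin d) ℝ) : ℝ :=
  open Classical in if ε ≤ lam h then 1 else 0

lemma Fth_nonneg {d : ℕ} (ε : ℝ) (h : Matrix (Fin d) (Fin d) ℝ) : 0 ≤ Fth ε h := by
  unfold Fth; split_ifs <;> norm_num

/-- data of a covering tree -/
def TreeAt (m n : ℕ) (lm ε logG logC : ℝ) (t L : ℕ) (g : Matrix (Fin (m + n)) (Fin (m + n)) ℝ) :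
    Prop :=
  ∃ (J : Type) (_ : Fintype J) (q : J → ℝ) (D : J → Set (Fin m → Fin n → ℝ)),
    (∀ j, 0 < q j) ∧ ∑ j, q j ≤ 1 ∧ (∀ j, IsCompact (D j)) ∧
    (∀ A : Fin m → Fin n → ℝ, ‖A‖ ≤ 1 → ∃ j, A ∈ D j) ∧
    (∀ j, ∀ A ∈ D j, ∀ A' ∈ D j, ‖A - A'‖ * lm ^ L ≤ 2) ∧
    (∀ j, ∀ A ∈ D j, ‖A‖ ≤ 1) ∧
    ∀ j, ∀ A ∈ D j, -Real.log (q j) ≤ L * logG + Real.log (wt g) +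
      logC * ∑ l ∈ Finset.range L, Fth ε (aMat m n (t * l) * uMat m n A * g)

lemma tree (m n : ℕ) (hm : 0 < m) (hn : 0 < n) (t M : ℕ) (G W C' : ℝ) (hG : 0 < G)
    (hW : 1 ≤ W) (hC' : 1 ≤ C') (hM : Real.exp (t / m + t / n) ≤ M)
    (hcon : ∀ h : Matrix (Fin (m + n)) (Fin (m + n)) ℝ, h.det = 1 →
      (W ≤ wt h → ∑ c : Fin n → Fin m → IccM M, wt (BM t c * h) ≤ G * wt h) ∧
      ∑ c : Fin n → Fin m → IccM M, wt (BM t c * h) ≤ C' * (G * wt h)) (L : ℕ) :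
    ∀ g : Matrix (Fin (m + n)) (Fin (m + n)) ℝ, g.det = 1 →
      TreeAt m n (Real.exp (t / m + t / n)) (((m + n : ℕ) : ℝ) ^ 2 * W)⁻¹ (Real.log G) (Real.log C')
        t L g := by
  have hd0 : 0 < m + n := by omega
  set lm := Real.exp ((t : ℝ) / m + t / n) with hlm
  have hlmpos : 0 < lm := Real.exp_pos _
  have hlogC : 0 ≤ Real.log C' := Real.log_nonneg hC'
  induction L with
  | zero =>
    intro g hg
    refine ⟨Unit, inferInstance, fun _ => 1, fun _ => Metric.closedBall 0 1, by simp, by simp,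
      fun _ => isCompact_closedBall 0 1, fun A hA => ⟨(), by simpa using hA⟩, ?_, ?_, ?_⟩
    · intro _ A hA A' hA'
      have h1 : ‖A‖ ≤ 1 := by simpa using hA
      have h2 : ‖A'‖ ≤ 1 := by simpa using hA'
      rw [pow_zero, mul_one]
      linarith [norm_sub_le A A']
    · intro _ A hA; simpa using hA
    · intro _ A hA
      have := Real.log_nonneg (wt_ge_one hm g hg)
      simpa using this
  | succ L ih =>
    intro g hg
    have hdet : ∀ c : Fin n → Fin m → IccM M, (BM (t : ℝ) c * g).det = 1 := fun c => by
      rw [Matrix.det_mul, BM_det hm hn, hg, one_mul]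
    choose J hJ q D hq hsum hcpt hcov hdiam hball hlog using fun c => ih (BM (t : ℝ) c * g) (hdet c)
    have hwpos : ∀ c : Fin n → Fin m → IccM M, 0 < wt (BM (t : ℝ) c * g) := fun c =>
      lt_of_lt_of_le one_pos (wt_ge_one hm _ (hdet c))
    set S := ∑ c : Fin n → Fin m → IccM M, wt (BM (t : ℝ) c * g) with hS
    have hSpos : 0 < S := Finset.sum_pos (fun c _ => hwpos c)
      ⟨fun _ _ => ⟨0, by rw [Finset.mem_Icc]; constructor <;> simp⟩, Finset.mem_univ _⟩
    have hgpos : 0 < wt g := lt_of_lt_of_le one_pos (wt_ge_one hm g hg)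
    have hlogS : ∀ A : Fin m → Fin n → ℝ, ‖A‖ ≤ 1 → Real.log S ≤ Real.log G + Real.log (wt g) +
        Real.log C' * Fth (((m + n : ℕ) : ℝ) ^ 2 * W)⁻¹ (uMat m n A * g) := by
      intro A hA
      by_cases hw : W ≤ wt g
      · have h1 := Real.log_le_log hSpos ((hcon g hg).1 hw)
        rw [Real.log_mul hG.ne' hgpos.ne'] at h1
        have := mul_nonneg hlogC (Fth_nonneg (((m + n : ℕ) : ℝ) ^ 2 * W)⁻¹ (uMat m n A * g))
        linarith
      · have h1 := Real.log_le_log hSpos (hcon g hg).2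
        rw [Real.log_mul (by positivity) (by positivity), Real.log_mul hG.ne' hgpos.ne'] at h1
        have hl := lam_pos hd0 g hg
        have hl1 := lam_le_one hd0 g hg
        have hs := lam_pos hd0 _ (det_dual g hg)
        have h2 : (lam g)⁻¹ ≤ W := by
          rw [not_le] at hw
          calc (lam g)⁻¹ ≤ ((lam g)⁻¹) ^ m :=
                le_self_pow₀ (by rw [one_le_inv₀ hl]; exact hl1) hm.ne'
            _ ≤ wt g := by
                have : 0 ≤ ((lam ((g⁻¹)ᵀ))⁻¹) ^ n := by positivity
                simp only [wt]; linarith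
            _ ≤ W := hw.le
        have hdd : (0 : ℝ) < ((m + n : ℕ) : ℝ) ^ 2 := by positivity
        have h3 : lam g ≤ ((m + n : ℕ) : ℝ) ^ 2 * lam (uMat m n A * g) := by
          apply lam_le_mul hd0 _ _ _ hdd
          intro v
          have h4 : v = uMat m n (-A) *ᵥ (uMat m n A *ᵥ v) := by
            rw [Matrix.mulVec_mulVec, uMat_mul, neg_add_cancel, uMat_zero, Matrix.one_mulVec]
          have h5 := nb_mulVec (uMat m n (-A)) (uMat m n A *ᵥ v)
          rw [← h4] at h5
          refine h5.trans (mul_le_mul_of_nonneg_right ?_ (norm_nonneg _))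
          have h6 := nb_le (uMat m n (-A)) 1 (uMat_entry _ 1 le_rfl (fun i j => by
            have h7 := (norm_le_pi_norm (A i) j).trans ((norm_le_pi_norm A i).trans hA)
            show |-(A i j)| ≤ 1
            rwa [abs_neg]))
          rwa [mul_one] at h6
        have h4 : Fth (((m + n : ℕ) : ℝ) ^ 2 * W)⁻¹ (uMat m n A * g) = 1 := by
          unfold Fth
          rw [if_pos]
          rw [mul_inv, ← div_eq_inv_mul, div_le_iff₀' hdd]
          refine le_trans ?_ h3
          rw [inv_le_comm₀ (by linarith) hl]; exact h2
        rw [h4, mul_one]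
        linarith
    refine ⟨Σ c, J c, inferInstance, fun x => wt (BM (t : ℝ) x.1 * g) / S * q x.1 x.2,
      fun x => Metric.closedBall 0 1 ∩ (fun A => lm • A - cmat x.1) ⁻¹' (D x.1 x.2), ?_, ?_, ?_, ?_,
      ?_, ?_, ?_⟩
    · intro x
      exact mul_pos (div_pos (hwpos _) hSpos) (hq _ _)
    · rw [Fintype.sum_sigma]
      calc ∑ c, ∑ j, wt (BM (t : ℝ) c * g) / S * q c j
          = ∑ c, wt (BM (t : ℝ) c * g) / S * ∑ j, q c j := by
            apply Finset.sum_congr rfl; intro c _; rw [Finset.mul_sum]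
        _ ≤ ∑ c, wt (BM (t : ℝ) c * g) / S * 1 := by
            apply Finset.sum_le_sum; intro c _
            exact mul_le_mul_of_nonneg_left (hsum c) (div_pos (hwpos _) hSpos).le
        _ = 1 := by
            simp only [mul_one]
            rw [← Finset.sum_div, ← hS, div_self hSpos.ne']
    · intro x
      apply (isCompact_closedBall _ _).inter_right
      apply (hcpt x.1 x.2).isClosed.preimage
      fun_prop
    · intro A hA
      have hlA : ∀ i j, |lm * A i j| ≤ M := by
        intro i j
        have h7 := (norm_le_pi_norm (A i) j).trans ((norm_le_pi_norm A i).trans hA)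
        rw [Real.norm_eq_abs] at h7
        rw [abs_mul, abs_of_pos hlmpos]
        nlinarith [abs_nonneg (A i j)]
      let c : Fin n → Fin m → IccM M := fun b a => ⟨⌊lm * A a b⌋, by
        have := abs_le.1 (hlA a b)
        rw [Finset.mem_Icc]
        constructor
        · rw [Int.le_floor]; push_cast; exact this.1
        · have h1 := (Int.floor_le (lm * A a b)).trans this.2
          exact_mod_cast h1⟩
      have hA' : ‖lm • A - cmat c‖ ≤ 1 := by
        rw [pi_norm_le_iff_of_nonneg zero_le_one]
        intro i
        rw [pi_norm_le_iff_of_nonneg zero_le_one]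
        intro j
        show |lm * A i j - ((⌊lm * A i j⌋ : ℤ) : ℝ)| ≤ 1
        have h1 := Int.floor_le (lm * A i j)
        have h2 := Int.lt_floor_add_one (lm * A i j)
        rw [abs_le]; constructor <;> linarith
      obtain ⟨j, hj⟩ := hcov c _ hA'
      exact ⟨⟨c, j⟩, by simpa using hA, hj⟩
    · rintro x A ⟨_, hA⟩ A' ⟨_, hA'⟩
      have h1 := hdiam x.1 x.2 _ hA _ hA'
      have h2 : lm • A - cmat x.1 - (lm • A' - cmat x.1) = lm • (A - A') := by
        rw [smul_sub]; abel
      rw [h2, norm_smul, Real.norm_eq_abs, abs_of_pos hlmpos] at h1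
      calc _ = lm * ‖A - A'‖ * lm ^ L := by ring
        _ ≤ 2 := h1
    · rintro x A ⟨hA, _⟩; simpa using hA
    · rintro x A ⟨hA1, hA⟩
      have hA1' : ‖A‖ ≤ 1 := by simpa using hA1
      have h1 := hlog x.1 x.2 _ hA
      have h2 := hlogS A hA1'
      have hmat : ∀ l : ℕ, aMat m n (t * l) * uMat m n (lm • A - cmat x.1) * (BM (t : ℝ) x.1 * g)
          = aMat m n (t * (l + 1 : ℕ)) * uMat m n A * g := by
        intro l
        have h3 : uMat m n (lm • A - cmat x.1) * BM (t : ℝ) x.1 = aMat m n t * uMat m n A := by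
          rw [BM, ← Matrix.mul_assoc, uMat_mul, sub_add_cancel, aMat_uMat]
        rw [Matrix.mul_assoc, ← Matrix.mul_assoc (uMat _ _ _), h3, ← Matrix.mul_assoc,
          ← Matrix.mul_assoc, aMat_mul]
        congr 3
        push_cast; ring
      rw [Finset.sum_congr rfl (fun l _ => by rw [hmat l])] at h1
      rw [Real.log_mul (div_pos (hwpos _) hSpos).ne' (hq _ _).ne', Real.log_div (hwpos _).ne' hSpos.ne',
        Finset.sum_range_succ']
      simp only [Nat.cast_zero, mul_zero, aMat_zero, Matrix.one_mul]
      push_cast at h1 h2 ⊢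
      linarith

/-! ### Part 7: the Mahler compactness criterion -/

lemma mahler_span {d : ℕ} (hd : 0 < d) (ε : ℝ) (hε : 0 < ε) (hε1 : ε ≤ 1) :
    ∃ R : ℝ, 0 < R ∧ ∀ h : Matrix (Fin d) (Fin d) ℝ, h.det = 1 → ε ≤ lam h →
      shortSpan h R = ⊤ := by
  have hd' : (1 : ℝ) ≤ d := by exact_mod_cast hd
  set e := ε / (2 * d) with he
  have hepos : 0 < e := by positivity
  have he1 : e ≤ 1 := by
    rw [he, div_le_one (by positivity)]; linarith
  set S := 2 / e ^ d with hS
  have hS1 : 1 ≤ S := by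
    rw [hS, one_le_div (by positivity)]
    have := pow_le_one₀ hepos.le he1 (n := d); linarith
  refine ⟨d * S, by positivity, ?_⟩
  intro h hh hl
  by_contra hne
  set E := shortSpan h (d * S) with hE
  set k := Module.finrank ℝ E with hk
  have hkd : k < d := by
    have := Submodule.finrank_lt hne
    simpa using this
  obtain ⟨O, hO1, hO2, hO3, -⟩ := exists_adapted E
  have hOe := orth_entry O hO1
  have hOTe : ∀ i j, |Oᵀ i j| ≤ 1 := fun i j => hOe j i
  have hback : ∀ v : Fin d → ℝ, Oᵀ *ᵥ (O *ᵥ v) = v := fun v => by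
    rw [Matrix.mulVec_mulVec, hO2, Matrix.one_mulVec]
  obtain ⟨z, hz, hzr⟩ := minkowski_box (O * h)
    (by rw [Matrix.det_mul, hh, mul_one]; exact orth_det O hO1)
    (fun i => if (i : ℕ) < k then e else S) (fun i => by split_ifs <;> linarith) (by
      rw [prod_two hkd.le]
      obtain ⟨j, hj⟩ : ∃ j, d - k = j + 1 := ⟨d - k - 1, by omega⟩
      have h1 : S ≤ S ^ (d - k) := by rw [hj]; exact le_self_pow₀ hS1 (by omega)
      have h2 : e ^ d ≤ e ^ k := pow_le_pow_of_le_one hepos.le he1 hkd.le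
      calc (1 : ℝ) < 2 := by norm_num
        _ = e ^ d * S := by rw [hS]; field_simp
        _ ≤ e ^ k * S ^ (d - k) := mul_le_mul h2 h1 (by linarith) (by positivity))
  rw [← Matrix.mulVec_mulVec] at hzr
  have hb1 : ‖h *ᵥ zv z‖ ≤ d * S := by
    rw [pi_norm_le_iff_of_nonneg (by positivity)]
    intro i
    rw [← hback (h *ᵥ zv z)]
    apply orth_norm _ hOTe
    intro i
    have := hzr i
    split_ifs at this <;> linarith
  have hmem : h *ᵥ zv z ∈ E := Submodule.subset_span ⟨z, rfl, hb1⟩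
  have hb2 : ‖h *ᵥ zv z‖ ≤ d * e := by
    rw [pi_norm_le_iff_of_nonneg (by positivity)]
    intro i
    rw [← hback (h *ᵥ zv z)]
    apply orth_norm _ hOTe
    intro i
    have := hzr i
    split_ifs at this with hi
    · exact this.le
    · rw [hO3 _ hmem i (not_lt.1 hi), abs_zero]; exact hepos.le
  have h3 := lam_le h z hz
  have h4 : d * e = ε / 2 := by rw [he]; field_simp
  linarith

/-- the integer matrix as a real matrix -/
def rmat {d : ℕ} (N : Matrix (Fin d) (Fin d) ℤ) : Matrix (Fin d) (Fin d) ℝ := N.map (Int.cast)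

lemma rmat_mul {d : ℕ} (N N' : Matrix (Fin d) (Fin d) ℤ) : rmat (N * N') = rmat N * rmat N' := by
  unfold rmat
  exact Matrix.map_mul (f := Int.castRingHom ℝ)

lemma rmat_det {d : ℕ} (N : Matrix (Fin d) (Fin d) ℤ) : (rmat N).det = (N.det : ℝ) := by
  have := (Int.castRingHom ℝ).map_det N
  simpa [rmat] using this.symm

lemma short_basis {d : ℕ} (hd : 0 < d) (ε : ℝ) (hε : 0 < ε) (hε1 : ε ≤ 1) :
    ∃ R : ℝ, 0 < R ∧ ∀ h : Matrix (Fin d) (Fin d) ℝ, h.det = 1 → ε ≤ lam h →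
      ∃ N : Matrix (Fin d) (Fin d) ℤ, N.det ≠ 0 ∧ ∀ i j, |(h * rmat N) i j| ≤ R := by
  obtain ⟨R, hR, hspan⟩ := mahler_span hd ε hε hε1
  refine ⟨R, hR, ?_⟩
  intro h hh hl
  have ht := hspan h hh hl
  unfold shortSpan at ht
  obtain ⟨f, hf1, hf2, hf3⟩ := Submodule.exists_fun_fin_finrank_span_eq ℝ
    {w | ∃ z : Fin d → ℤ, w = h *ᵥ zv z ∧ ‖w‖ ≤ R}
  have hfin : Module.finrank ℝ (Submodule.span ℝ {w | ∃ z : Fin d → ℤ, w = h *ᵥ zv z ∧ ‖w‖ ≤ R})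
      = d := by
    rw [ht]; simp
  let e : Fin d ≃ Fin _ := finCongr hfin.symm
  have hf3' := hf3.comp e e.injective
  choose z hz1 hz2 using fun i => hf1 (e i)
  let N : Matrix (Fin d) (Fin d) ℤ := Matrix.of fun i j => z j i
  have hcol : ∀ j i, (h * rmat N) i j = f (e j) i := by
    intro j i
    rw [hz1 j, Matrix.mul_apply]
    rfl
  refine ⟨N, ?_, ?_⟩
  · intro h0
    have h1 : (h * rmat N).det = 0 := by
      rw [Matrix.det_mul, rmat_det, h0]; simp
    have h2 : LinearIndependent ℝ ((h * rmat N).col) := by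
      have h5 : (h * rmat N).col = f ∘ e := by
        ext j i
        exact hcol j i
      rw [h5]
      exact hf3'
    have h3 := Matrix.linearIndependent_cols_iff_isUnit.1 h2
    rw [Matrix.isUnit_iff_isUnit_det, h1] at h3
    simp at h3
  · intro i j
    rw [hcol]
    have := (norm_le_pi_norm (f (e j)) i).trans (hz2 j)
    simpa using this

lemma int_quot {d : ℕ} (N N' : Matrix (Fin d) (Fin d) ℤ) (hN : N.det ≠ 0) (hdet : N'.det = N.det)
    (hmod : ∀ i j, N i j ≡ N' i j [ZMOD N.det]) :
    ∃ γ : Matrix (Fin d) (Fin d) ℤ, γ.det = 1 ∧ N' = γ * N := by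
  have hdiv : ∀ i j, N.det ∣ (N' * N.adjugate) i j := by
    intro i j
    have h1 : (N' * N.adjugate) i j = ((N' - N) * N.adjugate) i j + (N * N.adjugate) i j := by
      rw [sub_mul]; simp
    rw [h1, Matrix.mul_adjugate]
    apply dvd_add
    · rw [Matrix.mul_apply]
      apply Finset.dvd_sum
      intro l _
      apply Dvd.dvd.mul_right
      rw [Matrix.sub_apply]
      exact (hmod i l).dvd
    · simp
  choose γ hγ using hdiv
  have h1 : N' * N.adjugate = N.det • (Matrix.of γ) := by
    ext i j; simp [hγ i j]
  have h2 : N.det • N' = N.det • ((Matrix.of γ) * N) := by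
    rw [← Matrix.smul_mul, ← h1, Matrix.mul_assoc, Matrix.adjugate_mul, Matrix.mul_smul,
      Matrix.mul_one]
  have h3 : N' = (Matrix.of γ) * N := by
    ext i j
    have := congrFun (congrFun h2 i) j
    simp only [Matrix.smul_apply, smul_eq_mul] at this
    exact mul_left_cancel₀ hN this
  refine ⟨Matrix.of γ, ?_, h3⟩
  have h4 := congrArg Matrix.det h3
  rw [Matrix.det_mul, hdet] at h4
  have : (Matrix.of γ).det * N.det = 1 * N.det := by rw [← h4, one_mul]
  exact mul_right_cancel₀ hN this

lemma mahler_crit {d : ℕ} (hd : 0 < d) (ε : ℝ) (hε : 0 < ε) :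
    ∃ R : ℝ, ∀ h : Matrix (Fin d) (Fin d) ℝ, h.det = 1 → ε ≤ lam h →
      ∃ γ : Matrix (Fin d) (Fin d) ℤ, γ.det = 1 ∧ ∀ i j, |(h * rmat γ) i j| ≤ R := by
  classical
  by_cases hε1 : ε ≤ 1
  swap
  · refine ⟨0, fun h hh hl => ?_⟩
    have := lam_le_one hd h hh
    linarith
  obtain ⟨R, hR, hb⟩ := short_basis hd ε hε hε1
  set D : ℝ := Nat.factorial d * R ^ d with hD
  let key : Matrix (Fin d) (Fin d) ℤ → ℤ × (Fin d → Fin d → ℤ) :=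
    fun N => (N.det, fun i j => N i j % N.det)
  let S : Set (Matrix (Fin d) (Fin d) ℤ) := {N | N.det ≠ 0 ∧ |(N.det : ℝ)| ≤ D}
  have hfin : (key '' S).Finite := by
    apply Set.Finite.subset (s := (Set.Icc (-⌈D⌉) ⌈D⌉) ×ˢ
      (Set.pi Set.univ fun _ : Fin d => Set.pi Set.univ fun _ : Fin d => Set.Icc (0 : ℤ) ⌈D⌉))
    · apply (Set.finite_Icc _ _).prod
      exact Set.Finite.pi fun _ => Set.Finite.pi fun _ => Set.finite_Icc _ _
    · rintro _ ⟨N, ⟨hN1, hN2⟩, rfl⟩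
      have h1 : |N.det| ≤ ⌈D⌉ := by
        have := hN2.trans (Int.le_ceil D)
        rw [← Int.cast_abs] at this
        exact_mod_cast this
      refine ⟨abs_le.1 h1, ?_⟩
      intro i _ j _
      exact ⟨Int.emod_nonneg _ hN1, (Int.emod_lt_abs _ hN1).le.trans h1⟩
  let rep : ℤ × (Fin d → Fin d → ℤ) → Matrix (Fin d) (Fin d) ℤ := fun κ =>
    if hκ : ∃ N ∈ S, key N = κ then hκ.choose else 1
  have hrep : ∀ N ∈ S, rep (key N) ∈ S ∧ key (rep (key N)) = key N := by
    intro N hN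
    have hex : ∃ N' ∈ S, key N' = key N := ⟨N, hN, rfl⟩
    simp only [rep, dif_pos hex]
    exact hex.choose_spec
  refine ⟨∑ κ ∈ hfin.toFinset, nb (rmat (rep κ))⁻¹ * (d * R), ?_⟩
  intro h hh hl
  obtain ⟨N, hN, hNb⟩ := hb h hh hl
  have hNS : N ∈ S := by
    refine ⟨hN, ?_⟩
    have h1 : (h * rmat N).det = N.det := by rw [Matrix.det_mul, hh, one_mul, rmat_det]
    have h2 := Matrix.det_le (A := h * rmat N) (abv := AbsoluteValue.abs) (x := R)
      (fun i j => hNb i j)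
    rw [h1] at h2
    simpa [hD] using h2
  obtain ⟨⟨hr1, hr2⟩, hr3⟩ := hrep N hNS
  set N0 := rep (key N) with hN0
  have hdet : N.det = N0.det := (congrArg Prod.fst hr3).symm
  obtain ⟨γ, hγ1, hγ2⟩ := int_quot N0 N hr1 hdet (by
    intro i j
    have := congrFun (congrFun (congrArg Prod.snd hr3) i) j
    simp only [key] at this
    unfold Int.ModEq
    rw [this, hdet])
  refine ⟨γ, hγ1, ?_⟩
  intro i j
  have hunit : IsUnit (rmat N0).det := by
    rw [rmat_det]; simpa using hr1
  have hg : h * rmat γ = (h * rmat N) * (rmat N0)⁻¹ := by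
    rw [hγ2, rmat_mul, Matrix.mul_assoc, Matrix.mul_assoc, Matrix.mul_nonsing_inv _ hunit,
      Matrix.mul_one]
  have hkey : key N ∈ hfin.toFinset := by
    rw [Set.Finite.mem_toFinset]; exact ⟨N, hNS, rfl⟩
  refine le_trans ?_ (Finset.single_le_sum
    (f := fun κ => nb (rmat (rep κ))⁻¹ * (d * R))
    (fun κ _ => mul_nonneg (nb_nonneg _) (by positivity)) hkey)
  rw [hg, Matrix.mul_apply]
  show _ ≤ nb (rmat N0)⁻¹ * (d * R)
  have hent : ∀ i j, |(rmat N0)⁻¹ i j| ≤ nb (rmat N0)⁻¹ := by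
    intro i j
    unfold nb
    exact (Finset.single_le_sum (f := fun j => |(rmat N0)⁻¹ i j|) (fun _ _ => abs_nonneg _)
      (Finset.mem_univ j)).trans (Finset.single_le_sum (f := fun i => ∑ j, |(rmat N0)⁻¹ i j|)
      (fun _ _ => Finset.sum_nonneg fun _ _ => abs_nonneg _) (Finset.mem_univ i))
  calc _ ≤ ∑ l, |(h * rmat N) i l * (rmat N0)⁻¹ l j| := Finset.abs_sum_le_sum_abs _ _
    _ ≤ ∑ _l : Fin d, R * nb (rmat N0)⁻¹ := by
        apply Finset.sum_le_sum; intro l _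
        rw [abs_mul]
        exact mul_le_mul (hNb i l) (hent l j) (abs_nonneg _) hR.le
    _ = _ := by simp; ring

/-! ### Part 8: topology of the space of lattices -/

instance SLgrp (d : ℕ) : IsTopologicalGroup (Matrix.SpecialLinearGroup (Fin d) ℝ) :=
  @Matrix.SpecialLinearGroup.topologicalGroup (Fin d) ℝ _ _ _ _ _

instance matSC (d : ℕ) : SecondCountableTopology (Matrix (Fin d) (Fin d) ℝ) :=
  inferInstanceAs (SecondCountableTopology (Fin d → Fin d → ℝ))

instance matLC (d : ℕ) : LocallyCompactSpace (Matrix (Fin d) (Fin d) ℝ) :=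
  inferInstanceAs (LocallyCompactSpace (Fin d → Fin d → ℝ))

instance SLSC (d : ℕ) : SecondCountableTopology (Matrix.SpecialLinearGroup (Fin d) ℝ) :=
  TopologicalSpace.Subtype.secondCountableTopology _

lemma SL_emb (d : ℕ) : IsClosedEmbedding
    (fun g : Matrix.SpecialLinearGroup (Fin d) ℝ => (g : Matrix (Fin d) (Fin d) ℝ)) := by
  apply IsClosed.isClosedEmbedding_subtypeVal
  exact isClosed_eq (Continuous.matrix_det continuous_id) continuous_const

instance SLLC (d : ℕ) : LocallyCompactSpace (Matrix.SpecialLinearGroup (Fin d) ℝ) :=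
  (SL_emb d).locallyCompactSpace

instance SLT2 (d : ℕ) : T2Space (Matrix.SpecialLinearGroup (Fin d) ℝ) :=
  (SL_emb d).isEmbedding.t2Space

lemma SL_bdd_compact (d : ℕ) (R : ℝ) :
    IsCompact {g : Matrix.SpecialLinearGroup (Fin d) ℝ |
      ∀ i j, |(g : Matrix (Fin d) (Fin d) ℝ) i j| ≤ R} := by
  have h1 : IsCompact (Set.pi Set.univ fun _ : Fin d => Set.pi Set.univ fun _ : Fin d =>
      Set.Icc (-R) R) := isCompact_univ_pi fun _ => isCompact_univ_pi fun _ => isCompact_Icc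
  have h2 := (SL_emb d).isCompact_preimage (K := (Set.pi Set.univ fun _ : Fin d =>
      Set.pi Set.univ fun _ : Fin d => Set.Icc (-R) R : Set (Fin d → Fin d → ℝ))) h1
  convert h2 using 1
  ext g
  constructor
  · intro h i _ j _
    exact abs_le.1 (h i j)
  · intro h i j
    exact abs_le.2 (h i trivial j trivial)

lemma mem_Gamma {d : ℕ} (g : Matrix.SpecialLinearGroup (Fin d) ℝ) :
    g ∈ Gamma d ↔ ∀ i j, (g : Matrix (Fin d) (Fin d) ℝ) i j ∈ Set.range (Int.cast : ℤ → ℝ) := by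
  constructor
  · rintro ⟨γ, rfl⟩ i j
    exact ⟨γ i j, by simp⟩
  · intro h
    choose N hN using h
    have hN' : rmat (Matrix.of N) = g := by ext i j; simp [rmat, hN]
    have hdet : (Matrix.of N).det = 1 := by
      have := rmat_det (Matrix.of N)
      rw [hN', g.det_coe] at this
      exact_mod_cast this.symm
    refine ⟨⟨Matrix.of N, hdet⟩, ?_⟩
    apply Subtype.ext
    exact hN'

lemma Gamma_closed (d : ℕ) : IsClosed (Gamma d : Set (Matrix.SpecialLinearGroup (Fin d) ℝ)) := by
  have : (Gamma d : Set (Matrix.SpecialLinearGroup (Fin d) ℝ)) = ⋂ i, ⋂ j,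
      (fun g : Matrix.SpecialLinearGroup (Fin d) ℝ => (g : Matrix (Fin d) (Fin d) ℝ) i j) ⁻¹'
        Set.range (Int.cast : ℤ → ℝ) := by
    ext g; simp only [SetLike.mem_coe, mem_Gamma, Set.mem_iInter, Set.mem_preimage]
  rw [this]
  refine isClosed_iInter fun i => isClosed_iInter fun j => ?_
  apply IsClosed.preimage
  · exact (continuous_apply_apply i j).comp (SL_emb d).continuous
  · exact Int.isClosedEmbedding_coe_real.isClosed_range

instance XT2 (d : ℕ) : T2Space (XSp d) := by
  rw [t2Space_iff_of_isOpenQuotientMap QuotientGroup.isOpenQuotientMap_mk]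
  have : {q : Matrix.SpecialLinearGroup (Fin d) ℝ × Matrix.SpecialLinearGroup (Fin d) ℝ |
      (q.1 : XSp d) = (q.2 : XSp d)} = (fun q => q.1⁻¹ * q.2) ⁻¹' (Gamma d : Set _) := by
    ext q
    simp [QuotientGroup.eq]
  rw [this]
  exact (Gamma_closed d).preimage (by fun_prop)

instance XBorel (d : ℕ) : BorelSpace (XSp d) := ⟨rfl⟩

lemma X_inner (d : ℕ) (μ : Measure (XSp d)) [IsProbabilityMeasure μ] (A : Set (XSp d))
    (hA : MeasurableSet A) (η : ℝ) (hη : 0 < η) :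
    ∃ K ⊆ A, IsCompact K ∧ (μ (A \ K)).toReal < η := by
  obtain ⟨K, hK, hK2, hK3⟩ := hA.exists_isCompact_sdiff_lt (μ := μ) (measure_ne_top μ A)
    (ε := ENNReal.ofReal η) (by simpa using hη)
  exact ⟨K, hK, hK2, ENNReal.toReal_lt_of_lt_ofReal hK3⟩

lemma lam_gamma {d : ℕ} (hd : 0 < d) (h : Matrix (Fin d) (Fin d) ℝ)
    (γ : Matrix (Fin d) (Fin d) ℤ) (hγ : γ.det = 1) : lam h ≤ lam (h * rmat γ) := by
  apply le_lam hd
  intro z hz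
  have h1 : (h * rmat γ) *ᵥ zv z = h *ᵥ zv (γ *ᵥ z) := by
    rw [← Matrix.mulVec_mulVec]
    congr 1
    ext i
    simp [Matrix.mulVec, dotProduct, rmat, zv]
  rw [h1]
  apply lam_le
  intro h0
  apply hz
  have : γ⁻¹ *ᵥ (γ *ᵥ z) = z := by
    rw [Matrix.mulVec_mulVec, Matrix.nonsing_inv_mul _ (by simp [hγ]), Matrix.one_mulVec]
  rw [← this, h0, Matrix.mulVec_zero]

lemma lam_Gamma {d : ℕ} (hd : 0 < d) (g γ : Matrix.SpecialLinearGroup (Fin d) ℝ)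
    (hγ : γ ∈ Gamma d) :
    lam (g : Matrix (Fin d) (Fin d) ℝ) ≤ lam ((g * γ : Matrix.SpecialLinearGroup (Fin d) ℝ) : Matrix (Fin d) (Fin d) ℝ) := by
  obtain ⟨γ', rfl⟩ := hγ
  have := lam_gamma hd g γ' γ'.det_coe
  exact this

lemma lam_quot {d : ℕ} (hd : 0 < d) (g g' : Matrix.SpecialLinearGroup (Fin d) ℝ)
    (h : (g : XSp d) = (g' : XSp d)) :
    lam (g : Matrix (Fin d) (Fin d) ℝ) = lam (g' : Matrix (Fin d) (Fin d) ℝ) := by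
  have h1 : g⁻¹ * g' ∈ Gamma d := QuotientGroup.eq.1 h
  have h2 : g'⁻¹ * g ∈ Gamma d := QuotientGroup.eq.1 h.symm
  apply le_antisymm
  · have := lam_Gamma hd g _ h1
    rwa [mul_inv_cancel_left] at this
  · have := lam_Gamma hd g' _ h2
    rwa [mul_inv_cancel_left] at this

lemma nb_sub_comm {d : ℕ} (A B : Matrix (Fin d) (Fin d) ℝ) : nb (A - B) = nb (B - A) := by
  simp [nb, abs_sub_comm]

lemma lam_near {d : ℕ} (hd : 0 < d) (h h' : Matrix (Fin d) (Fin d) ℝ) (hh : h.det = 1) :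
    |lam h' - lam h| ≤ nb (h' - h) * nb h⁻¹ * lam h := by
  have hn := nb_nonneg (h' - h)
  have hi := nb_nonneg h⁻¹
  have key : ∀ v, ‖(h' - h) *ᵥ v‖ ≤ nb (h' - h) * nb h⁻¹ * ‖h *ᵥ v‖ := by
    intro v
    calc _ ≤ nb (h' - h) * ‖v‖ := nb_mulVec _ _
      _ ≤ nb (h' - h) * (nb h⁻¹ * ‖h *ᵥ v‖) :=
        mul_le_mul_of_nonneg_left (lower_of_inv h hh v) hn
      _ = _ := by ring
  have hlp := lam_pos hd h hh
  set δ := nb (h' - h) * nb h⁻¹ with hδ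
  have hδ0 : 0 ≤ δ := by positivity
  rw [abs_le]
  constructor
  · have : (1 - δ) * lam h ≤ lam h' := by
      apply le_lam hd
      intro z hz
      have h1 := key (zv z)
      rw [Matrix.sub_mulVec] at h1
      have h2 := norm_sub_norm_le (h *ᵥ zv z) (h' *ᵥ zv z)
      rw [norm_sub_rev] at h2
      have h3 := lam_le h z hz
      by_cases h4 : δ ≤ 1
      · nlinarith [norm_nonneg (h' *ᵥ zv z)]
      · have : (1 - δ) * lam h ≤ 0 := mul_nonpos_of_nonpos_of_nonneg (by linarith) hlp.le
        linarith [norm_nonneg (h' *ᵥ zv z)]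
    linarith
  · have : lam h' / (1 + δ) ≤ lam h := by
      apply le_lam hd
      intro z hz
      rw [div_le_iff₀ (by linarith)]
      refine (lam_le h' z hz).trans ?_
      have h1 := key (zv z)
      rw [Matrix.sub_mulVec] at h1
      have h2 := norm_sub_norm_le (h' *ᵥ zv z) (h *ᵥ zv z)
      linarith
    rw [div_le_iff₀ (by linarith)] at this
    linarith

lemma nb_cont {d : ℕ} : Continuous (nb (d := d)) := by
  unfold nb
  apply continuous_finsetSum; intro i _
  apply continuous_finsetSum; intro j _
  exact (continuous_apply_apply (ρ := fun _ _ => ℝ) i j).abs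

lemma lam_cont {d : ℕ} (hd : 0 < d) : Continuous
    (fun g : Matrix.SpecialLinearGroup (Fin d) ℝ => lam (g : Matrix (Fin d) (Fin d) ℝ)) := by
  rw [continuous_iff_continuousAt]
  intro g
  rw [ContinuousAt, tendsto_iff_dist_tendsto_zero]
  have h1 : Tendsto (fun g' : Matrix.SpecialLinearGroup (Fin d) ℝ =>
      nb ((g' : Matrix (Fin d) (Fin d) ℝ) - (g : Matrix (Fin d) (Fin d) ℝ)) * nb (g : Matrix (Fin d) (Fin d) ℝ)⁻¹
        * lam (g : Matrix (Fin d) (Fin d) ℝ)) (𝓝 g) (𝓝 0) := by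
    have h2 : Continuous (fun g' : Matrix.SpecialLinearGroup (Fin d) ℝ =>
      nb ((g' : Matrix (Fin d) (Fin d) ℝ) - (g : Matrix (Fin d) (Fin d) ℝ)) * nb (g : Matrix (Fin d) (Fin d) ℝ)⁻¹
        * lam (g : Matrix (Fin d) (Fin d) ℝ)) :=
      ((nb_cont.comp ((SL_emb d).continuous.sub continuous_const)).mul continuous_const).mul
        continuous_const
    have h3 := h2.tendsto g
    simpa [nb] using h3
  refine squeeze_zero (fun _ => dist_nonneg) (fun g' => ?_) h1
  rw [Real.dist_eq]
  exact lam_near hd _ _ g.det_coe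

lemma thick_fun {d : ℕ} (hd : 0 < d) (ε : ℝ) (hε : 0 < ε) :
    ∃ f : XSp d → ℝ, Continuous f ∧ HasCompactSupport f ∧ (∀ x, 0 ≤ f x) ∧ (∀ x, f x ≤ 1) ∧
      ∀ g : Matrix.SpecialLinearGroup (Fin d) ℝ, ε ≤ lam (g : Matrix (Fin d) (Fin d) ℝ) →
        f (g : XSp d) = 1 := by
  let F : Matrix.SpecialLinearGroup (Fin d) ℝ → ℝ :=
    fun g => max 0 (min 1 (2 * lam (g : Matrix (Fin d) (Fin d) ℝ) / ε - 1))
  have hF : Continuous F := by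
    have := lam_cont hd
    fun_prop
  have hFq : ∀ g g' : Matrix.SpecialLinearGroup (Fin d) ℝ, (g : XSp d) = (g' : XSp d) → F g = F g' := by
    intro g g' h
    simp only [F, lam_quot hd g g' h]
  let f : XSp d → ℝ := fun x => F x.out
  have hf : ∀ g : Matrix.SpecialLinearGroup (Fin d) ℝ, f (g : XSp d) = F g := fun g =>
    hFq _ _ (QuotientGroup.out_eq' _)
  refine ⟨f, ?_, ?_, ?_, ?_, ?_⟩
  · rw [QuotientGroup.isOpenQuotientMap_mk.isQuotientMap.continuous_iff]
    convert hF using 1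
    ext g; exact hf g
  · obtain ⟨R, hR⟩ := mahler_crit hd (ε / 2) (by positivity)
    apply HasCompactSupport.intro ((SL_bdd_compact d R).image
      (QuotientGroup.continuous_mk (N := Gamma d)))
    intro x hx
    obtain ⟨g, rfl⟩ := QuotientGroup.mk_surjective x
    rw [hf]
    by_contra h0
    apply hx
    have h1 : ε / 2 ≤ lam (g : Matrix (Fin d) (Fin d) ℝ) := by
      by_contra h2
      apply h0
      apply max_eq_left
      refine (min_le_right _ _).trans ?_
      rw [sub_nonpos, div_le_one hε]
      linarith
    obtain ⟨γ, hγ, hb⟩ := hR g g.det_coe h1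
    let γ' : Matrix.SpecialLinearGroup (Fin d) ℝ :=
      Matrix.SpecialLinearGroup.map (Int.castRingHom ℝ) ⟨γ, hγ⟩
    refine ⟨g * γ', ?_, ?_⟩
    · intro i j
      exact hb i j
    · rw [QuotientGroup.eq]
      have : (g * γ')⁻¹ * g = γ'⁻¹ := by group
      rw [this]
      exact inv_mem ⟨_, rfl⟩
  · intro x; exact le_max_left _ _
  · intro x; exact max_le zero_le_one (min_le_left _ _)
  · intro g hg
    rw [hf]
    have : 1 ≤ 2 * lam (g : Matrix (Fin d) (Fin d) ℝ) / ε - 1 := by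
      rw [le_sub_iff_add_le, le_div_iff₀ hε]; linarith
    simp only [F]
    rw [min_eq_left this]; simp

/-! ### Part 9: entropy estimates from codings -/

lemma negMulLog_le (p q : ℝ) (hp : 0 ≤ p) (hq : 0 < q) :
    Real.negMulLog p ≤ p * (-Real.log q) + q - p := by
  rcases hp.eq_or_lt with rfl | hp
  · simp [hq.le]
  · have h1 := Real.log_le_sub_one_of_pos (div_pos hq hp)
    rw [Real.log_div hq.ne' hp.ne'] at h1
    have h2 : p * (Real.log q - Real.log p) ≤ p * (q / p - 1) := mul_le_mul_of_nonneg_left h1 hp.le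
    have h3 : p * (q / p - 1) = q - p := by field_simp
    rw [Real.negMulLog]
    nlinarith

lemma negMulLog_sum {J : Type*} [Fintype J] (p : J → ℝ) (hp : ∀ j, 0 ≤ p j) :
    Real.negMulLog (∑ j, p j) ≤ ∑ j, Real.negMulLog (p j) := by
  rw [Real.negMulLog, ← Finset.sum_neg_distrib, Finset.sum_mul]
  apply Finset.sum_le_sum
  intro j _
  rw [Real.negMulLog]
  rcases (hp j).eq_or_lt with h | h
  · rw [← h]; simp
  · have h1 : p j ≤ ∑ j, p j := Finset.single_le_sum (fun j _ => hp j) (Finset.mem_univ j)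
    have h2 := Real.log_le_log h h1
    nlinarith

lemma gibbs {X : Type*} [MeasurableSpace X] (μ : Measure X) [IsProbabilityMeasure μ]
    {Ω J : Type*} [Fintype Ω] [Fintype J] (Q : Ω → Set X) (hQm : ∀ ω, MeasurableSet (Q ω))
    (hQd : Pairwise (Function.onFun Disjoint Q)) (hQu : (⋃ ω, Q ω) = Set.univ)
    (ι : X → J) (hι : ∀ j, MeasurableSet (ι ⁻¹' {j}))
    (q : J → Ω → ℝ) (hq : ∀ j ω, 0 < q j ω) (hqs : ∑ j, ∑ ω, q j ω ≤ 1)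
    (φ : X → ℝ) (hφ : Integrable φ μ) (hle : ∀ ω, ∀ x ∈ Q ω, -Real.log (q (ι x) ω) ≤ φ x) :
    partEnt μ Q ≤ ∫ x, φ x ∂μ := by
  classical
  let c : J → Ω → Set X := fun j ω => Q ω ∩ ι ⁻¹' {j}
  have hc : ∀ j ω, MeasurableSet (c j ω) := fun j ω => (hQm ω).inter (hι j)
  let p : J → Ω → ℝ := fun j ω => (μ (c j ω)).toReal
  have hp : ∀ j ω, 0 ≤ p j ω := fun j ω => ENNReal.toReal_nonneg
  have hpω : ∀ ω, (μ (Q ω)).toReal = ∑ j, p j ω := by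
    intro ω
    have h1 : Q ω = ⋃ j, c j ω := by
      ext x; simp [c]
    have h2 : μ (⋃ j, c j ω) = ∑ j, μ (c j ω) := by
      rw [measure_iUnion _ (fun j => hc j ω), tsum_fintype]
      intro i j hij
      rw [Function.onFun, Set.disjoint_left]
      rintro x ⟨_, hx⟩ ⟨_, hx'⟩
      exact hij (hx.symm.trans hx')
    conv_lhs => rw [h1, h2]
    rw [ENNReal.toReal_sum (fun j _ => measure_ne_top _ _)]
  have hptot : ∑ ω, ∑ j, p j ω = 1 := by
    simp_rw [← hpω]
    rw [← ENNReal.toReal_sum (fun ω _ => measure_ne_top _ _), ← tsum_fintype (L := .unconditional _),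
      ← measure_iUnion hQd hQm, hQu]
    simp
  have h1 : partEnt μ Q ≤ ∑ ω, ∑ j, (p j ω * (-Real.log (q j ω)) + q j ω - p j ω) := by
    unfold partEnt
    apply Finset.sum_le_sum; intro ω _
    rw [hpω]
    refine (negMulLog_sum _ (fun j => hp j ω)).trans ?_
    apply Finset.sum_le_sum; intro j _
    exact negMulLog_le _ _ (hp j ω) (hq j ω)
  have h2 : ∑ ω, ∑ j, (p j ω * (-Real.log (q j ω)) + q j ω - p j ω) ≤
      ∑ ω, ∑ j, p j ω * (-Real.log (q j ω)) := by
    simp only [Finset.sum_sub_distrib, Finset.sum_add_distrib]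
    rw [hptot, Finset.sum_comm (f := fun ω j => q j ω)]
    linarith
  refine h1.trans (h2.trans ?_)
  have h3 : ∑ ω, ∑ j, p j ω * (-Real.log (q j ω)) =
      ∫ x, ∑ ω, ∑ j, (c j ω).indicator (fun _ => -Real.log (q j ω)) x ∂μ := by
    rw [integral_finsetSum]
    · apply Finset.sum_congr rfl; intro ω _
      rw [integral_finsetSum]
      · apply Finset.sum_congr rfl; intro j _
        rw [integral_indicator_const _ (hc j ω)]
        rfl
      · intro j _
        exact (integrable_const _).indicator (hc j ω)
    · intro ω _
      apply integrable_finsetSum; intro j _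
      exact (integrable_const _).indicator (hc j ω)
  rw [h3]
  refine integral_mono ?_ hφ ?_
  · apply integrable_finsetSum; intro ω _
    apply integrable_finsetSum; intro j _
    exact (integrable_const _).indicator (hc j ω)
  · intro x
    obtain ⟨ω0, hω0⟩ : ∃ ω, x ∈ Q ω := by
      have : x ∈ ⋃ ω, Q ω := by rw [hQu]; trivial
      simpa using this
    show ∑ ω, ∑ j, (c j ω).indicator (fun _ => -Real.log (q j ω)) x ≤ φ x
    rw [Finset.sum_eq_single ω0, Finset.sum_eq_single (ι x)]
    · rw [Set.indicator_of_mem]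
      · exact hle ω0 x hω0
      · exact ⟨hω0, rfl⟩
    · intro j _ hj
      apply Set.indicator_of_notMem
      rintro ⟨_, h⟩
      exact hj h.symm
    · intro h; exact absurd (Finset.mem_univ _) h
    · intro ω _ hω
      apply Finset.sum_eq_zero; intro j _
      apply Set.indicator_of_notMem
      rintro ⟨h, _⟩
      exact Set.disjoint_left.1 (hQd hω) h hω0
    · intro h; exact absurd (Finset.mem_univ _) h

lemma select {X J : Type*} [MeasurableSpace X] [Fintype J] (E : J → Set X)
    (hE : ∀ j, MeasurableSet (E j)) :
    ∃ ι : X → Option J, (∀ j, MeasurableSet (ι ⁻¹' {j})) ∧ (∀ x j, ι x = some j → x ∈ E j) ∧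
      ∀ x, ι x = none → ∀ j, x ∉ E j := by
  classical
  suffices H : ∀ s : Finset J, ∃ ι : X → Option J, (@Measurable _ _ _ ⊤ ι) ∧
      (∀ x j, ι x = some j → x ∈ E j) ∧ ∀ x, ι x = none → ∀ j ∈ s, x ∉ E j by
    obtain ⟨ι, h1, h2, h3⟩ := H Finset.univ
    exact ⟨ι, fun j => h1 trivial, h2, fun x hx j => h3 x hx j (Finset.mem_univ j)⟩
  intro s
  induction s using Finset.induction_on with
  | empty =>
    refine ⟨fun _ => none, @measurable_const _ _ ⊤ _ _, by simp, by simp⟩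
  | insert a s ha ih =>
    obtain ⟨ι, h1, h2, h3⟩ := ih
    refine ⟨fun x => if x ∈ E a then some a else ι x, ?_, ?_, ?_⟩
    · let _ : MeasurableSpace (Option J) := ⊤
      exact Measurable.ite (hE a) measurable_const h1
    · intro x j hx
      by_cases h : x ∈ E a
      · simp only [h, if_true] at hx
        cases hx; exact h
      · simp only [h, if_false] at hx
        exact h2 x j hx
    · intro x hx j hj
      by_cases h : x ∈ E a
      · simp [h] at hx
      · simp only [h, if_false] at hx
        rcases Finset.mem_insert.1 hj with rfl | hj
        · exact h
        · exact h3 x hx j hj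

lemma joinPart_meas {X : Type*} [MeasurableSpace X] (T : X → X) (hT : Measurable T) {k : ℕ}
    (P : Fin k → Set X) (hP : IsFinPart P) (N : ℕ) (ω : Fin N → Fin k) :
    MeasurableSet (joinPart T P N ω) :=
  MeasurableSet.iInter fun j => (hT.iterate j) (hP.1 _)

lemma joinPart_disj {X : Type*} [MeasurableSpace X] (T : X → X) {k : ℕ}
    (P : Fin k → Set X) (hP : IsFinPart P) (N : ℕ) :
    Pairwise (Function.onFun Disjoint (joinPart T P N)) := by
  intro ω ω' h
  obtain ⟨j, hj⟩ := Function.ne_iff.1 h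
  rw [Function.onFun, Set.disjoint_left]
  intro x hx hx'
  exact Set.disjoint_left.1 (hP.2.1 hj) (Set.mem_iInter.1 hx j) (Set.mem_iInter.1 hx' j)

lemma joinPart_univ {X : Type*} [MeasurableSpace X] (T : X → X) {k : ℕ}
    (P : Fin k → Set X) (hP : IsFinPart P) (N : ℕ) : (⋃ ω, joinPart T P N ω) = Set.univ := by
  rw [Set.eq_univ_iff_forall]
  intro x
  have h1 : ∀ y, ∃ i, y ∈ P i := fun y => by
    have : y ∈ ⋃ i, P i := by rw [hP.2.2]; trivial
    simpa using this
  choose s hs using h1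
  exact Set.mem_iUnion.2 ⟨fun j => s (T^[j] x), Set.mem_iInter.2 fun j => hs _⟩

/-- Finite-time entropy estimate from a coding. -/
lemma ent_fin {X : Type*} [MeasurableSpace X] (μ : Measure X) [IsProbabilityMeasure μ]
    (T : X → X) (hT : MeasurePreserving T μ μ) {k : ℕ} (hk : 0 < k) (P : Fin k → Set X)
    (hP : IsFinPart P) (t L N : ℕ) (hN : N = t * L) (K : Fin k → Set X) (hKm : ∀ i, MeasurableSet (K i))
    (hKP : ∀ i, K i ⊆ P i) (η : ℝ) (hKμ : ∀ i, (μ (P i \ K i)).toReal ≤ η)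
    (Q : Set X) (hQ : MeasurableSet Q) (hQμ : (μ Qᶜ).toReal ≤ η)
    (f : X → ℝ) (hfm : Measurable f) (hf0 : ∀ x, 0 ≤ f x) (hf1 : ∀ x, f x ≤ 1)
    (c1 β C : ℝ) (hc1 : 0 ≤ c1) (hβ : 0 ≤ β) (hC : 0 ≤ C) (l0 : ℕ)
    {J : Type*} [Fintype J] (q : J → ℝ) (hq : ∀ j, 0 < q j) (hqs : ∑ j, q j ≤ 1)
    (E : J → Set X) (hE : ∀ j, MeasurableSet (E j)) (hEQ : ∀ x ∈ Q, ∃ j, x ∈ E j)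
    (ha : ∀ j, ∀ x ∈ E j, -Real.log (q j) ≤ c1 + L * β + C * ∑ l ∈ Finset.range L, f (T^[t * l] x))
    (hb : ∀ j, ∀ x ∈ E j, ∀ x' ∈ E j, ∀ i : ℕ, i + l0 ≤ N → ∀ a b, T^[i] x ∈ K a → T^[i] x' ∈ K b →
      a = b) (r : ℝ) (hr : 0 < r) (hr1 : r < 1) :
    partEnt μ (joinPart T P N) ≤ Real.log 2 + c1 + L * β + C * (L * ∫ x, f x ∂μ) +
      N * (η * Real.log k) + N * (-Real.log (1 - r)) + (k * η * N + l0) * Real.log (k / r) := by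
  classical
  have hk1 : (1 : ℝ) ≤ k := by exact_mod_cast hk
  have hk0 : (0 : ℝ) < k := by linarith
  obtain ⟨ι, hι1, hι2, hι3⟩ := select E hE
  let sym : J → ℕ → Fin k := fun j i =>
    if h : ∃ a, ∃ x ∈ E j, T^[i] x ∈ K a then h.choose else ⟨0, hk⟩
  have hsym : ∀ j, ∀ x ∈ E j, ∀ i : ℕ, i + l0 ≤ N → ∀ a, T^[i] x ∈ K a → sym j i = a := by
    intro j x hx i hi a hxa
    have h : ∃ a, ∃ x ∈ E j, T^[i] x ∈ K a := ⟨a, x, hx, hxa⟩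
    simp only [sym, dif_pos h]
    obtain ⟨y, hy, hya⟩ := h.choose_spec
    exact hb j y hy x hx i hi _ _ hya hxa
  let θ : J → ℕ → Fin k → ℝ := fun j i a => (if a = sym j i then 1 - r else 0) + r / k
  have hθpos : ∀ j i a, 0 < θ j i a := by
    intro j i a
    have : 0 < r / k := by positivity
    simp only [θ]; split_ifs <;> linarith
  have hθsum : ∀ j i, ∑ a, θ j i a = 1 := by
    intro j i
    simp only [θ, Finset.sum_add_distrib, Finset.sum_ite_eq', Finset.mem_univ, if_true,
      Finset.sum_const, Finset.card_univ, Fintype.card_fin, nsmul_eq_mul]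
    field_simp; ring
  let Bad : Set X := ⋃ i, P i \ K i
  have hBadm : MeasurableSet Bad := MeasurableSet.iUnion fun i => (hP.1 i).diff (hKm i)
  have hBadμ : (μ Bad).toReal ≤ k * η := by
    have h1 : μ Bad ≤ ∑ i, μ (P i \ K i) := measure_iUnion_fintype_le _ _
    have h2 := ENNReal.toReal_mono (ENNReal.sum_ne_top.2 fun i _ => measure_ne_top _ _) h1
    rw [ENNReal.toReal_sum (fun i _ => measure_ne_top _ _)] at h2
    refine h2.trans ((Finset.sum_le_sum fun i _ => hKμ i).trans ?_)
    simp
  let bd : X → ℝ := Bad.indicator (fun _ => 1)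
  have hbd0 : ∀ x, 0 ≤ bd x := fun x => Set.indicator_nonneg (fun _ _ => zero_le_one) x
  have hlogk : 0 ≤ Real.log k := Real.log_nonneg hk1
  have hlogkr : 0 ≤ Real.log (k / r) := Real.log_nonneg (by rw [le_div_iff₀ hr]; linarith)
  have hlogr : 0 ≤ -Real.log (1 - r) := by
    have := Real.log_nonpos (by linarith : 0 ≤ 1 - r) (by linarith); linarith
  let tail : ℕ → ℝ := fun i => if i + l0 ≤ N then 0 else 1
  have htail0 : ∀ i, 0 ≤ tail i := fun i => by simp only [tail]; split_ifs <;> norm_num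
  have htail : ∑ i ∈ Finset.range N, tail i ≤ l0 := by
    simp only [tail, Finset.sum_ite, Finset.sum_const_zero, zero_add, Finset.sum_const,
      nsmul_eq_mul, mul_one]
    have : (Finset.filter (fun i => ¬ (i + l0 ≤ N)) (Finset.range N)).card ≤ l0 := by
      calc _ ≤ (Finset.Ico (N - l0) N).card := by
            apply Finset.card_le_card
            intro i hi
            simp only [Finset.mem_filter, Finset.mem_range] at hi
            rw [Finset.mem_Ico]; omega
        _ ≤ l0 := by rw [Nat.card_Ico]; omega
    exact_mod_cast this
  have hθ : ∀ j, ∀ x ∈ E j, ∀ i < N, ∀ a, T^[i] x ∈ P a →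
      -Real.log (θ j i a) ≤ -Real.log (1 - r) + Real.log (k / r) * (bd (T^[i] x) + tail i) := by
    intro j x hx i hi a hxa
    by_cases hsa : a = sym j i
    · have h1 : 1 - r ≤ θ j i a := by
        simp only [θ, if_pos hsa]
        have : 0 < r / k := by positivity
        linarith
      have h2 := Real.log_le_log (by linarith) h1
      have h3 : 0 ≤ Real.log (k / r) * (bd (T^[i] x) + tail i) :=
        mul_nonneg hlogkr (add_nonneg (hbd0 _) (htail0 _))
      linarith
    · have h1 : θ j i a = (k / r)⁻¹ := by
        simp only [θ, if_neg hsa, zero_add, inv_div]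
      rw [h1, Real.log_inv, neg_neg]
      have h2 : 1 ≤ bd (T^[i] x) + tail i := by
        by_cases h3 : i + l0 ≤ N
        · have h4 : T^[i] x ∈ Bad := by
            refine Set.mem_iUnion.2 ⟨a, hxa, fun hK => hsa (hsym j x hx i h3 a hK).symm⟩
          have h5 : bd (T^[i] x) = 1 := Set.indicator_of_mem h4 _
          linarith [htail0 i]
        · have h5 : tail i = 1 := by simp only [tail, if_neg h3]
          linarith [hbd0 (T^[i] x)]
      nlinarith
  let qq : Option J → (Fin N → Fin k) → ℝ := fun o ω =>
    match o with
    | some j => 1 / 2 * (q j * ∏ i : Fin N, θ j i (ω i))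
    | none => 1 / 2 * ((k : ℝ) ^ N)⁻¹
  have hqq : ∀ o ω, 0 < qq o ω := by
    intro o ω
    cases o with
    | none => simp only [qq]; positivity
    | some j =>
      simp only [qq]
      have := Finset.prod_pos (fun (i : Fin N) (_ : i ∈ Finset.univ) => hθpos j i (ω i))
      have := hq j
      positivity
  have hqqs : ∑ o, ∑ ω, qq o ω ≤ 1 := by
    rw [Fintype.sum_option]
    have h1 : ∑ ω, qq none ω = 1 / 2 := by
      simp only [qq, Finset.sum_const, Finset.card_univ, nsmul_eq_mul]
      have : ((Fintype.card (Fin N → Fin k) : ℕ) : ℝ) = (k : ℝ) ^ N := by simp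
      rw [this]; field_simp
    have h2 : ∀ j, ∑ ω, qq (some j) ω = 1 / 2 * q j := by
      intro j
      simp only [qq]
      rw [← Finset.mul_sum, ← Finset.mul_sum]
      have h3 := Finset.prod_univ_sum (fun _ : Fin N => (Finset.univ : Finset (Fin k)))
        (fun i a => θ j i a)
      rw [Fintype.piFinset_univ] at h3
      rw [← h3]
      simp [hθsum]
    rw [h1]
    simp_rw [h2]
    rw [← Finset.mul_sum]
    linarith
  let qc : X → ℝ := Qᶜ.indicator (fun _ => 1)
  have hqc0 : ∀ x, 0 ≤ qc x := fun x => Set.indicator_nonneg (fun _ _ => zero_le_one) x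
  let φ : X → ℝ := fun x => (Real.log 2 + c1 + L * β + N * (-Real.log (1 - r)) + l0 * Real.log (k / r)) +
    N * Real.log k * qc x + C * ∑ l ∈ Finset.range L, f (T^[t * l] x) +
    Real.log (k / r) * ∑ i ∈ Finset.range N, bd (T^[i] x)
  have hfi : ∀ i, Integrable (fun x => f (T^[i] x)) μ := by
    intro i
    refine Integrable.of_bound ((hfm.comp (hT.measurable.iterate i)).aestronglyMeasurable) 1 ?_
    refine Filter.Eventually.of_forall fun x => ?_
    rw [Real.norm_eq_abs, abs_of_nonneg (hf0 _)]; exact hf1 _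
  have hbdm : Measurable bd := measurable_const.indicator hBadm
  have hbdi : ∀ i, Integrable (fun x => bd (T^[i] x)) μ := by
    intro i
    refine Integrable.of_bound ((hbdm.comp (hT.measurable.iterate i)).aestronglyMeasurable) 1 ?_
    refine Filter.Eventually.of_forall fun x => ?_
    rw [Real.norm_eq_abs, abs_of_nonneg (hbd0 _)]
    exact Set.indicator_le_self' (fun _ _ => zero_le_one) _
  have hqci : Integrable qc μ := (integrable_const _).indicator hQ.compl
  have hinv : ∀ (g : X → ℝ), Measurable g → ∀ i, ∫ x, g (T^[i] x) ∂μ = ∫ x, g x ∂μ := by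
    intro g hg i
    have h1 := hT.iterate i
    conv_rhs => rw [← h1.map_eq]
    rw [integral_map h1.measurable.aemeasurable hg.aestronglyMeasurable]
  have hφi : Integrable φ μ := by
    refine (((integrable_const _).add (hqci.const_mul _)).add
      ((integrable_finsetSum _ fun l _ => hfi _).const_mul _)).add
      ((integrable_finsetSum _ fun l _ => hbdi _).const_mul _)
  have hmain := gibbs μ (joinPart T P N) (joinPart_meas T hT.measurable P hP N)
    (joinPart_disj T P hP N) (joinPart_univ T P hP N) ι hι1 qq hqq hqqs φ hφi ?_
  · refine hmain.trans ?_
    have h1 : ∫ x, φ x ∂μ = (Real.log 2 + c1 + L * β + N * (-Real.log (1 - r)) + l0 * Real.log (k / r)) +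
        N * Real.log k * (μ Qᶜ).toReal + C * (L * ∫ x, f x ∂μ) +
        Real.log (k / r) * (N * (μ Bad).toReal) := by
      simp only [φ]
      rw [integral_add, integral_add, integral_add, integral_const_mul, integral_const_mul,
        integral_const_mul, integral_finsetSum, integral_finsetSum]
      · simp_rw [hinv f hfm, hinv bd hbdm]
        have h2 : ∫ x, bd x ∂μ = (μ Bad).toReal := by
          simp only [bd]; rw [integral_indicator_const _ hBadm]; simp [Measure.real]
        have h3 : ∫ x, qc x ∂μ = (μ Qᶜ).toReal := by
          simp only [qc]; rw [integral_indicator_const _ hQ.compl]; simp [Measure.real]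
        rw [h2, h3]
        simp
      · intro i _; exact hbdi _
      · intro i _; exact hfi _
      · exact integrable_const _
      · exact hqci.const_mul _
      · exact (integrable_const _).add (hqci.const_mul _)
      · exact (integrable_finsetSum _ fun l _ => hfi _).const_mul _
      · exact ((integrable_const _).add (hqci.const_mul _)).add
          ((integrable_finsetSum _ fun l _ => hfi _).const_mul _)
      · exact (integrable_finsetSum _ fun l _ => hbdi _).const_mul _
    rw [h1]
    have h4 : N * Real.log k * (μ Qᶜ).toReal ≤ N * Real.log k * η :=
      mul_le_mul_of_nonneg_left hQμ (by positivity)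
    have h5 : Real.log (k / r) * (N * (μ Bad).toReal) ≤ Real.log (k / r) * (N * (k * η)) :=
      mul_le_mul_of_nonneg_left (mul_le_mul_of_nonneg_left hBadμ (by positivity)) hlogkr
    nlinarith
  · intro ω x hx
    have hfs : 0 ≤ C * ∑ l ∈ Finset.range L, f (T^[t * l] x) :=
      mul_nonneg hC (Finset.sum_nonneg fun l _ => hf0 _)
    have hbs : 0 ≤ Real.log (k / r) * ∑ i ∈ Finset.range N, bd (T^[i] x) :=
      mul_nonneg hlogkr (Finset.sum_nonneg fun l _ => hbd0 _)
    have hqs' : 0 ≤ N * Real.log k * qc x := mul_nonneg (by positivity) (hqc0 x)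
    have hLβ : 0 ≤ L * β := by positivity
    have hNr : 0 ≤ N * (-Real.log (1 - r)) := mul_nonneg (by positivity) hlogr
    have hlr : 0 ≤ l0 * Real.log (k / r) := by positivity
    cases hιx : ι x with
    | none =>
      have hxQ : x ∉ Q := fun h => by
        obtain ⟨j, hj⟩ := hEQ x h
        exact hι3 x hιx j hj
      have hqx : qc x = 1 := Set.indicator_of_mem hxQ _
      have h1 : -Real.log (qq none ω) = Real.log 2 + N * Real.log k := by
        simp only [qq]
        rw [Real.log_mul (by norm_num) (by positivity), Real.log_inv, Real.log_pow, one_div,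
          Real.log_inv]
        ring
      rw [h1]
      simp only [φ]
      rw [hqx] at hqs' ⊢
      linarith
    | some j =>
      have hxE := hι2 x j hιx
      have hprod : 0 < ∏ i : Fin N, θ j i (ω i) := Finset.prod_pos fun i _ => hθpos j i (ω i)
      have h1 : -Real.log (qq (some j) ω) = Real.log 2 + -Real.log (q j) +
          ∑ i : Fin N, -Real.log (θ j i (ω i)) := by
        simp only [qq]
        rw [Real.log_mul (by norm_num) (mul_pos (hq j) hprod).ne', Real.log_mul (hq j).ne' hprod.ne',
          Real.log_prod (s := Finset.univ) (f := fun i : Fin N => θ j i (ω i)) (fun i _ => (hθpos j i (ω i)).ne'), one_div, Real.log_inv,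
          Finset.sum_neg_distrib]
        ring
      have h2 : ∑ i : Fin N, -Real.log (θ j i (ω i)) ≤
          ∑ i : Fin N, (-Real.log (1 - r) + Real.log (k / r) * (bd (T^[i] x) + tail i)) :=
        Finset.sum_le_sum fun i _ => hθ j x hxE i i.2 (ω i) (Set.mem_iInter.1 hx i)
      rw [Fin.sum_univ_eq_sum_range (fun i => -Real.log (1 - r) + Real.log (k / r) * (bd (T^[i] x) + tail i)),
        Finset.sum_add_distrib, ← Finset.mul_sum, Finset.sum_add_distrib] at h2
      simp only [Finset.sum_const, Finset.card_range, nsmul_eq_mul] at h2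
      have h3 := ha j x hxE
      have h4 := mul_le_mul_of_nonneg_left htail hlogkr
      rw [h1]
      simp only [φ]
      nlinarith

/-! ### Part 10: entropy bound from codings at all times -/

/-- existence of good codings for a map at all times -/
def Coding {X : Type} [TopologicalSpace X] (T : X → X) (t : ℕ) (f : X → ℝ) (β C : ℝ) : Prop :=
  ∀ (k : ℕ) (K : Fin k → Set X), (∀ i, IsCompact (K i)) → Pairwise (Function.onFun Disjoint K) →
    ∀ Q : Set X, IsCompact Q → ∃ c1 : ℝ, 0 ≤ c1 ∧ ∃ l0 : ℕ, ∀ L : ℕ,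
      ∃ (J : Type) (_ : Fintype J) (q : J → ℝ) (E : J → Set X),
        (∀ j, 0 < q j) ∧ ∑ j, q j ≤ 1 ∧ (∀ j, IsCompact (E j)) ∧ (∀ x ∈ Q, ∃ j, x ∈ E j) ∧
        (∀ j, ∀ x ∈ E j, -Real.log (q j) ≤ c1 + L * β + C * ∑ l ∈ Finset.range L, f (T^[t * l] x)) ∧
        (∀ j, ∀ x ∈ E j, ∀ x' ∈ E j, ∀ i : ℕ, i + l0 ≤ t * L → ∀ a b, T^[i] x ∈ K a → T^[i] x' ∈ K b →
          a = b)

lemma partEnt_nonneg {X : Type*} [MeasurableSpace X] (μ : Measure X) [IsProbabilityMeasure μ]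
    {ι : Type*} [Fintype ι] (P : ι → Set X) : 0 ≤ partEnt μ P := by
  apply Finset.sum_nonneg; intro i _
  apply Real.negMulLog_nonneg ENNReal.toReal_nonneg
  exact ENNReal.toReal_le_of_le_ofReal zero_le_one (by simpa using prob_le_one)

lemma ent_bound (d : ℕ) (T : XSp d → XSp d) (t : ℕ) (ht : 1 ≤ t) (f : XSp d → ℝ)
    (hfc : Continuous f) (hf0 : ∀ x, 0 ≤ f x) (hf1 : ∀ x, f x ≤ 1) (β C : ℝ) (hβ : 0 ≤ β)
    (hC : 0 ≤ C) (hcod : Coding T t f β C) (μ : Measure (XSp d)) [IsProbabilityMeasure μ]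
    (hT : MeasurePreserving T μ μ) {k : ℕ} (P : Fin k → Set (XSp d)) (hP : IsFinPart P) :
    ⨅ N : ℕ, partEnt μ (joinPart T P (N + 1)) / (N + 1) ≤ (β + C * ∫ x, f x ∂μ) / t := by
  have hk : 0 < k := by
    rcases Nat.eq_zero_or_pos k with h | h
    · exfalso
      subst h
      have h1 := hP.2.2
      rw [Set.iUnion_of_empty] at h1
      have h2 : μ Set.univ = 1 := measure_univ
      rw [← h1] at h2
      simp at h2
    · exact h
  have hk1 : (1 : ℝ) ≤ k := by exact_mod_cast hk
  have hlogk : 0 ≤ Real.log k := Real.log_nonneg hk1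
  have ht0 : (0 : ℝ) < t := by exact_mod_cast ht
  have hbdd : BddBelow (Set.range fun N : ℕ => partEnt μ (joinPart T P (N + 1)) / ((N : ℝ) + 1)) := by
    refine ⟨0, ?_⟩
    rintro _ ⟨N, rfl⟩
    exact div_nonneg (partEnt_nonneg μ _) (by positivity)
  apply _root_.le_of_forall_pos_le_add
  intro δ hδ
  -- choose r
  obtain ⟨r, hr0, hr1, hr⟩ : ∃ r : ℝ, 0 < r ∧ r < 1 ∧ -Real.log (1 - r) ≤ δ / 3 := by
    refine ⟨1 - Real.exp (-(δ / 3)), ?_, ?_, ?_⟩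
    · have : Real.exp (-(δ / 3)) < 1 := Real.exp_lt_one_iff.2 (by linarith)
      linarith
    · have := Real.exp_pos (-(δ / 3)); linarith
    · rw [_root_.sub_sub_cancel, Real.log_exp]; linarith
  have hlogkr : 0 ≤ Real.log (k / r) := Real.log_nonneg (by rw [le_div_iff₀ hr0]; linarith)
  set η : ℝ := (δ / 3) / (1 + Real.log k + k * Real.log (k / r)) with hη
  have hden : 0 < 1 + Real.log k + k * Real.log (k / r) := by positivity
  have hη0 : 0 < η := by positivity
  have hη1 : η * (Real.log k + k * Real.log (k / r)) ≤ δ / 3 := by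
    rw [hη, div_mul_eq_mul_div, div_le_iff₀ hden]
    nlinarith
  choose K hKP hKc hKμ using fun i => X_inner d μ (P i) (hP.1 i) η hη0
  obtain ⟨Q, -, hQc, hQμ⟩ := X_inner d μ Set.univ MeasurableSet.univ η hη0
  rw [← Set.compl_eq_univ_sdiff] at hQμ
  have hKd : Pairwise (Function.onFun Disjoint K) := fun i j hij =>
    (hP.2.1 hij).mono (hKP i) (hKP j)
  obtain ⟨c1, hc1, l0, hL⟩ := hcod k K hKc hKd Q hQc
  set c2 := Real.log 2 + c1 + l0 * Real.log (k / r) with hc2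
  obtain ⟨L, hL1⟩ := exists_nat_gt (c2 / (δ / 3))
  obtain ⟨L, hL0, hLc⟩ : ∃ L : ℕ, 1 ≤ L ∧ c2 ≤ L * (δ / 3) := by
    refine ⟨L + 1, by omega, ?_⟩
    rw [div_lt_iff₀ (by positivity)] at hL1
    push_cast
    nlinarith
  obtain ⟨J, hJ, q, E, hq, hqs, hE, hEQ, ha, hb⟩ := hL L
  have hent := ent_fin μ T hT hk P hP t L (t * L) rfl K (fun i => (hKc i).measurableSet) hKP η
    (fun i => (hKμ i).le) Q hQc.measurableSet hQμ.le f hfc.measurable hf0 hf1 c1 β C hc1 hβ hC l0 q hq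
    hqs E (fun j => (hE j).measurableSet) hEQ ha hb r hr0 hr1
  obtain ⟨N, hN⟩ : ∃ N, t * L = N + 1 := ⟨t * L - 1, by have := Nat.mul_pos ht hL0; omega⟩
  refine (ciInf_le hbdd N).trans ?_
  have hNr : ((N : ℝ) + 1) = t * L := by exact_mod_cast hN.symm
  rw [← hN, hNr]
  have hLr : (1 : ℝ) ≤ L := by exact_mod_cast hL0
  have htr : (1 : ℝ) ≤ t := by exact_mod_cast ht
  rw [div_le_iff₀ (by positivity)]
  refine hent.trans ?_
  push_cast
  have e1 : ((β + C * ∫ x, f x ∂μ) / t + δ) * (t * L) =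
      L * β + C * (L * ∫ x, f x ∂μ) + t * L * δ := by
    field_simp
  rw [e1]
  have h1 : t * L * -Real.log (1 - r) ≤ t * L * (δ / 3) := mul_le_mul_of_nonneg_left hr (by positivity)
  have h2 : t * L * (η * (Real.log k + k * Real.log (k / r))) ≤ t * L * (δ / 3) :=
    mul_le_mul_of_nonneg_left hη1 (by positivity)
  have h3 : L * (δ / 3) ≤ t * L * (δ / 3) := by
    apply mul_le_mul_of_nonneg_right _ (by positivity)
    nlinarith
  have h4 : c2 ≤ t * L * (δ / 3) := hLc.trans h3
  rw [hc2] at h4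
  linarith

/-! ### Part 11: local product structure -/

lemma nhds_entry {d : ℕ} (p : Matrix.SpecialLinearGroup (Fin d) ℝ → Prop)
    (hp : ∀ᶠ g : Matrix.SpecialLinearGroup (Fin d) ℝ in 𝓝 1, p g) :
    ∃ r : ℝ, 0 < r ∧ ∀ g : Matrix.SpecialLinearGroup (Fin d) ℝ,
      (∀ i j, |(g : Matrix (Fin d) (Fin d) ℝ) i j - (1 : Matrix (Fin d) (Fin d) ℝ) i j| ≤ r) → p g := by
  rw [(SL_emb d).isInducing.nhds_eq_comap, Filter.eventually_comap] at hp
  have hp' : ∀ᶠ b : Fin d → Fin d → ℝ in 𝓝 (fun i j => (1 : Matrix (Fin d) (Fin d) ℝ) i j),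
    ∀ a : Matrix.SpecialLinearGroup (Fin d) ℝ, (a : Matrix (Fin d) (Fin d) ℝ) = b → p a := hp
  obtain ⟨r, hr, hball⟩ := Metric.nhds_basis_closedBall.eventually_iff.1 hp'
  refine ⟨r, hr, fun g hg => ?_⟩
  refine hball (x := fun i j => (g : Matrix (Fin d) (Fin d) ℝ) i j) ?_ g rfl
  rw [Metric.mem_closedBall, dist_pi_le_iff hr.le]
  intro i
  rw [dist_pi_le_iff hr.le]
  intro j
  rw [Real.dist_eq]
  exact hg i j

lemma entry_nhds {d : ℕ} (r : ℝ) (hr : 0 < r) :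
    ∀ᶠ g : Matrix.SpecialLinearGroup (Fin d) ℝ in 𝓝 1,
      ∀ i j, |(g : Matrix (Fin d) (Fin d) ℝ) i j - (1 : Matrix (Fin d) (Fin d) ℝ) i j| ≤ r := by
  rw [Filter.eventually_all]; intro i
  rw [Filter.eventually_all]; intro j
  have hc : Continuous (fun g : Matrix.SpecialLinearGroup (Fin d) ℝ =>
      |(g : Matrix (Fin d) (Fin d) ℝ) i j - (1 : Matrix (Fin d) (Fin d) ℝ) i j|) :=
    (((continuous_apply_apply (ρ := fun _ _ => ℝ) i j).comp (SL_emb d).continuous).sub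
      continuous_const).abs
  have h1 := hc.tendsto 1
  have h2 : |((1 : Matrix.SpecialLinearGroup (Fin d) ℝ) : Matrix (Fin d) (Fin d) ℝ) i j -
      (1 : Matrix (Fin d) (Fin d) ℝ) i j| = 0 := by simp
  rw [h2] at h1
  exact (h1.eventually (Iic_mem_nhds hr))

/-- the weakly contracted directions, close to the identity -/
def Pm (m n : ℕ) (r : ℝ) : Set (Matrix.SpecialLinearGroup (Fin (m + n)) ℝ) :=
  {p | (∀ i j, |(p : Matrix (Fin (m + n)) (Fin (m + n)) ℝ) i j - (1 : Matrix (Fin (m + n)) (Fin (m + n)) ℝ) i j| ≤ r) ∧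
    ∀ (a : Fin m) (b : Fin n), (p : Matrix (Fin (m + n)) (Fin (m + n)) ℝ) (Fin.castAdd n a) (Fin.natAdd m b) = 0}

lemma SL_entry_cont {d : ℕ} (i j : Fin d) : Continuous
    (fun g : Matrix.SpecialLinearGroup (Fin d) ℝ => (g : Matrix (Fin d) (Fin d) ℝ) i j) :=
  (continuous_apply_apply (ρ := fun _ _ => ℝ) i j).comp (SL_emb d).continuous

lemma Pm_compact (m n : ℕ) (r : ℝ) : IsCompact (Pm m n r) := by
  apply (SL_bdd_compact (m + n) (r + 1)).of_isClosed_subset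
  · have : Pm m n r = (⋂ i, ⋂ j, {p : Matrix.SpecialLinearGroup (Fin (m + n)) ℝ | |(p : Matrix (Fin (m + n)) (Fin (m + n)) ℝ) i j -
        (1 : Matrix (Fin (m + n)) (Fin (m + n)) ℝ) i j| ≤ r}) ∩ ⋂ (a : Fin m), ⋂ (b : Fin n),
        {p : Matrix.SpecialLinearGroup (Fin (m + n)) ℝ | (p : Matrix (Fin (m + n)) (Fin (m + n)) ℝ) (Fin.castAdd n a) (Fin.natAdd m b) = 0} := by
      ext p; simp [Pm]
    rw [this]
    apply IsClosed.inter
    · refine isClosed_iInter fun i => isClosed_iInter fun j => ?_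
      exact isClosed_le ((SL_entry_cont i j).sub continuous_const).abs continuous_const
    · refine isClosed_iInter fun i => isClosed_iInter fun j => ?_
      exact isClosed_eq (SL_entry_cont _ _) continuous_const
  · intro p hp i j
    have h1 := hp.1 i j
    have h2 : |(1 : Matrix (Fin (m + n)) (Fin (m + n)) ℝ) i j| ≤ 1 := by
      rw [Matrix.one_apply]; split_ifs <;> simp
    have h3 := abs_add_le ((p : Matrix (Fin (m + n)) (Fin (m + n)) ℝ) i j -
      (1 : Matrix (Fin (m + n)) (Fin (m + n)) ℝ) i j) ((1 : Matrix (Fin (m + n)) (Fin (m + n)) ℝ) i j)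
    rw [sub_add_cancel] at h3
    linarith

lemma aMat_diag (m n : ℕ) (s : ℝ) : aMat m n s = Matrix.diagonal
    (Fin.addCases (motive := fun _ => ℝ) (fun _ : Fin m => Real.exp (s / m))
      (fun _ : Fin n => Real.exp (-(s / n)))) := by
  ext i j
  refine Fin.addCases (fun a => ?_) (fun a => ?_) i <;>
  refine Fin.addCases (fun a' => ?_) (fun a' => ?_) j <;>
  simp [aMat, Matrix.one_apply, Matrix.diagonal_apply] <;>
  (intro h; have := congrArg Fin.val h; simp at this; omega)

lemma aSL_mul (m n : ℕ) (hm : 0 < m) (hn : 0 < n) (s t : ℝ) :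
    aSL m n hm hn s * aSL m n hm hn t = aSL m n hm hn (s + t) :=
  Subtype.ext (aMat_mul m n s t)

lemma aSL_zero (m n : ℕ) (hm : 0 < m) (hn : 0 < n) : aSL m n hm hn 0 = 1 :=
  Subtype.ext (aMat_zero m n)

lemma aSL_neg (m n : ℕ) (hm : 0 < m) (hn : 0 < n) (s : ℝ) :
    (aSL m n hm hn s)⁻¹ = aSL m n hm hn (-s) := by
  rw [inv_eq_iff_mul_eq_one, aSL_mul, add_neg_cancel, aSL_zero]

lemma aSL_uSL (m n : ℕ) (hm : 0 < m) (hn : 0 < n) (s : ℝ) (A : Fin m → Fin n → ℝ) :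
    aSL m n hm hn s * uSL m n A = uSL m n (Real.exp (s / m + s / n) • A) * aSL m n hm hn s :=
  Subtype.ext (aMat_uMat m n s A)

lemma uSL_mul (m n : ℕ) (A A' : Fin m → Fin n → ℝ) : uSL m n A * uSL m n A' = uSL m n (A + A') :=
  Subtype.ext (uMat_mul m n A A')

lemma uSL_zero (m n : ℕ) : uSL m n 0 = 1 := Subtype.ext (uMat_zero m n)

lemma uSL_neg (m n : ℕ) (A : Fin m → Fin n → ℝ) : (uSL m n A)⁻¹ = uSL m n (-A) := by
  rw [inv_eq_iff_mul_eq_one, uSL_mul, add_neg_cancel, uSL_zero]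

lemma Pm_conj (m n : ℕ) (hm : 0 < m) (hn : 0 < n) (r s : ℝ) (hs : 0 ≤ s)
    (p : Matrix.SpecialLinearGroup (Fin (m + n)) ℝ) (hp : p ∈ Pm m n r) :
    aSL m n hm hn s * p * (aSL m n hm hn s)⁻¹ ∈ Pm m n r := by
  rw [aSL_neg]
  have hent : ∀ i j, ((aSL m n hm hn s * p * aSL m n hm hn (-s) :
      Matrix.SpecialLinearGroup (Fin (m + n)) ℝ) : Matrix (Fin (m + n)) (Fin (m + n)) ℝ) i j =
      (Fin.addCases (motive := fun _ => ℝ) (fun _ : Fin m => Real.exp (s / m))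
      (fun _ : Fin n => Real.exp (-(s / n))) i) * (p : Matrix (Fin (m + n)) (Fin (m + n)) ℝ) i j *
      (Fin.addCases (motive := fun _ => ℝ) (fun _ : Fin m => Real.exp (-s / m))
      (fun _ : Fin n => Real.exp (-(-s / n))) j) := by
    intro i j
    show (aMat m n s * (p : Matrix (Fin (m + n)) (Fin (m + n)) ℝ) * aMat m n (-s)) i j = _
    rw [aMat_diag, aMat_diag, Matrix.mul_diagonal, Matrix.diagonal_mul]
  constructor
  · intro i j
    rw [hent]
    have h0 := hp.1 i j
    revert h0
    refine Fin.addCases (fun a => ?_) (fun a => ?_) i <;>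
    refine Fin.addCases (fun a' => ?_) (fun a' => ?_) j <;>
    intro h0 <;>
    simp only [Fin.addCases_left, Fin.addCases_right]
    · have : ∀ x : ℝ, Real.exp (s / m) * x * Real.exp (-s / m) = x := fun x => by
        rw [mul_right_comm, ← Real.exp_add, neg_div, add_neg_cancel, Real.exp_zero, one_mul]
      rw [this]; exact h0
    · rw [hp.2] at h0 ⊢
      simpa using h0
    · have h1 : (1 : Matrix (Fin (m + n)) (Fin (m + n)) ℝ) (Fin.natAdd m a) (Fin.castAdd n a') = 0 := by
        apply Matrix.one_apply_ne
        intro h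
        have := congrArg Fin.val h
        simp at this; omega
      rw [h1, sub_zero] at h0 ⊢
      rw [abs_mul, abs_mul, abs_of_pos (Real.exp_pos _), abs_of_pos (Real.exp_pos _)]
      have h2 : Real.exp (-(s / n)) ≤ 1 := Real.exp_le_one_iff.2 (by
        have : 0 ≤ s / n := by positivity
        linarith)
      have h3 : Real.exp (-s / m) ≤ 1 := Real.exp_le_one_iff.2 (by
        rw [neg_div]
        have : 0 ≤ s / m := by positivity
        linarith)
      refine le_trans ?_ h0
      calc _ ≤ 1 * |(p : Matrix (Fin (m + n)) (Fin (m + n)) ℝ) (Fin.natAdd m a) (Fin.castAdd n a')| * 1 := by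
            gcongr
        _ = _ := by ring
    · have : ∀ x : ℝ, Real.exp (-(s / n)) * x * Real.exp (-(-s / n)) = x := fun x => by
        rw [mul_right_comm, ← Real.exp_add, neg_div, add_neg_cancel, Real.exp_zero, one_mul]
      rw [this]; exact h0
  · intro a b
    rw [hent, hp.2]; simp

lemma uSL_cont (m n : ℕ) : Continuous (uSL m n) := by
  rw [(SL_emb (m + n)).isInducing.continuous_iff]
  show Continuous (fun A => uMat m n A)
  refine continuous_matrix ?_
  intro i j
  refine Fin.addCases (fun a => ?_) (fun a => ?_) i <;>
  refine Fin.addCases (fun a' => ?_) (fun a' => ?_) j <;>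
  simp only [uMat, Matrix.reindex_apply, Matrix.submatrix_apply, finSumFinEquiv_symm_apply_castAdd,
    finSumFinEquiv_symm_apply_natAdd, Matrix.fromBlocks_apply₁₁, Matrix.fromBlocks_apply₁₂,
    Matrix.fromBlocks_apply₂₁, Matrix.fromBlocks_apply₂₂, Matrix.of_apply]
  · exact continuous_const
  · fun_prop
  · exact continuous_const
  · exact continuous_const

/-- the chart: near the identity every element is `p * u_A` -/
lemma chart (m n : ℕ) (r : ℝ) (hr : 0 < r) :
    ∀ᶠ g : Matrix.SpecialLinearGroup (Fin (m + n)) ℝ in 𝓝 1,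
      ∃ p ∈ Pm m n r, ∃ A : Fin m → Fin n → ℝ, ‖A‖ ≤ 1 ∧ g = p * uSL m n A := by
  let al : Matrix.SpecialLinearGroup (Fin (m + n)) ℝ → Matrix (Fin m) (Fin m) ℝ := fun g =>
    Matrix.of fun i j => (g : Matrix (Fin (m + n)) (Fin (m + n)) ℝ) (Fin.castAdd n i) (Fin.castAdd n j)
  let be : Matrix.SpecialLinearGroup (Fin (m + n)) ℝ → Matrix (Fin m) (Fin n) ℝ := fun g =>
    Matrix.of fun i j => (g : Matrix (Fin (m + n)) (Fin (m + n)) ℝ) (Fin.castAdd n i) (Fin.natAdd m j)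
  have hal : Continuous al := continuous_matrix fun i j => SL_entry_cont _ _
  have hbe : Continuous be := continuous_matrix fun i j => SL_entry_cont _ _
  have hal1 : al 1 = 1 := by
    ext i j; simp [al, Matrix.one_apply]
  have hbe1 : be 1 = 0 := by
    ext i j
    simp only [be, Matrix.of_apply, Matrix.SpecialLinearGroup.coe_one]
    apply Matrix.one_apply_ne
    intro h
    have := congrArg Fin.val h
    simp at this; omega
  let Af : Matrix.SpecialLinearGroup (Fin (m + n)) ℝ → (Fin m → Fin n → ℝ) := fun g =>
    fun i j => ((al g).det)⁻¹ * ((al g).adjugate * be g) i j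
  have hdet1 : (al 1).det ≠ 0 := by rw [hal1]; simp
  have hdetc : Continuous fun g => (al g).det := Continuous.matrix_det hal
  have hAf : ContinuousAt Af 1 := by
    rw [continuousAt_pi]; intro i
    rw [continuousAt_pi]; intro j
    refine (hdetc.continuousAt.inv₀ hdet1).mul ?_
    have : Continuous fun g => (al g).adjugate * be g := (Continuous.matrix_adjugate hal).matrix_mul hbe
    exact ((continuous_apply_apply (ρ := fun _ _ => ℝ) i j).comp this).continuousAt
  have hAf1 : Af 1 = 0 := by
    ext i j; simp [Af, hbe1]
  have hpf : ContinuousAt (fun g => g * uSL m n (-(Af g))) 1 :=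
    continuousAt_id.mul ((uSL_cont m n).continuousAt.comp hAf.neg)
  have e1 : ∀ᶠ g : Matrix.SpecialLinearGroup (Fin (m + n)) ℝ in 𝓝 1, (al g).det ≠ 0 :=
    hdetc.continuousAt.eventually_ne hdet1
  have e2 : ∀ᶠ g : Matrix.SpecialLinearGroup (Fin (m + n)) ℝ in 𝓝 1, ‖Af g‖ ≤ 1 := by
    have h1 : Tendsto (fun g => ‖Af g‖) (𝓝 1) (𝓝 0) := by
      have := hAf.norm.tendsto
      rwa [hAf1, norm_zero] at this
    exact h1.eventually (Iic_mem_nhds one_pos)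
  have e3 : ∀ᶠ g : Matrix.SpecialLinearGroup (Fin (m + n)) ℝ in 𝓝 1, ∀ i j,
      |((g * uSL m n (-(Af g)) : Matrix.SpecialLinearGroup (Fin (m + n)) ℝ) : Matrix (Fin (m + n)) (Fin (m + n)) ℝ) i j -
        (1 : Matrix (Fin (m + n)) (Fin (m + n)) ℝ) i j| ≤ r := by
    have h1 := hpf.tendsto
    rw [hAf1, neg_zero, uSL_zero, mul_one] at h1
    exact h1.eventually (entry_nhds r hr)
  filter_upwards [e1, e2, e3] with g h1 h2 h3
  refine ⟨g * uSL m n (-(Af g)), ⟨h3, ?_⟩, Af g, h2, ?_⟩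
  · intro a b
    have h4 : al g * Matrix.of (Af g) = be g := by
      have : Matrix.of (Af g) = ((al g).det)⁻¹ • ((al g).adjugate * be g) := by
        ext i j; simp [Af]
      rw [this, Matrix.mul_smul, ← Matrix.mul_assoc, Matrix.mul_adjugate, Matrix.smul_mul,
        Matrix.one_mul, smul_smul, inv_mul_cancel₀ h1, one_smul]
    have h5 := congrFun (congrFun h4 a) b
    rw [Matrix.mul_apply] at h5
    show ((g : Matrix (Fin (m + n)) (Fin (m + n)) ℝ) * uMat m n (-(Af g))) _ _ = 0
    rw [Matrix.mul_apply, Fin.sum_univ_add]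
    simp only [al, be, Matrix.of_apply] at h5
    simp [uMat, Matrix.one_apply, h5]
  · rw [mul_assoc, uSL_mul, neg_add_cancel, uSL_zero, mul_one]

/-- separation of compact sets by small group elements -/
lemma separate (d k : ℕ) (K : Fin k → Set (XSp d)) (hK : ∀ i, IsCompact (K i))
    (hd : Pairwise (Function.onFun Disjoint K)) :
    ∀ᶠ v : Matrix.SpecialLinearGroup (Fin d) ℝ in 𝓝 1, ∀ a b, ∀ x ∈ K a, v • x ∈ K b → a = b := by
  rw [Filter.eventually_all]; intro a
  rw [Filter.eventually_all]; intro b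
  by_cases hab : a = b
  · exact Filter.Eventually.of_forall fun _ _ _ _ => hab
  · have h1 : ∀ᶠ v : Matrix.SpecialLinearGroup (Fin d) ℝ in 𝓝 1, ∀ x ∈ K a, v • x ∈ (K b)ᶜ := by
      apply (hK a).eventually_forall_of_forall_eventually
      intro x hx
      have hc : Continuous (fun z : Matrix.SpecialLinearGroup (Fin d) ℝ × XSp d => z.1 • z.2) :=
        continuous_smul
      have h2 := hc.tendsto (1, x)
      rw [one_smul] at h2
      apply h2.eventually
      apply (hK b).isClosed.isOpen_compl.mem_nhds
      exact Set.disjoint_left.1 (hd hab) hx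
    filter_upwards [h1] with v hv x hx hvx
    exact absurd hvx (hv x hx)

/-! ### Part 12: codings for the diagonal flow -/

lemma aAct_iter (m n : ℕ) (hm : 0 < m) (hn : 0 < n) (i : ℕ)
    (g : Matrix.SpecialLinearGroup (Fin (m + n)) ℝ) :
    (aAct m n hm hn)^[i] (g : XSp (m + n)) =
      ((aSL m n hm hn i * g : Matrix.SpecialLinearGroup (Fin (m + n)) ℝ) : XSp (m + n)) := by
  induction i with
  | zero => simp [aSL_zero]
  | succ i ih =>
    rw [Function.iterate_succ_apply', ih]
    show ((aSL m n hm hn 1 * (aSL m n hm hn i * g) : Matrix.SpecialLinearGroup (Fin (m + n)) ℝ) :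
      XSp (m + n)) = _
    rw [← mul_assoc, aSL_mul]
    push_cast
    rw [add_comm (1 : ℝ) (i : ℝ)]

lemma sp_cont (m n : ℕ) : Continuous (fun z : Matrix.SpecialLinearGroup (Fin (m + n)) ℝ ×
      ((Fin m → Fin n → ℝ) × Matrix.SpecialLinearGroup (Fin (m + n)) ℝ) =>
      z.1 * uSL m n z.2.1 * z.2.2⁻¹) :=
  (continuous_fst.mul ((uSL_cont m n).comp (continuous_fst.comp continuous_snd))).mul
    (continuous_snd.comp continuous_snd).inv

lemma sp_tendsto (m n : ℕ) : Tendsto (fun z : Matrix.SpecialLinearGroup (Fin (m + n)) ℝ ×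
      ((Fin m → Fin n → ℝ) × Matrix.SpecialLinearGroup (Fin (m + n)) ℝ) =>
      z.1 * uSL m n z.2.1 * z.2.2⁻¹) (𝓝 1 ×ˢ (𝓝 0 ×ˢ 𝓝 1)) (𝓝 1) := by
  rw [← nhds_prod_eq, ← nhds_prod_eq]
  have h := (sp_cont m n).tendsto ((1 : Matrix.SpecialLinearGroup (Fin (m + n)) ℝ),
    ((0 : Fin m → Fin n → ℝ), (1 : Matrix.SpecialLinearGroup (Fin (m + n)) ℝ)))
  have e : (1 : Matrix.SpecialLinearGroup (Fin (m + n)) ℝ) * uSL m n 0 * 1⁻¹ = 1 := by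
    rw [uSL_zero, inv_one, one_mul, one_mul]
  have h' : Tendsto (fun z : Matrix.SpecialLinearGroup (Fin (m + n)) ℝ ×
      ((Fin m → Fin n → ℝ) × Matrix.SpecialLinearGroup (Fin (m + n)) ℝ) =>
      z.1 * uSL m n z.2.1 * z.2.2⁻¹) (𝓝 (1, 0, 1))
      (𝓝 ((1 : Matrix.SpecialLinearGroup (Fin (m + n)) ℝ) * uSL m n 0 * 1⁻¹)) := h
  rwa [e] at h'

lemma sp_abs {α β : Type*} (l : Filter α) (l' : Filter β) (φ : α × (β × α) → α)
    (h1 : Tendsto φ (l ×ˢ (l' ×ˢ l)) l) (p : α → Prop) (hp : ∀ᶠ v in l, p v) :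
    ∃ pa : α → Prop, (∀ᶠ v in l, pa v) ∧ ∃ pc : β → Prop, (∀ᶠ v in l', pc v) ∧
      ∃ pd : α → Prop, (∀ᶠ v in l, pd v) ∧ ∀ x y z, pa x → pc y → pd z → p (φ (x, (y, z))) := by
  have h2 := h1.eventually hp
  obtain ⟨pa, hpa, pb, hpb, h3⟩ := Filter.eventually_prod_iff.1 h2
  obtain ⟨pc, hpc, pd, hpd, h4⟩ := Filter.eventually_prod_iff.1 hpb
  exact ⟨pa, hpa, pc, hpc, pd, hpd, fun x y z hx hy hz => h3 hx (h4 hy hz)⟩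

lemma small_params (m n : ℕ) (p : Matrix.SpecialLinearGroup (Fin (m + n)) ℝ → Prop)
    (hp : ∀ᶠ v : Matrix.SpecialLinearGroup (Fin (m + n)) ℝ in 𝓝 1, p v) :
    ∃ r : ℝ, 0 < r ∧ ∃ s : ℝ, 0 < s ∧ ∀ p1 ∈ Pm m n r, ∀ p2 ∈ Pm m n r, ∀ B : Fin m → Fin n → ℝ,
      ‖B‖ ≤ s → p (p1 * uSL m n B * p2⁻¹) := by
  obtain ⟨pa, hpa, pc, hpc, pd, hpd, h4⟩ := sp_abs _ _ _ (sp_tendsto m n) p hp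
  obtain ⟨r1, hr1, h5⟩ := nhds_entry pa hpa
  obtain ⟨r2, hr2, h6⟩ := nhds_entry pd hpd
  obtain ⟨s, hs, h7⟩ := Metric.nhds_basis_closedBall.eventually_iff.1 hpc
  refine ⟨min r1 r2, lt_min hr1 hr2, s, hs, ?_⟩
  intro p1 hp1 p2 hp2 B hB
  have h8 : pc B := h7 (mem_closedBall_zero_iff.2 hB)
  have h9 : pd p2 := h6 p2 fun i j => (hp2.1 i j).trans (min_le_right _ _)
  have h10 : pa p1 := h5 p1 fun i j => (hp1.1 i j).trans (min_le_left _ _)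
  exact h4 p1 B p2 h10 h8 h9

lemma Pm_mono (m n : ℕ) (r r' : ℝ) (h : r ≤ r') : Pm m n r ⊆ Pm m n r' :=
  fun _ hp => ⟨fun i j => (hp.1 i j).trans h, hp.2⟩

lemma Pm_lam (m n : ℕ) (hm : 0 < m) (r : ℝ) (hr : r ≤ (2 * ((m + n : ℕ) : ℝ) ^ 2)⁻¹)
    (p : Matrix.SpecialLinearGroup (Fin (m + n)) ℝ) (hp : p ∈ Pm m n r)
    (h : Matrix (Fin (m + n)) (Fin (m + n)) ℝ) :
    lam h / 2 ≤ lam ((p : Matrix (Fin (m + n)) (Fin (m + n)) ℝ) * h) := by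
  have hd : 0 < m + n := by omega
  have hd' : (0 : ℝ) < ((m + n : ℕ) : ℝ) := by exact_mod_cast hd
  have h1 : nb ((p : Matrix (Fin (m + n)) (Fin (m + n)) ℝ) - 1) ≤ 1 / 2 := by
    refine (nb_le _ r fun i j => hp.1 i j).trans ?_
    calc _ ≤ ((m + n : ℕ) : ℝ) ^ 2 * (2 * ((m + n : ℕ) : ℝ) ^ 2)⁻¹ :=
          mul_le_mul_of_nonneg_left hr (by positivity)
      _ = 1 / 2 := by field_simp
  have h2 := lam_le_mul hd (p : Matrix (Fin (m + n)) (Fin (m + n)) ℝ) h 2 two_pos (by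
    intro v
    have h3 := nb_mulVec ((p : Matrix (Fin (m + n)) (Fin (m + n)) ℝ) - 1) v
    rw [Matrix.sub_mulVec, Matrix.one_mulVec] at h3
    have h4 := norm_sub_norm_le v ((p : Matrix (Fin (m + n)) (Fin (m + n)) ℝ) *ᵥ v)
    rw [norm_sub_rev] at h4
    have h5 := mul_le_mul_of_nonneg_right h1 (norm_nonneg v)
    linarith)
  linarith

lemma coding (m n : ℕ) (hm : 0 < m) (hn : 0 < n) (t : ℕ) (ε β C : ℝ)
    (hC : 0 ≤ C)
    (htree : ∀ (L : ℕ) (g : Matrix (Fin (m + n)) (Fin (m + n)) ℝ), g.det = 1 →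
      TreeAt m n (Real.exp (t / m + t / n)) ε β C t L g)
    (f : XSp (m + n) → ℝ) (hf0 : ∀ x, 0 ≤ f x)
    (hf : ∀ g : Matrix.SpecialLinearGroup (Fin (m + n)) ℝ,
      ε / 2 ≤ lam (g : Matrix (Fin (m + n)) (Fin (m + n)) ℝ) → f (g : XSp (m + n)) = 1) :
    Coding (aAct m n hm hn) t f β C := by
  classical
  intro k K hK hKd Q hQ
  obtain ⟨r0, hr0, s, hs, hsep⟩ := small_params m n _ (separate (m + n) k K hK hKd)
  have hd : 0 < m + n := by omega
  have hd' : (0 : ℝ) < ((m + n : ℕ) : ℝ) := by exact_mod_cast hd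
  set r := min r0 (2 * ((m + n : ℕ) : ℝ) ^ 2)⁻¹ with hr
  have hrpos : 0 < r := lt_min hr0 (by positivity)
  have hrr0 : Pm m n r ⊆ Pm m n r0 := Pm_mono m n _ _ (min_le_left _ _)
  -- covering of Q
  let W : Set (Matrix.SpecialLinearGroup (Fin (m + n)) ℝ) :=
    {g | ∃ p ∈ Pm m n r, ∃ A : Fin m → Fin n → ℝ, ‖A‖ ≤ 1 ∧ g = p * uSL m n A}
  have hW : W ∈ 𝓝 (1 : Matrix.SpecialLinearGroup (Fin (m + n)) ℝ) := chart m n r hrpos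
  let gx : XSp (m + n) → Matrix.SpecialLinearGroup (Fin (m + n)) ℝ := fun x => x.out
  have hgx : ∀ x, (gx x : XSp (m + n)) = x := fun x => QuotientGroup.out_eq' x
  obtain ⟨S, -, hS⟩ := hQ.elim_nhds_subcover
    (fun x => (fun w : Matrix.SpecialLinearGroup (Fin (m + n)) ℝ =>
      ((w * gx x : Matrix.SpecialLinearGroup (Fin (m + n)) ℝ) : XSp (m + n))) '' W) (by
    intro x _
    have hopen : IsOpenMap (fun w : Matrix.SpecialLinearGroup (Fin (m + n)) ℝ =>
        ((w * gx x : Matrix.SpecialLinearGroup (Fin (m + n)) ℝ) : XSp (m + n))) :=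
      (QuotientGroup.isOpenMap_coe (N := Gamma (m + n))).comp (isOpenMap_mul_right (gx x))
    have := hopen.image_mem_nhds hW
    rwa [one_mul, hgx] at this)
  have hwt : ∀ x, 0 ≤ Real.log (wt (gx x : Matrix (Fin (m + n)) (Fin (m + n)) ℝ)) := fun x =>
    Real.log_nonneg (wt_ge_one hm _ (gx x).det_coe)
  set c1 := Real.log S.card + ∑ x ∈ S, Real.log (wt (gx x : Matrix (Fin (m + n)) (Fin (m + n)) ℝ))
    with hc1
  set l1 : ℝ := 1 / m + 1 / n with hl1
  have hm' : (0 : ℝ) < m := by exact_mod_cast hm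
  have hn' : (0 : ℝ) < n := by exact_mod_cast hn
  have hl1pos : 0 < l1 := by positivity
  obtain ⟨l0, hl0⟩ : ∃ l0 : ℕ, 2 * Real.exp (-(l1 * l0)) ≤ s := by
    obtain ⟨l0, h⟩ := exists_nat_gt (-Real.log (s / 2) / l1)
    refine ⟨l0, ?_⟩
    rw [div_lt_iff₀ hl1pos] at h
    have h1 : -(l1 * l0) ≤ Real.log (s / 2) := by linarith
    have h2 := Real.exp_le_exp.2 h1
    rw [Real.exp_log (by positivity)] at h2
    linarith
  refine ⟨c1, ?_, l0, ?_⟩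
  · apply add_nonneg (Real.log_natCast_nonneg _)
    exact Finset.sum_nonneg fun x _ => hwt x
  intro L
  choose J hJ q D hq hqs hDc hDcov hDdiam hDball hDlog using
    fun x : {x // x ∈ S} => htree L (gx x.1) (gx x.1).det_coe
  refine ⟨Σ x : {x // x ∈ S}, J x, inferInstance, fun j => q j.1 j.2 / S.card,
    fun j => (fun z : Matrix.SpecialLinearGroup (Fin (m + n)) ℝ × (Fin m → Fin n → ℝ) =>
      ((z.1 * uSL m n z.2 * gx j.1.1 : Matrix.SpecialLinearGroup (Fin (m + n)) ℝ) : XSp (m + n))) ''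
      (Pm m n r ×ˢ D j.1 j.2), ?_, ?_, ?_, ?_, ?_, ?_⟩
  · rintro ⟨x, j⟩
    have : 0 < S.card := Finset.card_pos.2 ⟨x.1, x.2⟩
    exact div_pos (hq x j) (by exact_mod_cast this)
  · rw [Fintype.sum_sigma]
    simp only
    simp_rw [← Finset.sum_div]
    calc _ ≤ (∑ _x : {x // x ∈ S}, (1 : ℝ)) / S.card := by
          gcongr with x _
          exact hqs x
      _ ≤ 1 := by simp; exact div_self_le_one _
  · rintro ⟨x, j⟩
    apply ((Pm_compact m n r).prod (hDc x j)).image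
    have := uSL_cont m n
    have h2 : Continuous (fun z : Matrix.SpecialLinearGroup (Fin (m + n)) ℝ × (Fin m → Fin n → ℝ) =>
      z.1 * uSL m n z.2 * gx x.1) := by fun_prop
    exact QuotientGroup.continuous_mk.comp h2
  · intro y hy
    obtain ⟨x, hx, w, ⟨p, hp, A, hA, rfl⟩, rfl⟩ := Set.mem_iUnion₂.1 (hS hy)
    obtain ⟨j, hj⟩ := hDcov ⟨x, hx⟩ A hA
    exact ⟨⟨⟨x, hx⟩, j⟩, (p, A), ⟨hp, hj⟩, rfl⟩
  · rintro ⟨x, j⟩ _ ⟨⟨p, A⟩, ⟨hp, hA⟩, rfl⟩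
    have hcard : (0 : ℝ) < S.card := by
      exact_mod_cast Finset.card_pos.2 ⟨x.1, x.2⟩
    simp only at hA hp ⊢
    rw [Real.log_div (hq x j).ne' hcard.ne']
    have h1 := hDlog x j A hA
    have h2 : Real.log (wt (gx x.1 : Matrix (Fin (m + n)) (Fin (m + n)) ℝ)) ≤
        ∑ x ∈ S, Real.log (wt (gx x : Matrix (Fin (m + n)) (Fin (m + n)) ℝ)) :=
      Finset.single_le_sum (f := fun x => Real.log (wt (gx x : Matrix (Fin (m + n)) (Fin (m + n)) ℝ)))
        (fun x _ => hwt x) x.2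
    have h3 : ∑ l ∈ Finset.range L, Fth ε (aMat m n (t * l) * uMat m n A *
        (gx x.1 : Matrix (Fin (m + n)) (Fin (m + n)) ℝ)) ≤
        ∑ l ∈ Finset.range L, f ((aAct m n hm hn)^[t * l]
          ((p * uSL m n A * gx x.1 : Matrix.SpecialLinearGroup (Fin (m + n)) ℝ) : XSp (m + n))) := by
      apply Finset.sum_le_sum
      intro l _
      rw [Fth]
      split_ifs with hl
      · rw [aAct_iter]
        apply ge_of_eq
        apply hf
        have hp1 := Pm_conj m n hm hn r ((t * l : ℕ) : ℝ) (by positivity) p hp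
        set p1 := aSL m n hm hn ((t * l : ℕ) : ℝ) * p * (aSL m n hm hn ((t * l : ℕ) : ℝ))⁻¹ with hp1d
        have h4 : aSL m n hm hn ((t * l : ℕ) : ℝ) * (p * uSL m n A * gx x.1) =
            p1 * (aSL m n hm hn ((t * l : ℕ) : ℝ) * uSL m n A * gx x.1) := by
          rw [hp1d]; group
        rw [h4]
        have h5 := Pm_lam m n hm r (min_le_right _ _) p1 hp1
          ((aSL m n hm hn ((t * l : ℕ) : ℝ) * uSL m n A * gx x.1 :
            Matrix.SpecialLinearGroup (Fin (m + n)) ℝ) : Matrix (Fin (m + n)) (Fin (m + n)) ℝ)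
        have h6 : ((aSL m n hm hn ((t * l : ℕ) : ℝ) * uSL m n A * gx x.1 :
            Matrix.SpecialLinearGroup (Fin (m + n)) ℝ) : Matrix (Fin (m + n)) (Fin (m + n)) ℝ) =
            aMat m n (t * l) * uMat m n A * (gx x.1 : Matrix (Fin (m + n)) (Fin (m + n)) ℝ) := by
          show aMat m n ((t * l : ℕ) : ℝ) * uMat m n A * (gx x.1 : Matrix (Fin (m + n)) (Fin (m + n)) ℝ) = _
          push_cast; rfl
        rw [← h6] at hl
        rw [Matrix.SpecialLinearGroup.coe_mul]
        linarith
      · exact hf0 _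
    have h4 := mul_le_mul_of_nonneg_left h3 hC
    linarith
  · rintro ⟨x, j⟩ _ ⟨⟨p, A⟩, ⟨hp, hA⟩, rfl⟩ _ ⟨⟨p', A'⟩, ⟨hp', hA'⟩, rfl⟩ i hi a b ha hb
    simp only at hA hp hA' hp' ha hb
    rw [aAct_iter] at ha hb
    have hp1 := Pm_conj m n hm hn r (i : ℝ) (by positivity) p hp
    have hp1' := Pm_conj m n hm hn r (i : ℝ) (by positivity) p' hp'
    set p1 := aSL m n hm hn (i : ℝ) * p * (aSL m n hm hn (i : ℝ))⁻¹ with hp1d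
    set p1' := aSL m n hm hn (i : ℝ) * p' * (aSL m n hm hn (i : ℝ))⁻¹ with hp1d'
    set B : Fin m → Fin n → ℝ := Real.exp ((i : ℝ) / m + (i : ℝ) / n) • (A' - A) with hB
    have hconj : uSL m n B = aSL m n hm hn (i : ℝ) * uSL m n (A' - A) * (aSL m n hm hn (i : ℝ))⁻¹ := by
      rw [aSL_uSL, mul_inv_cancel_right]
    have hBs : ‖B‖ ≤ s := by
      rw [hB, norm_smul, Real.norm_eq_abs, abs_of_pos (Real.exp_pos _)]
      have h1 := hDdiam x j A' hA' A hA
      have h2 : Real.exp ((t : ℝ) / m + t / n) ^ L = Real.exp (l1 * (t * L)) := by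
        rw [← Real.exp_nat_mul]; congr 1; rw [hl1]; ring
      rw [h2] at h1
      have h3 : (i : ℝ) / m + (i : ℝ) / n = l1 * i := by rw [hl1]; ring
      rw [h3]
      have hir : (i : ℝ) + l0 ≤ t * L := by exact_mod_cast hi
      have h4 : l1 * i ≤ l1 * (t * L) + -(l1 * l0) := by nlinarith
      calc Real.exp (l1 * i) * ‖A' - A‖
          ≤ Real.exp (l1 * (t * L) + -(l1 * l0)) * ‖A' - A‖ :=
            mul_le_mul_of_nonneg_right (Real.exp_le_exp.2 h4) (norm_nonneg _)
        _ = (‖A' - A‖ * Real.exp (l1 * (t * L))) * Real.exp (-(l1 * l0)) := by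
            rw [Real.exp_add]; ring
        _ ≤ 2 * Real.exp (-(l1 * l0)) := mul_le_mul_of_nonneg_right h1 (Real.exp_pos _).le
        _ ≤ s := hl0
    have h5 := hsep p1' (hrr0 hp1') p1 (hrr0 hp1) B hBs a b _ ha
    apply h5
    have h6 : p1' * uSL m n B * p1⁻¹ * (aSL m n hm hn (i : ℝ) * (p * uSL m n A * gx x.1)) =
        aSL m n hm hn (i : ℝ) * (p' * uSL m n A' * gx x.1) := by
      have h7 : uSL m n A' = uSL m n (A' - A) * uSL m n A := by rw [uSL_mul, sub_add_cancel]
      rw [h7, hconj, hp1d, hp1d']; group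
    show (((p1' * uSL m n B * p1⁻¹) * (aSL m n hm hn (i : ℝ) * (p * uSL m n A * gx x.1)) :
      Matrix.SpecialLinearGroup (Fin (m + n)) ℝ) : XSp (m + n)) ∈ K b
    rw [h6]
    exact hb

/-! ### Part 13: conclusion -/

lemma choose_t (c δ : ℝ) (hδ : 0 < δ) : ∃ t : ℕ, 1 ≤ t ∧
    c + 2 * Real.log (1 + t) ≤ δ / 2 * t := by
  have h1 := Real.isLittleO_log_id_atTop.bound (show (0 : ℝ) < δ / 16 by positivity)
  have h2 : Tendsto (fun t : ℕ => (1 : ℝ) + t) atTop atTop :=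
    tendsto_atTop_add_const_left _ _ tendsto_natCast_atTop_atTop
  have h3 := h2.eventually h1
  have h4 : ∀ᶠ t : ℕ in atTop, c / (δ / 4) ≤ (t : ℝ) :=
    tendsto_natCast_atTop_atTop.eventually (eventually_ge_atTop _)
  obtain ⟨t, h5, h6, h7⟩ := (h3.and (h4.and (eventually_ge_atTop 1))).exists
  refine ⟨t, h7, ?_⟩
  have ht : (1 : ℝ) ≤ t := by exact_mod_cast h7
  rw [div_le_iff₀ (by positivity)] at h6
  simp only [id, Real.norm_eq_abs] at h5
  rw [abs_of_pos (show (0 : ℝ) < 1 + t by positivity)] at h5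
  have h8 := (le_abs_self _).trans h5
  nlinarith

lemma ks_nonneg {X : Type*} [MeasurableSpace X] (T : X → X) (μ : Measure X)
    [IsProbabilityMeasure μ] : 0 ≤ ksEntropy T μ := by
  refine Real.iSup_nonneg fun k => Real.iSup_nonneg fun P => Real.iSup_nonneg fun _ =>
    Real.iInf_nonneg fun N => div_nonneg (partEnt_nonneg μ _) (by positivity)

lemma main_bound (m n : ℕ) (hm : 0 < m) (hn : 0 < n)
    (μ : ℕ → Measure (XSp (m + n)))
    (hprob : ∀ k, IsProbabilityMeasure (μ k))
    (hinv : ∀ k, MeasurePreserving (aAct m n hm hn) (μ k) (μ k))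
    (hconv : ∀ f : XSp (m + n) → ℝ, Continuous f → HasCompactSupport f →
      Tendsto (fun k => ∫ x, f x ∂(μ k)) atTop (𝓝 0)) (δ : ℝ) (hδ : 0 < δ) :
    ∀ᶠ k in atTop, ksEntropy (aAct m n hm hn) (μ k) ≤ (m : ℝ) + n - 1 + δ := by
  have hm1 : (1 : ℝ) ≤ m := by exact_mod_cast hm
  have hn1 : (1 : ℝ) ≤ n := by exact_mod_cast hn
  obtain ⟨C0, hC0, hcon⟩ := contraction m n hm hn
  obtain ⟨t, ht, htb⟩ := choose_t (Real.log C0) δ hδ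
  have ht1 : (1 : ℝ) ≤ t := by exact_mod_cast ht
  obtain ⟨M, -, hM, W, C', hW, hC', hcon⟩ := hcon t ht
  set G : ℝ := C0 * ((1 + t) ^ 2 * Real.exp ((m + n - 1) * t)) with hG
  have hGp : 0 < G := by positivity
  have hlogG : Real.log G = Real.log C0 + 2 * Real.log (1 + t) + (m + n - 1) * t := by
    rw [hG, Real.log_mul (by positivity) (by positivity), Real.log_mul (by positivity)
      (by positivity), Real.log_exp, Real.log_pow]
    push_cast; ring
  have hβ : 0 ≤ Real.log G := by
    rw [hlogG]
    have := Real.log_nonneg hC0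
    have := Real.log_nonneg (show (1 : ℝ) ≤ 1 + t by linarith)
    have : 0 ≤ ((m : ℝ) + n - 1) * t := mul_nonneg (by linarith) (by linarith)
    linarith
  have hC := Real.log_nonneg hC'
  have hdp : (0 : ℝ) < ((m + n : ℕ) : ℝ) := by exact_mod_cast (by omega : 0 < m + n)
  have hε : 0 < (((m + n : ℕ) : ℝ) ^ 2 * W)⁻¹ := by positivity
  obtain ⟨f, hfc, hfs, hf0, hf1, hf⟩ := thick_fun (by omega : 0 < m + n) _ (half_pos hε)
  have hcod := coding m n hm hn t _ _ _ hC
    (fun L => tree m n hm hn t M G W C' hGp hW hC' hM hcon L) f hf0 hf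
  have hlim := (hconv f hfc hfs).const_mul (Real.log C')
  rw [mul_zero] at hlim
  filter_upwards [hlim.eventually (ge_mem_nhds (half_pos hδ))] with k hk
  haveI := hprob k
  have hnn : (0 : ℝ) ≤ (m : ℝ) + n - 1 + δ := by linarith
  refine Real.iSup_le (fun q => Real.iSup_le (fun P => Real.iSup_le (fun hP => ?_) hnn) hnn) hnn
  refine (ent_bound (m + n) _ t ht f hfc hf0 hf1 _ _ hβ hC hcod (μ k) (hinv k) P hP).trans ?_
  rw [div_le_iff₀ (by linarith), hlogG]
  nlinarith

/-- If a sequence of `a`-invariant probability measures on `X_{m+n}` converges weak* to the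
zero measure, then `limsup_k h_{μ_k}(a) ≤ m+n-1`. -/
theorem limsup_entropy_escape (m n : ℕ) (hm : 0 < m) (hn : 0 < n)
    (μ : ℕ → Measure (XSp (m + n)))
    (hprob : ∀ k, IsProbabilityMeasure (μ k))
    (hinv : ∀ k, MeasurePreserving (aAct m n hm hn) (μ k) (μ k))
    (hconv : ∀ f : XSp (m + n) → ℝ, Continuous f → HasCompactSupport f →
      Tendsto (fun k => ∫ x, f x ∂(μ k)) atTop (𝓝 0)) :
    limsup (fun k => ksEntropy (aAct m n hm hn) (μ k)) atTop ≤ (m : ℝ) + n - 1 := by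
  apply _root_.le_of_forall_pos_le_add
  intro δ hδ
  refine limsup_le_of_le ?_ (main_bound m n hm hn μ hprob hinv hconv δ hδ)
  refine isCoboundedUnder_le_of_le (x := 0) atTop fun k => ?_
  haveI := hprob k
  exact ks_nonneg _ _
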